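/- There exist constants ν₀ ∈ (0,1], ε₀ ∈ (0,1) and C > 0 with the following property. Let 0 < ν ≤ ν₀, k ∈ ℤ with |k| ≥ 1 and νk² ≤ 1, ε ∈ (0, ε₀], and λ ∈ ℝ. Let φ : [−1,1] → ℂ be four times continuously differentiable with φ(±1) = 0 and φ'(±1) = 0; set w = φ'' − k²φ, F(y) = −ν(w''(y) − k²w(y)) + ik(y−λ)w(y) − ε·ν^{1/3}|k|^{2/3}w(y), and ‖u‖_{L²} = (‖φ'‖_{L²}² + k²‖φ‖_{L²}²)^{1/2}. Then: (i) ν^{1/6}|k|^{5/6}‖w‖_{L¹} + ν^{5/12}|k|^{5/6}‖w‖_{L²} ≤ C‖F‖_{L²}; and (ii) if M ≥ 0 dominates F in H^{−1}, then ν^{3/4}|k|^{1/2}‖w‖_{L²} + ν^{2/3}|k|^{1/3}·(∫_{−1}^{1} ρ_k(y)|w(y)|²dy)^{1/2} + (νk²)^{1/2}‖u‖_{L²} ≤ C·M. -/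

import Mathlib

/-- The `L²` norm of a function on the interval `[-1,1]`. -/
noncomputable def nL2 (f : ℝ → ℂ) : ℝ :=
  (∫ y in Set.Icc (-1:ℝ) 1, ‖f y‖ ^ 2) ^ ((1:ℝ)/2)

/-- The `L¹` norm of a function on the interval `[-1,1]`. -/
noncomputable def nL1 (f : ℝ → ℂ) : ℝ :=
  ∫ y in Set.Icc (-1:ℝ) 1, ‖f y‖

/-- The `L²` pairing of two functions on the interval `[-1,1]`. -/
noncomputable def innI (f g : ℝ → ℂ) : ℂ :=
  ∫ y in Set.Icc (-1:ℝ) 1, f y * (starRingEnd ℂ) (g y)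

/-- `M ≥ 0` dominates `F` in `H^{-1}` : `|⟨F, φ⟩| ≤ M ‖φ‖_{H¹}` for every `C¹` function
vanishing at `±1`. -/
def Dominates (F : ℝ → ℂ) (M : ℝ) : Prop :=
  ∀ g : ℝ → ℂ, ContDiff ℝ 1 g → g (-1) = 0 → g 1 = 0 →
    ‖innI F g‖ ≤ M * ((nL2 g ^ 2 + nL2 (deriv g) ^ 2) ^ ((1:ℝ)/2))

/-- The boundary-layer weight `ρ_k` (depending on `L = (|k|/ν)^{1/3}`) on `[-1,1]`. -/
noncomputable def rhoW (L : ℝ) (y : ℝ) : ℝ :=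
  if y ≤ -1 + 1/L then L * (y + 1) else if y ≤ 1 - 1/L then 1 else L * (1 - y)

section Helpers

open Set Filter Topology MeasureTheory

/-- moments `∫₀^∞ η^k exp(-η³/3 + z η) dη`. -/
noncomputable def airM (k : ℕ) (z : ℂ) : ℂ :=
  ∫ x in Ioi (0:ℝ), ((x:ℂ)^k) * Complex.exp (-(x:ℂ)^3/3 + z * x)

/-- real dominating integrand -/
noncomputable def airD (k : ℕ) (R : ℝ) (x : ℝ) : ℝ := x^k * Real.exp (-x^3/3 + R*x)

lemma airD_integrable (k : ℕ) (R : ℝ) : IntegrableOn (airD k R) (Ioi 0) := by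
  have h1 : IntegrableOn (fun x : ℝ => Real.exp (4*(|R|+1)^2+0) * (Real.exp (-x) * x ^ ((k+1:ℝ)-1))) (Ioi 0) :=
    (Real.GammaIntegral_convergent (by positivity)).const_mul _
  refine Integrable.mono' h1 ?_ ?_
  · apply Continuous.aestronglyMeasurable
    unfold airD; fun_prop
  · filter_upwards [ae_restrict_mem measurableSet_Ioi] with x hx
    have hx : 0 < x := hx
    unfold airD
    rw [Real.norm_of_nonneg (by positivity)]
    have e1 : x ^ ((k+1:ℝ)-1) = x^k := by
      rw [show ((k+1:ℝ)-1) = (k:ℝ) by ring, Real.rpow_natCast]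
    rw [e1, ← mul_assoc, ← Real.exp_add, mul_comm]
    apply mul_le_mul_of_nonneg_right _ (by positivity)
    apply Real.exp_le_exp.2
    have hR := le_abs_self R
    have hR0 := abs_nonneg R
    set S := |R| + 1
    have : R * x ≤ (S-1) * x := by
      apply mul_le_mul_of_nonneg_right _ hx.le; simp only [S]; linarith
    by_cases h : x ≤ 4*S
    · nlinarith [pow_pos hx 3]
    · push Not at h
      have hS : 1 ≤ S := by simp only [S]; linarith
      have : 16*S^2*x ≤ x^3 := by
        have : (4*S)^2 ≤ x^2 := by gcongr
        nlinarith
      have : S * x ≤ S^2*x := by nlinarith [mul_pos hx (by linarith : 0 < S)]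
      nlinarith

lemma airM_norm_integrand (k : ℕ) (z : ℂ) (x : ℝ) (hx : 0 < x) :
    ‖((x:ℂ)^k) * Complex.exp (-(x:ℂ)^3/3 + z * x)‖ = airD k z.re x := by
  unfold airD
  rw [norm_mul, norm_pow, Complex.norm_exp, Complex.norm_real, Real.norm_of_nonneg hx.le]
  congr 2
  simp [← Complex.ofReal_pow, ← Complex.ofReal_neg]

lemma airD_mono (k : ℕ) {R S : ℝ} (h : R ≤ S) {x : ℝ} (hx : 0 < x) : airD k R x ≤ airD k S x := by
  unfold airD; gcongr

lemma airM_integrable (k : ℕ) (z : ℂ) :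
    IntegrableOn (fun x : ℝ => ((x:ℂ)^k) * Complex.exp (-(x:ℂ)^3/3 + z * x)) (Ioi 0) := by
  refine Integrable.mono' (airD_integrable k z.re) ?_ ?_
  · apply Continuous.aestronglyMeasurable
    fun_prop
  · filter_upwards [ae_restrict_mem measurableSet_Ioi] with x hx
    exact (airM_norm_integrand k z x hx).le

lemma airM_bound (k : ℕ) (z : ℂ) (R : ℝ) (h : z.re ≤ R) :
    ‖airM k z‖ ≤ ∫ x in Ioi (0:ℝ), airD k R x := by
  unfold airM
  refine (norm_integral_le_integral_norm _).trans ?_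
  apply setIntegral_mono_on (airM_integrable k z).norm (airD_integrable k R) measurableSet_Ioi
  intro x hx
  rw [airM_norm_integrand k z x hx]
  exact airD_mono k h hx

lemma airM_hasDerivAt (k : ℕ) (z : ℂ) : HasDerivAt (airM k) (airM (k+1) z) z := by
  unfold airM
  have := hasDerivAt_integral_of_dominated_loc_of_deriv_le (μ := volume.restrict (Ioi (0:ℝ)))
    (F := fun (z:ℂ) (x:ℝ) => ((x:ℂ)^k) * Complex.exp (-(x:ℂ)^3/3 + z * x))
    (F' := fun (z:ℂ) (x:ℝ) => ((x:ℂ)^(k+1)) * Complex.exp (-(x:ℂ)^3/3 + z * x))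
    (x₀ := z) (s := Metric.ball z 1) (bound := airD (k+1) (z.re+1)) (Metric.ball_mem_nhds z one_pos)
    ?_ ?_ ?_ ?_ ?_ ?_
  · exact this.2
  · exact Eventually.of_forall fun z => by
      apply Continuous.aestronglyMeasurable; fun_prop
  · exact airM_integrable k z
  · apply Continuous.aestronglyMeasurable; fun_prop
  · filter_upwards [ae_restrict_mem measurableSet_Ioi] with x hx y hy
    rw [airM_norm_integrand (k+1) y x hx]
    apply airD_mono _ _ hx
    have : |(y-z).re| ≤ ‖y - z‖ := Complex.abs_re_le_norm _
    rw [Metric.mem_ball, dist_eq_norm] at hy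
    have := le_abs_self (y-z).re
    simp at this ⊢
    simp at *
    linarith
  · exact airD_integrable _ _
  · refine Eventually.of_forall fun x y _ => ?_
    have h1 : HasDerivAt (fun z : ℂ => -(x:ℂ)^3/3 + z * x) (x:ℂ) y := by
      simpa using ((hasDerivAt_id y).mul_const (x:ℂ)).const_add (-(x:ℂ)^3/3)
    have h2 := (h1.cexp).const_mul ((x:ℂ)^k)
    exact h2.congr_deriv (by ring)

/-- decay at infinity of the integrand -/
lemma airD_tendsto (k : ℕ) (R : ℝ) : Tendsto (airD k R) atTop (𝓝 0) := by
  have h1 : Tendsto (fun x : ℝ => Real.exp (4*(|R|+1)^2) * (x ^ k * Real.exp (-x))) atTop (𝓝 0) := by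
    have := (Real.tendsto_pow_mul_exp_neg_atTop_nhds_zero k).const_mul (Real.exp (4*(|R|+1)^2))
    simpa using this
  refine squeeze_zero' ?_ ?_ h1
  · filter_upwards [eventually_gt_atTop 0] with x hx
    unfold airD; positivity
  · filter_upwards [eventually_gt_atTop 0] with x hx
    unfold airD
    rw [mul_left_comm, ← Real.exp_add]
    apply mul_le_mul_of_nonneg_left _ (by positivity)
    apply Real.exp_le_exp.2
    have hR := le_abs_self R
    have hR0 := abs_nonneg R
    set S := |R| + 1
    have : R * x ≤ (S-1) * x := by
      apply mul_le_mul_of_nonneg_right _ hx.le; simp only [S]; linarith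
    by_cases h : x ≤ 4*S
    · nlinarith [pow_pos hx 3]
    · push Not at h
      have hS : 1 ≤ S := by simp only [S]; linarith
      have : 16*S^2*x ≤ x^3 := by
        have : (4*S)^2 ≤ x^2 := by gcongr
        nlinarith
      have : S * x ≤ S^2*x := by nlinarith [mul_pos hx (by linarith : 0 < S)]
      nlinarith

lemma airM_rec (k : ℕ) (z : ℂ) :
    airM (k+2) z = z * airM k z + (if k = 0 then 1 else (k:ℂ) * airM (k-1) z) := by
  have hd : ∀ x : ℝ, HasDerivAt (fun x : ℝ => ((x:ℂ)^k) * Complex.exp (-(x:ℂ)^3/3 + z * x))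
      ((k:ℂ) * (x:ℂ)^(k-1) * Complex.exp (-(x:ℂ)^3/3 + z * x) +
        (x:ℂ)^k * ((-(x:ℂ)^2 + z) * Complex.exp (-(x:ℂ)^3/3 + z * x))) x := by
    intro x
    have h0 : HasDerivAt (fun x : ℝ => (x:ℂ)) 1 x := Complex.ofRealCLM.hasDerivAt
    have h3 : HasDerivAt (fun x : ℝ => -(x:ℂ)^3/3 + z * x) (-(x:ℂ)^2 + z) x := by
      have := ((h0.pow 3).neg.div_const 3).add (h0.const_mul z)
      exact this.congr_deriv (by push_cast; ring)
    have := (h0.pow k).mul h3.cexp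
    exact this.congr_deriv (by simp only [Pi.pow_apply]; ring)
  have hintg : IntegrableOn (fun x : ℝ => ((k:ℂ) * (x:ℂ)^(k-1) * Complex.exp (-(x:ℂ)^3/3 + z * x) +
        (x:ℂ)^k * ((-(x:ℂ)^2 + z) * Complex.exp (-(x:ℂ)^3/3 + z * x)))) (Ioi 0) := by
    have := (((airM_integrable (k-1) z).const_mul (k:ℂ)).add
      (((airM_integrable (k+2) z).const_mul (-1)).add ((airM_integrable k z).const_mul z)))
    refine this.congr (Eventually.of_forall fun x => ?_)
    simp only [Pi.add_apply]; ring
  have hI := integral_Ioi_of_hasDerivAt_of_tendsto' (m := 0) (fun x _ => hd x) hintg ?_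
  · have e : (∫ x in Ioi (0:ℝ), ((k:ℂ) * (x:ℂ)^(k-1) * Complex.exp (-(x:ℂ)^3/3 + z * x) +
        (x:ℂ)^k * ((-(x:ℂ)^2 + z) * Complex.exp (-(x:ℂ)^3/3 + z * x)))) =
        k * airM (k-1) z + (- airM (k+2) z + z * airM k z) := by
      unfold airM
      rw [← integral_const_mul, ← integral_const_mul, ← integral_neg, ← integral_add, ← integral_add]
      · apply integral_congr_ae
        refine Eventually.of_forall fun x => ?_
        simp only; ring
      · exact (airM_integrable (k-1) z).const_mul (k:ℂ)
      · exact (airM_integrable (k+2) z).neg.add ((airM_integrable k z).const_mul z)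
      · exact (airM_integrable (k+2) z).neg
      · exact ((airM_integrable k z).const_mul z)
    rw [e] at hI
    by_cases hk : k = 0
    · subst hk
      simp at hI ⊢
      linear_combination -hI
    · simp [hk] at hI ⊢
      linear_combination -hI
  · rw [tendsto_zero_iff_norm_tendsto_zero]
    refine (airD_tendsto k z.re).congr' ?_
    filter_upwards [eventually_gt_atTop 0] with x hx
    exact (airM_norm_integrand k z x hx).symm

noncomputable def airOm : ℂ := ⟨-1/2, -(Real.sqrt 3)/2⟩

lemma airOm_cube : airOm^3 = 1 := by
  have h3 : Real.sqrt 3 ^2 = 3 := Real.sq_sqrt (by norm_num)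
  have e : airOm ^ 2 = ⟨-1/2, (Real.sqrt 3)/2⟩ := by
    rw [pow_two, airOm]
    apply Complex.ext
    · simp; nlinarith
    · simp; ring
  rw [pow_succ, e, airOm]
  apply Complex.ext
  · simp; nlinarith
  · simp; ring

/-- the `k`-th derivative of the decaying (Airy) solution of `w'' = i y w`. -/
noncomputable def airW (k : ℕ) (y : ℂ) : ℂ :=
  (-Complex.I)^k * airM k (-Complex.I * y)
    - airOm * (-Complex.I * airOm)^k * airM k (-Complex.I * airOm * y)

lemma airW_hasDerivAt (k : ℕ) (y : ℂ) : HasDerivAt (airW k) (airW (k+1) y) y := by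
  have h1 : HasDerivAt (fun y : ℂ => -Complex.I * y) (-Complex.I) y := by
    simpa using (hasDerivAt_id y).const_mul (-Complex.I)
  have h2 : HasDerivAt (fun y : ℂ => -Complex.I * airOm * y) (-Complex.I * airOm) y := by
    simpa using (hasDerivAt_id y).const_mul (-Complex.I * airOm)
  have h3 := ((airM_hasDerivAt k (-Complex.I * y)).comp y h1).const_mul ((-Complex.I)^k)
  have h4 := ((airM_hasDerivAt k (-Complex.I * airOm * y)).comp y h2).const_mul
    (airOm * (-Complex.I * airOm)^k)
  refine (h3.sub h4).congr_deriv ?_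
  unfold airW
  ring

lemma airW_rec (k : ℕ) (y : ℂ) :
    airW (k+2) y = Complex.I * y * airW k y + Complex.I * k * airW (k-1) y := by
  unfold airW
  rw [airM_rec, airM_rec]
  have hI : Complex.I^2 = -1 := Complex.I_sq
  have ho := airOm_cube
  have hIo : (-Complex.I * airOm)^3 = Complex.I := by
    rw [mul_pow, ho, neg_pow, Complex.I_pow_three]; ring
  have hI3 : (-Complex.I)^3 = Complex.I := by
    rw [neg_pow, Complex.I_pow_three]; ring
  rcases k with _ | k
  · simp only [if_true, pow_zero, Nat.cast_zero]
    have : (-Complex.I)^2 = -1 := by rw [neg_sq, hI]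
    have h2 : airOm * (-Complex.I * airOm)^2 = -1 := by
      rw [mul_pow, this]; linear_combination -ho
    rw [zero_add, this, h2]
    linear_combination (Complex.I * airOm * y * airM 0 (-Complex.I * airOm * y)) * 0
  · simp only [Nat.succ_ne_zero, if_false, Nat.add_sub_cancel, if_neg]
    have e1 : (-Complex.I)^(k+1+2) = Complex.I * (-Complex.I)^k := by
      rw [show k+1+2 = k+3 by ring, pow_add, hI3]; ring
    have e2 : (-Complex.I*airOm)^(k+1+2) = Complex.I * (-Complex.I*airOm)^k := by
      rw [show k+1+2 = k+3 by ring, pow_add, hIo]; ring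
    rw [e1, e2]
    push_cast
    rw [pow_succ (-Complex.I) k, pow_succ (-Complex.I*airOm) k]
    ring_nf

lemma airW_two (y : ℂ) : airW 2 y = Complex.I * y * airW 0 y := by
  have := airW_rec 0 y
  simpa using this

/-- region of boundedness -/
def airS (R : ℝ) : Set ℂ := {y | y.im ≤ R ∧ -(Real.sqrt 3/2) * y.re - y.im/2 ≤ R}

lemma airW_bound (k : ℕ) (R : ℝ) : ∃ C, 0 ≤ C ∧ ∀ y ∈ airS R, ‖airW k y‖ ≤ C := by
  refine ⟨2 * (‖airOm‖+1)^(k+1) * ∫ x in Ioi (0:ℝ), airD k R x, ?_, ?_⟩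
  · have : 0 ≤ ∫ x in Ioi (0:ℝ), airD k R x := by
      apply setIntegral_nonneg measurableSet_Ioi
      intro x hx
      have : (0:ℝ) < x := hx
      unfold airD; positivity
    positivity
  · intro y hy
    have b1 := airM_bound k (-Complex.I * y) R (by simpa using hy.1)
    have b2 := airM_bound k (-Complex.I * airOm * y) R (by
      have := hy.2
      simp [airOm]
      linarith)
    have hn : 0 ≤ ‖airOm‖ := norm_nonneg _
    unfold airW
    refine (norm_sub_le _ _).trans ?_
    simp only [norm_mul, norm_pow, norm_neg, Complex.norm_I, one_pow, one_mul]
    have h1 : (1:ℝ) ≤ (‖airOm‖+1)^(k+1) := one_le_pow₀ (by linarith)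
    have h2 : ‖airOm‖ * ‖airOm‖^k ≤ (‖airOm‖+1)^(k+1) := by
      rw [← pow_succ']; gcongr; linarith
    have := norm_nonneg (airM k (-Complex.I * y))
    have := norm_nonneg (airM k (-Complex.I * airOm * y))
    nlinarith [mul_le_mul h2 b2 (by positivity) (by positivity), mul_le_mul h1 b1 (by positivity) (by positivity)]

lemma airW_decay (p : ℕ) (R : ℝ) : ∀ k, ∃ C, 0 ≤ C ∧ ∀ y ∈ airS R, ‖y‖^p * ‖airW k y‖ ≤ C := by
  induction p with
  | zero => intro k; simpa using airW_bound k R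
  | succ p ih =>
    intro k
    obtain ⟨C1, h1, hC1⟩ := ih (k+2)
    obtain ⟨C2, h2, hC2⟩ := ih (k-1)
    refine ⟨C1 + k * C2, by positivity, fun y hy => ?_⟩
    have e : Complex.I * y * airW k y = airW (k+2) y - Complex.I * k * airW (k-1) y := by
      rw [airW_rec]; ring
    have : ‖y‖ * ‖airW k y‖ ≤ ‖airW (k+2) y‖ + k * ‖airW (k-1) y‖ := by
      have h := congrArg norm e
      simp only [norm_mul, Complex.norm_I, one_mul] at h
      rw [h]
      refine (norm_sub_le _ _).trans ?_
      simp
    calc ‖y‖^(p+1) * ‖airW k y‖ = ‖y‖^p * (‖y‖ * ‖airW k y‖) := by ring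
      _ ≤ ‖y‖^p * (‖airW (k+2) y‖ + k * ‖airW (k-1) y‖) := by gcongr
      _ = ‖y‖^p * ‖airW (k+2) y‖ + k * (‖y‖^p * ‖airW (k-1) y‖) := by ring
      _ ≤ _ := by
        have := hC1 y hy
        have := hC2 y hy
        gcongr

/-- the primitive `A(y) = ∫_y^∞ w`. -/
noncomputable def airA (y : ℂ) : ℂ :=
  airW 0 y * (-Complex.I * airM 1 (-Complex.I * y)) - airW 1 y * airM 0 (-Complex.I * y)

lemma airA_hasDerivAt (y : ℂ) : HasDerivAt airA (-airW 0 y) y := by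
  have h1 : HasDerivAt (fun y : ℂ => -Complex.I * y) (-Complex.I) y := by
    simpa using (hasDerivAt_id y).const_mul (-Complex.I)
  have h3 := ((airM_hasDerivAt 0 (-Complex.I * y)).comp y h1)
  have h4 := ((airM_hasDerivAt 1 (-Complex.I * y)).comp y h1).const_mul (-Complex.I)
  refine (((airW_hasDerivAt 0 y).mul h4).sub ((airW_hasDerivAt 1 y).mul h3)).congr_deriv ?_
  rw [show 0+1 = 1 from rfl, show 1+1=0+2 from rfl, airW_two, airM_rec]
  simp only [if_true, Function.comp]
  linear_combination (airW 0 y * Complex.I^2 * 0 + airW 0 y * (1 + (-Complex.I*y) * airM 0 (-Complex.I*y))) * Complex.I_sq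

lemma airA_decay (p : ℕ) (R : ℝ) : ∃ C, 0 ≤ C ∧ ∀ y ∈ airS R, ‖y‖^p * ‖airA y‖ ≤ C := by
  obtain ⟨C0, h0, hC0⟩ := airW_decay p R 0
  obtain ⟨C1, h1, hC1⟩ := airW_decay p R 1
  set D0 := ∫ x in Ioi (0:ℝ), airD 0 R x
  set D1 := ∫ x in Ioi (0:ℝ), airD 1 R x
  have hD : ∀ k, 0 ≤ ∫ x in Ioi (0:ℝ), airD k R x := by
    intro k
    apply setIntegral_nonneg measurableSet_Ioi
    intro x hx
    have : (0:ℝ) < x := hx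
    unfold airD; positivity
  have hD0 : 0 ≤ D0 := hD 0
  have hD1 : 0 ≤ D1 := hD 1
  refine ⟨C0 * D1 + C1 * D0, by positivity, fun y hy => ?_⟩
  have b0 : ‖airM 0 (-Complex.I * y)‖ ≤ D0 := airM_bound 0 (-Complex.I * y) R (by simpa using hy.1)
  have b1 : ‖airM 1 (-Complex.I * y)‖ ≤ D1 := airM_bound 1 (-Complex.I * y) R (by simpa using hy.1)
  have : ‖airA y‖ ≤ ‖airW 0 y‖ * D1 + ‖airW 1 y‖ * D0 := by
    unfold airA
    refine (norm_sub_le _ _).trans ?_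
    simp only [norm_mul, norm_neg, Complex.norm_I, one_mul]
    gcongr
  calc ‖y‖^p * ‖airA y‖ ≤ ‖y‖^p * (‖airW 0 y‖ * D1 + ‖airW 1 y‖ * D0) := by gcongr
    _ = (‖y‖^p * ‖airW 0 y‖) * D1 + (‖y‖^p * ‖airW 1 y‖) * D0 := by ring
    _ ≤ _ := by
      have := hC0 y hy
      have := hC1 y hy
      gcongr

noncomputable def airH (k : ℕ) : ℝ := ∫ x in Ioi (0:ℝ), airD k 0 x

lemma airM_zero (k : ℕ) : airM k 0 = (airH k : ℂ) := by
  unfold airM airH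
  rw [← integral_complex_ofReal]
  congr 1
  ext x
  unfold airD
  push_cast
  simp

lemma airH_gamma (k : ℕ) : airH k = (1/3:ℝ)^(-((k:ℝ)+1)/3) * (1/3) * Real.Gamma (((k:ℝ)+1)/3) := by
  have := integral_rpow_mul_exp_neg_mul_rpow (p := 3) (q := k) (b := 1/3) (by norm_num)
    (by have : (0:ℝ) ≤ k := Nat.cast_nonneg k
        linarith) (by norm_num)
  rw [← this]
  unfold airH
  apply setIntegral_congr_fun measurableSet_Ioi
  intro x hx
  have hx : (0:ℝ) < x := hx
  unfold airD
  simp only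
  rw [Real.rpow_natCast]
  congr 2
  rw [show (3:ℝ) = ((3:ℕ):ℝ) by norm_num, Real.rpow_natCast]
  push_cast; ring

lemma gamma_third_cube (a b : ℝ) (ha : 0 < a) (hb : 0 < b) :
    Real.Gamma (a/3 + 2*b/3)^3 ≤ Real.Gamma a * Real.Gamma b^2 := by
  have h := Real.Gamma_mul_add_mul_le_rpow_Gamma_mul_rpow_Gamma (s := a) (t := b) (a := 1/3) (b := 2/3)
    ha hb (by norm_num) (by norm_num) (by norm_num)
  have e : (1/3 * a + 2/3*b : ℝ) = a/3 + 2*b/3 := by ring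
  rw [e] at h
  have g1 := Real.Gamma_pos_of_pos ha
  have g2 := Real.Gamma_pos_of_pos hb
  have h0 : 0 < Real.Gamma (a/3 + 2*b/3) := Real.Gamma_pos_of_pos (by positivity)
  calc Real.Gamma (a/3 + 2*b/3)^3 ≤ (Real.Gamma a ^ (1/3:ℝ) * Real.Gamma b ^ (2/3:ℝ))^3 := by gcongr
    _ = _ := by
      rw [mul_pow, ← Real.rpow_natCast, ← Real.rpow_natCast, ← Real.rpow_mul g1.le, ← Real.rpow_mul g2.le]
      norm_num

lemma gamma_three_halves_sq : Real.Gamma (3/2)^2 = Real.pi/4 := by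
  have : Real.Gamma (3/2) = 1/2 * Real.sqrt Real.pi := by
    rw [show (3/2:ℝ) = 1/2 + 1 by norm_num, Real.Gamma_add_one (by norm_num), Real.Gamma_one_half_eq]
  rw [this, mul_pow, Real.sq_sqrt Real.pi_pos.le]; ring

lemma airH0_cube : airH 0 ^ 3 ≤ 3 * Real.pi / 4 := by
  have h := gamma_third_cube 1 (3/2) (by norm_num) (by norm_num)
  rw [Real.Gamma_one, gamma_three_halves_sq] at h
  norm_num at h
  have e : Real.Gamma (4/3) = 1/3 * Real.Gamma (1/3) := by
    rw [show (4/3:ℝ) = 1/3+1 by norm_num, Real.Gamma_add_one (by norm_num)]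
  rw [airH_gamma]
  norm_num
  rw [mul_pow, mul_pow, ← Real.rpow_natCast, ← Real.rpow_mul (by norm_num)]
  norm_num
  rw [e, mul_pow] at h
  nlinarith

lemma airH1_cube : airH 1 ^ 3 ≤ 9 * Real.pi / 32 := by
  have h := gamma_third_cube 2 (3/2) (by norm_num) (by norm_num)
  rw [Real.Gamma_two, gamma_three_halves_sq] at h
  norm_num at h
  have e : Real.Gamma (5/3) = 2/3 * Real.Gamma (2/3) := by
    rw [show (5/3:ℝ) = 2/3+1 by norm_num, Real.Gamma_add_one (by norm_num)]
  rw [airH_gamma]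
  norm_num
  rw [mul_pow, mul_pow, ← Real.rpow_natCast, ← Real.rpow_mul (by norm_num)]
  norm_num
  rw [e, mul_pow] at h
  nlinarith

lemma airH_mul : airH 0 * airH 1 = 2 * Real.pi / (3 * Real.sqrt 3) := by
  have h := Real.Gamma_mul_Gamma_one_sub (1/3)
  rw [airH_gamma, airH_gamma]
  rw [show Real.pi * (1/3) = Real.pi/3 by ring, Real.sin_pi_div_three] at h
  norm_num at h ⊢
  have e : (1/3:ℝ)^(-(1/3):ℝ) * (1/3:ℝ)^(-(2/3):ℝ) = 3 := by
    rw [← Real.rpow_add (by norm_num)]; norm_num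
  calc _ = ((1/3:ℝ)^(-(1/3):ℝ) * (1/3:ℝ)^(-(2/3):ℝ)) * (1/9) * (Real.Gamma (1/3) * Real.Gamma (2/3)) := by ring
    _ = _ := by
      rw [e, h]
      have : Real.sqrt 3 ≠ 0 := by positivity
      field_simp
      norm_num

lemma airH_pos (k : ℕ) : 0 < airH k := by
  rw [airH_gamma]
  have : 0 < Real.Gamma (((k:ℝ)+1)/3) := Real.Gamma_pos_of_pos (by positivity)
  positivity

lemma sqrt3_bounds : 1.732 < Real.sqrt 3 ∧ Real.sqrt 3 < 1.7321 := by
  constructor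
  · apply Real.lt_sqrt_of_sq_lt; norm_num
  · rw [Real.sqrt_lt' (by norm_num)]; norm_num

lemma airH_bounds : 1.2598 ≤ airH 0 ∧ airH 0 ≤ 1.3309 ∧ airH 1 ≤ 0.9597 ∧ 0.9084 ≤ airH 1 ∧
    1.2091 ≤ airH 0 * airH 1 ∧ airH 0 * airH 1 ≤ 1.2093 := by
  have p1 := Real.pi_gt_d4
  have p2 := Real.pi_lt_d4
  obtain ⟨s1, s2⟩ := sqrt3_bounds
  have h0 := airH_pos 0
  have h1 := airH_pos 1
  have c0 := airH0_cube
  have c1 := airH1_cube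
  have hp := airH_mul
  have u0 : airH 0 ≤ 1.3309 := by
    by_contra hc
    push Not at hc
    have : (1.3309:ℝ)^3 < airH 0^3 := by gcongr
    norm_num at *
    linarith
  have u1 : airH 1 ≤ 0.9597 := by
    by_contra hc
    push Not at hc
    have : (0.9597:ℝ)^3 < airH 1^3 := by gcongr
    norm_num at *
    linarith
  have q1 : 1.2091 ≤ airH 0 * airH 1 := by
    rw [hp, le_div_iff₀ (by positivity)]; norm_num at *; linarith
  have q2 : airH 0 * airH 1 ≤ 1.2093 := by
    rw [hp, div_le_iff₀ (by positivity)]; norm_num at *; linarith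
  refine ⟨?_, u0, u1, ?_, q1, q2⟩
  · norm_num at *; nlinarith
  · norm_num at *; nlinarith

lemma airW0_zero : airW 0 0 = (Real.sqrt 3 : ℂ) * (airH 0 : ℂ) * ⟨Real.sqrt 3/2, 1/2⟩ := by
  have h3 : Real.sqrt 3 ^2 = 3 := Real.sq_sqrt (by norm_num)
  unfold airW
  simp only [mul_zero, airM_zero, pow_zero, one_mul, mul_one, airOm]
  apply Complex.ext
  · simp; linear_combination (-airH 0/2) * h3
  · simp; ring

lemma airW1_zero : airW 1 0 = -(Real.sqrt 3 : ℂ) * (airH 1 : ℂ) * ⟨1/2, Real.sqrt 3/2⟩ := by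
  have h3 : Real.sqrt 3 ^2 = 3 := Real.sq_sqrt (by norm_num)
  unfold airW
  simp only [mul_zero, airM_zero, pow_one, airOm]
  apply Complex.ext
  · simp; ring
  · simp; ring_nf; rw [h3]; ring

lemma airA_zero : airA 0 = (Real.sqrt 3 : ℂ) * (airH 0 * airH 1 : ℝ) := by
  have h3 : Real.sqrt 3 ^2 = 3 := Real.sq_sqrt (by norm_num)
  unfold airA
  rw [airW0_zero, airW1_zero]
  simp only [mul_zero, airM_zero]
  apply Complex.ext
  · simp; ring
  · simp; ring_nf

/-- Horner evaluation of a list of coefficients -/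
noncomputable def pe : List ℝ → ℝ → ℝ
  | [], _ => 0
  | c :: l, t => c + t * pe l t

noncomputable def pe' : List ℝ → ℝ → ℝ
  | [], _ => 0
  | _ :: l, t => pe l t + t * pe' l t

lemma pe_deriv (l : List ℝ) (t : ℝ) : HasDerivAt (pe l) (pe' l t) t := by
  induction l with
  | nil => exact hasDerivAt_const t 0
  | cons c l ih =>
    have := ((hasDerivAt_id t).mul ih).const_add c
    exact this.congr_deriv (by simp [pe'])

lemma nn_of_deriv {f f' : ℝ → ℝ} {T : ℝ} (h : ∀ t, HasDerivAt f (f' t) t) (h0 : 0 ≤ f 0)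
    (hp : ∀ t ∈ Icc 0 T, 0 ≤ f' t) : ∀ t ∈ Icc 0 T, 0 ≤ f t := by
  intro t ht
  have hm : MonotoneOn f (Icc 0 T) := by
    apply monotoneOn_of_deriv_nonneg (convex_Icc 0 T)
    · exact fun x _ => (h x).continuousAt.continuousWithinAt
    · exact fun x _ => (h x).differentiableAt.differentiableWithinAt
    · intro x hx
      rw [interior_Icc] at hx
      rw [(h x).deriv]
      exact hp x (Ioo_subset_Icc_self hx)
  exact h0.trans (hm ⟨le_refl _, ht.1.trans ht.2⟩ ht ht.1)

lemma prim_deriv {f : ℝ → ℝ} (hf : Continuous f) (t : ℝ) :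
    HasDerivAt (fun t => ∫ s in (0:ℝ)..t, f s) (f t) t :=
  intervalIntegral.integral_hasDerivAt_right (hf.intervalIntegrable _ _)
    (hf.stronglyMeasurableAtFilter _ _) hf.continuousAt

lemma airy_neg_step {r r1 c c1 b b1 b2 j : ℝ → ℝ} {r0 r10 c0 c10 B0 B1 B2 j0 T : ℝ}
    (hr : ∀ t, HasDerivAt r (r1 t) t) (hr1 : ∀ t, HasDerivAt r1 (t * c t + 3/2 * b1 t) t)
    (hc : ∀ t, HasDerivAt c (c1 t) t) (hc1 : ∀ t, HasDerivAt c1 (- t * r t + j t) t)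
    (hb : ∀ t, HasDerivAt b (b1 t) t) (hb1 : ∀ t, HasDerivAt b1 (b2 t) t)
    (hb2 : ∀ t, HasDerivAt b2 (-4 * t * j t) t) (hj : ∀ t, HasDerivAt j (- t * b t) t)
    (er : r 0 = r0) (er1 : r1 0 = r10) (ec : c 0 = c0) (ec1 : c1 0 = c10)
    (eb : b 0 = B0) (eb1 : b1 0 = B1) (eb2 : b2 0 = B2) (ej : j 0 = j0)
    (hb2n : ∀ t, 0 ≤ b2 t) (hB1 : 0 ≤ B1) (hB0' : 0 ≤ B0)
    (hpoly : ∀ t, 0 ≤ t → 0 ≤ t * pe [c0, c10, j0/2, -r0/6, -B0/24 - r10/12, -B1/60 - 3/80*B1,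
        -B2/240 - (c0+3/2*B2)/180, -c10/504, j0/2016+j0/2240, 0, -B0/43200 - B0/25200] t +
        3/2 * pe [B1, B2, 0, -2/3*j0, 0, B0/10, 4*B1/90, B2/84, 0, -j0/648, 0, B0/13200] t)
    (hT : ∀ t ∈ Icc 0 T, 0 ≤ r t) :
    ∀ t ∈ Icc 0 T, 0 ≤ t * c t + 3/2 * b1 t := by
  -- step 1
  have s1 : ∀ t ∈ Icc 0 T, 0 ≤ b1 t :=
    nn_of_deriv hb1 (by rw [eb1]; exact hB1) (fun t _ => hb2n t)
  have s2 : ∀ t ∈ Icc 0 T, 0 ≤ b t - B0 := by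
    refine nn_of_deriv (f' := b1) (fun t => (hb t).sub_const B0) (by rw [eb]; simp) s1
  have s3 : ∀ t ∈ Icc 0 T, 0 ≤ -j t + pe [j0, 0, -B0/2] t := by
    refine nn_of_deriv (fun t => (hj t).neg.add (pe_deriv _ t)) (by simp [pe, ej]) ?_
    intro t ht
    have := mul_nonneg ht.1 (s2 t ht)
    simp [pe, pe']; linarith
  have s4 : ∀ t ∈ Icc 0 T, 0 ≤ b2 t - pe [B2, 0, -2*j0, 0, B0/2] t := by
    refine nn_of_deriv (fun t => (hb2 t).sub (pe_deriv _ t)) (by simp [pe, eb2]) ?_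
    intro t ht
    have := mul_nonneg ht.1 (s3 t ht)
    simp [pe, pe'] at this ⊢; linarith
  have hbb1 : ∀ t, HasDerivAt (fun t => b1 t - pe [B1, B2, 0, -2/3*j0, 0, B0/10] t)
      (b2 t - pe [B2, 0, -2*j0, 0, B0/2] t) t := fun t =>
    ((hb1 t).sub (pe_deriv _ t)).congr_deriv (by simp [pe, pe']; ring)
  have s5 : ∀ t ∈ Icc 0 T, 0 ≤ b1 t - pe [B1, B2, 0, -2/3*j0, 0, B0/10] t := 
    nn_of_deriv hbb1 (by simp [pe, eb1]) s4
  have hbb : ∀ t, HasDerivAt (fun t => b t - pe [B0, B1, B2/2, 0, -j0/6, 0, B0/60] t)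
      (b1 t - pe [B1, B2, 0, -2/3*j0, 0, B0/10] t) t := fun t =>
    ((hb t).sub (pe_deriv _ t)).congr_deriv (by simp [pe, pe']; ring)
  have s6 : ∀ t ∈ Icc 0 T, 0 ≤ b t - pe [B0, B1, B2/2, 0, -j0/6, 0, B0/60] t :=
    nn_of_deriv hbb (by simp [pe, eb]) s5
  obtain ⟨bb, ebb⟩ : ∃ bb, bb = fun t => b t - pe [B0, B1, B2/2, 0, -j0/6, 0, B0/60] t := ⟨_, rfl⟩
  obtain ⟨bb1, ebb1⟩ : ∃ bb1, bb1 = fun t => b1 t - pe [B1, B2, 0, -2/3*j0, 0, B0/10] t := ⟨_, rfl⟩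
  obtain ⟨bb2, ebb2⟩ : ∃ bb2, bb2 = fun t => b2 t - pe [B2, 0, -2*j0, 0, B0/2] t := ⟨_, rfl⟩
  have dbb : ∀ t, HasDerivAt bb (bb1 t) t := by rw [ebb, ebb1]; exact hbb
  have dbb1 : ∀ t, HasDerivAt bb1 (bb2 t) t := by rw [ebb1, ebb2]; exact hbb1
  have bb0 : bb 0 = 0 := by simp [ebb, pe, eb]
  have bb10 : bb1 0 = 0 := by simp [ebb1, pe, eb1]
  have n2 : ∀ t ∈ Icc 0 T, 0 ≤ bb2 t := by rw [ebb2]; exact s4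
  have n1 : ∀ t ∈ Icc 0 T, 0 ≤ bb1 t := by rw [ebb1]; exact s5
  have n0 : ∀ t ∈ Icc 0 T, 0 ≤ bb t := by rw [ebb]; exact s6
  have s7 : ∀ t ∈ Icc 0 T, 0 ≤ t * bb1 t - bb t := by
    refine nn_of_deriv (fun t => (((hasDerivAt_id t).mul (dbb1 t)).sub (dbb t))) (by simp [bb0]) ?_
    intro t ht
    have := mul_nonneg ht.1 (n2 t ht)
    simp; linarith
  -- step 2
  obtain ⟨J, eJ⟩ : ∃ J, J = fun t => -j t + pe [j0, 0, -B0/2, -B1/3, -B2/8, 0, j0/36, 0, -B0/480] t := ⟨_, rfl⟩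
  have dJ : ∀ t, HasDerivAt J (t * bb t) t := by
    intro t
    rw [eJ]
    refine ((hj t).neg.add (pe_deriv _ t)).congr_deriv ?_
    rw [ebb]; simp [pe, pe']; ring
  have J0 : J 0 = 0 := by simp [eJ, pe, ej]
  have nJ : ∀ t ∈ Icc 0 T, 0 ≤ J t :=
    nn_of_deriv dJ (by rw [J0]) (fun t ht => mul_nonneg ht.1 (n0 t ht))
  have s8 : ∀ t ∈ Icc 0 T, 0 ≤ t^2 * bb t - 3 * J t := by
    refine nn_of_deriv (fun t => (((hasDerivAt_pow 2 t).mul (dbb t)).sub ((dJ t).const_mul 3))) (by simp [J0]) ?_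
    intro t ht
    have := mul_nonneg ht.1 (s7 t ht)
    simp; nlinarith
  -- step 3
  have cb : Continuous b := continuous_iff_continuousAt.2 fun t => (hb t).continuousAt
  obtain ⟨g, eg⟩ : ∃ g, g = fun t => (∫ s in (0:ℝ)..t, b s) - pe [0, B0, B1/2, B2/6, 0, -j0/30, 0, B0/420] t := ⟨_, rfl⟩
  have dg : ∀ t, HasDerivAt g (bb t) t := by
    intro t
    rw [eg]
    refine ((prim_deriv cb t).sub (pe_deriv _ t)).congr_deriv ?_
    rw [ebb]; simp [pe, pe']; ring
  have g0 : g 0 = 0 := by simp [eg, pe]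
  have s9 : ∀ t ∈ Icc 0 T, 0 ≤ t * bb t / 2 - g t := by
    refine nn_of_deriv (fun t => ((((hasDerivAt_id t).mul (dbb t)).div_const 2).sub (dg t))) (by simp [g0]) ?_
    intro t ht
    have := s7 t ht
    simp; linarith
  have s10 : ∀ t ∈ Icc 0 T, 0 ≤ 3/2 * J t - t * g t := by
    refine nn_of_deriv (fun t => (((dJ t).const_mul (3/2)).sub ((hasDerivAt_id t).mul (dg t)))) (by simp [J0]) ?_
    intro t ht
    have := s9 t ht
    simp; linarith
  -- step 4
  have cJ : Continuous J := continuous_iff_continuousAt.2 fun t => (dJ t).continuousAt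
  obtain ⟨K1, eK1⟩ : ∃ K1, K1 = fun t => (∫ s in (0:ℝ)..t, J s) := ⟨_, rfl⟩
  have dK1 : ∀ t, HasDerivAt K1 (J t) t := by rw [eK1]; exact prim_deriv cJ
  have cK1 : Continuous K1 := continuous_iff_continuousAt.2 fun t => (dK1 t).continuousAt
  obtain ⟨K, eK⟩ : ∃ K, K = fun t => (∫ s in (0:ℝ)..t, K1 s) := ⟨_, rfl⟩
  have dK : ∀ t, HasDerivAt K (K1 t) t := by rw [eK]; exact prim_deriv cK1
  have K10 : K1 0 = 0 := by simp [eK1]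
  have K0 : K 0 = 0 := by simp [eK]
  have s11 : ∀ t ∈ Icc 0 T, 0 ≤ t * J t - 4 * K1 t := by
    refine nn_of_deriv (fun t => (((hasDerivAt_id t).mul (dJ t)).sub ((dK1 t).const_mul 4))) (by simp [K10]) ?_
    intro t ht
    have := s8 t ht
    simp; nlinarith
  obtain ⟨e1, ee1⟩ : ∃ e1, e1 = fun t => b1 t - pe [B1, B2, 0, -2/3*j0, 0, B0/10, 4*B1/90, B2/84, 0, -j0/648, 0, B0/13200] t := ⟨_, rfl⟩
  obtain ⟨e2, ee2⟩ : ∃ e2, e2 = fun t => b2 t - pe [B2, 0, -2*j0, 0, B0/2, 4*B1/15, B2/12, 0, -j0/72, 0, B0/1200] t := ⟨_, rfl⟩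
  have de1 : ∀ t, HasDerivAt e1 (e2 t) t := by
    intro t; rw [ee1, ee2]
    exact ((hb1 t).sub (pe_deriv _ t)).congr_deriv (by simp [pe, pe']; ring)
  have de2 : ∀ t, HasDerivAt e2 (4 * t * J t) t := by
    intro t; rw [ee2, eJ]
    exact ((hb2 t).sub (pe_deriv _ t)).congr_deriv (by simp [pe, pe']; ring)
  have e10 : e1 0 = 0 := by simp [ee1, pe, eb1]
  have e20 : e2 0 = 0 := by simp [ee2, pe, eb2]
  have ne1 : ∀ t ∈ Icc 0 T, 0 ≤ e1 t := by
    refine nn_of_deriv de1 (by rw [e10]) (nn_of_deriv de2 (by rw [e20]) fun t ht => ?_)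
    have := mul_nonneg ht.1 (nJ t ht); linarith
  have s12 : ∀ t ∈ Icc 0 T, 0 ≤ 3/8 * e1 t - t * K t := by
    refine nn_of_deriv (f' := fun t => 3/8 * e2 t - (K t + t * K1 t))
      (fun t => (((de1 t).const_mul (3/8)).sub ((hasDerivAt_id t).mul (dK t))).congr_deriv (by simp))
      (by simp [e10]) ?_
    refine nn_of_deriv (fun t => (((de2 t).const_mul (3/8)).sub ((dK t).add ((hasDerivAt_id t).mul (dK1 t)))))
      (by simp [e20, K0]) ?_
    intro t ht
    have := s11 t ht
    simp; linarith
  -- step 5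
  have nj : ∀ t ∈ Icc 0 T, 0 ≤ j0 - j t := by
    intro t ht
    have := s3 t ht
    have hB0 : 0 ≤ B0 * t^2 := mul_nonneg hB0' (sq_nonneg t)
    simp [pe] at this
    nlinarith
  have s13 : ∀ t ∈ Icc 0 T, 0 ≤ pe [c0, c10, j0/2] t - c t := by
    refine nn_of_deriv (f' := fun t => pe [c10, j0] t - c1 t)
      (fun t => ((pe_deriv _ t).sub (hc t)).congr_deriv (by simp [pe, pe']; ring)) (by simp [pe, ec]) ?_
    refine nn_of_deriv (fun t => ((pe_deriv _ t).sub (hc1 t))) (by simp [pe, ec1]) ?_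
    intro t ht
    have := mul_nonneg ht.1 (hT t ht)
    have := nj t ht
    simp [pe, pe']; linarith
  -- step 6
  have s14 : ∀ t ∈ Icc 0 T, 0 ≤ pe [r0, r10, 3/4*B1, (c0+3/2*B2)/6, c10/12, -j0/40, 0, B0/280] t + 3/2 * g t - r t := by
    refine nn_of_deriv (f' := fun t => pe [r10, 3/2*B1, (c0+3/2*B2)/2, c10/3, -j0/8, 0, B0/40] t + 3/2 * bb t - r1 t)
      (fun t => (((pe_deriv _ t).add ((dg t).const_mul (3/2))).sub (hr t)).congr_deriv (by simp [pe, pe']; ring))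
      (by simp [pe, er, g0]) ?_
    refine nn_of_deriv (fun t => (((pe_deriv _ t).add ((dbb t).const_mul (3/2))).sub (hr1 t)))
      (by simp [pe, er1, bb0]) ?_
    intro t ht
    have := mul_nonneg ht.1 (s13 t ht)
    rw [ebb1]
    simp [pe, pe'] at this ⊢; linarith
  -- step 7
  have s15 : ∀ t ∈ Icc 0 T, 0 ≤ c t - pe [c0, c10, j0/2, -r0/6, -B0/24 - r10/12, -B1/60 - 3/80*B1,
        -B2/240 - (c0+3/2*B2)/180, -c10/504, j0/2016+j0/2240, 0, -B0/43200 - B0/25200] t + 13/4 * K t := by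
    refine nn_of_deriv (f' := fun t => c1 t - pe [c10, j0, -r0/2, 4*(-B0/24 - r10/12), 5*(-B1/60 - 3/80*B1),
        6*(-B2/240 - (c0+3/2*B2)/180), -c10/72, 8*(j0/2016+j0/2240), 0, 10*(-B0/43200 - B0/25200)] t + 13/4 * K1 t)
      (fun t => (((hc t).sub (pe_deriv _ t)).add ((dK t).const_mul (13/4))).congr_deriv (by simp [pe, pe']; ring))
      (by simp [pe, ec, K0]) ?_
    refine nn_of_deriv (fun t => (((hc1 t).sub (pe_deriv _ t)).add ((dK1 t).const_mul (13/4))))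
      (by simp [pe, ec1, K10]) ?_
    intro t ht
    have h1 := mul_nonneg ht.1 (s14 t ht)
    have h2 := s10 t ht
    have h3 : J t = -j t + pe [j0, 0, -B0/2, -B1/3, -B2/8, 0, j0/36, 0, -B0/480] t := by rw [eJ]
    simp [pe, pe'] at h1 h2 h3 ⊢; linarith
  intro t ht
  have h1 := mul_nonneg ht.1 (s15 t ht)
  have h2 := s12 t ht
  have h3 := ne1 t ht
  have h4 := hpoly t ht.1
  have h5 : b1 t = e1 t + pe [B1, B2, 0, -2/3*j0, 0, B0/10, 4*B1/90, B2/84, 0, -j0/648, 0, B0/13200] t := by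
    rw [ee1]; ring
  rw [h5]
  nlinarith

lemma polyP_pos (t : ℝ) (ht : 0 ≤ t) : 0 ≤ (78/25)*t^0 + (327/100)*t^1 + (19/20)*t^2 + (-303/1000)*t^3 + (-233/1000)*t^4 + (-9/1000)*t^5 + (261/10000)*t^6 + (43/10000)*t^7 + (-1/500)*t^8 + (-21/25000)*t^9 + (0)*t^10 + (1/12500)*t^11 := by
  rcases le_total t 3 with h | h
  · obtain ⟨s, hs⟩ : ∃ s, t = 3 * s := ⟨t/3, by ring⟩
    have h0 : 0 ≤ s := by linarith
    have h1 : 0 ≤ 1 - s := by linarith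
    have e : (78/25)*t^0 + (327/100)*t^1 + (19/20)*t^2 + (-303/1000)*t^3 + (-233/1000)*t^4 + (-9/1000)*t^5 + (261/10000)*t^6 + (43/10000)*t^7 + (-1/500)*t^8 + (-21/25000)*t^9 + (0)*t^10 + (1/12500)*t^11 = (78/25)*s^0*(1-s)^11 + (4413/100)*s^1*(1-s)^10 + (1113/4)*s^2*(1-s)^9 + (1025019/1000)*s^3*(1-s)^8 + (2430279/1000)*s^4*(1-s)^7 + (1928187/500)*s^5*(1-s)^6 + (41422959/10000)*s^6*(1-s)^5 + (15027543/5000)*s^7*(1-s)^4 + (3656331/2500)*s^8*(1-s)^3 + (11335947/25000)*s^9*(1-s)^2 + (2950323/50000)*s^10*(1-s)^1 + (129651/25000)*s^11*(1-s)^0 := by rw [hs]; ring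
    rw [e]; positivity
  · obtain ⟨v, hv⟩ : ∃ v, t = 3 + v := ⟨t-3, by ring⟩
    have h0 : 0 ≤ v := by linarith
    have e : (78/25)*t^0 + (327/100)*t^1 + (19/20)*t^2 + (-303/1000)*t^3 + (-233/1000)*t^4 + (-9/1000)*t^5 + (261/10000)*t^6 + (43/10000)*t^7 + (-1/500)*t^8 + (-21/25000)*t^9 + (0)*t^10 + (1/12500)*t^11 = (129651/25000) + (-32667/50000)*v + (412793/25000)*v^2 + ((1516323/50000)*v^3 + (697417/25000)*v^4 + (166203/10000)*v^5 + (83607/12500)*v^6 + (91127/50000)*v^7 + (8293/25000)*v^8 + (969/25000)*v^9 + (33/12500)*v^10 + (1/12500)*v^11) := by rw [hv]; ring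
    have h2 : 0 ≤ (1516323/50000)*v^3 + (697417/25000)*v^4 + (166203/10000)*v^5 + (83607/12500)*v^6 + (91127/50000)*v^7 + (8293/25000)*v^8 + (969/25000)*v^9 + (33/12500)*v^10 + (1/12500)*v^11 := by positivity
    rw [e]; nlinarith [sq_nonneg (v - 1/50)]

lemma neg_coefs : 
    let H0 := airH 0
    let H1 := airH 1
    let p := airH 0 * airH 1
    let q := Real.sqrt 3
    3.12 ≤ 3/2*(q*p) ∧ 3.27 ≤ p*H0/2 + 3/2*(2*H1^2) ∧ 0.95 ≤ q/2*p*H1 ∧ p/2/2 ≤ 0.303 ∧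
    p*H0*q/2/6 ≤ 0.233 ∧ -0.009 ≤ - H0^2/24 - (p*H1/2+H0^2)/12 + 3/20*H0^2 ∧
    0.0261 ≤ q*p/80 ∧ 0.0043 ≤ -(2*H1^2)/240 - (p*H0/2+3/2*(2*H1^2))/180 + (2*H1^2)/56 ∧
    q/2*p*H1/504 ≤ 0.002 ∧ (p/2)*(1/432-1/2016-1/2240) ≤ 0.00084 ∧
    0.00008 ≤ H0^2*(1/8800 - 1/43200-1/25200) := by
  intro H0 H1 p q
  obtain ⟨h1, h2, h3, h4, h5, h6⟩ := airH_bounds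
  obtain ⟨g1, g2⟩ := sqrt3_bounds
  change 1.2598 ≤ H0 at h1
  change H0 ≤ 1.3309 at h2
  change H1 ≤ 0.9597 at h3
  change 0.9084 ≤ H1 at h4
  change 1.2091 ≤ p at h5
  change p ≤ 1.2093 at h6
  change 1.732 < q at g1
  change q < 1.7321 at g2
  have hH0 : 1.2598^2 ≤ H0^2 := by gcongr
  have hH0' : H0^2 ≤ 1.3309^2 := by gcongr
  have hH1 : 0.9084^2 ≤ H1^2 := by gcongr
  have hH1' : H1^2 ≤ 0.9597^2 := by gcongr
  have hqp : 1.732*1.2091 ≤ q*p := by gcongr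
  have hqp' : q*p ≤ 1.7321*1.2093 := by gcongr
  have hpH : 1.2091*1.2598 ≤ p*H0 := by gcongr
  have hpH' : p*H0 ≤ 1.2093*1.3309 := by gcongr
  have hpG : 1.2091*0.9084 ≤ p*H1 := by gcongr
  have hpG' : p*H1 ≤ 1.2093*0.9597 := by gcongr
  have hq : 1.732*(1.2091*0.9084) ≤ q*(p*H1) := by gcongr
  have hq' : q*(p*H1) ≤ 1.7321*(1.2093*0.9597) := by gcongr
  have hr' : q*(p*H0) ≤ 1.7321*(1.2093*1.3309) := by gcongr
  have hp : H0 * H1 = p := rfl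
  have hx : 3.27 ≤ p*H0/2 + 3/2*(2*H1^2) := by
    have e1 : 1.2091 * H0 ≤ p * H0 := by gcongr
    have e2 := mul_nonneg (sub_nonneg.2 h2) (sub_nonneg.2 h4)
    have e3 := mul_nonneg (sub_nonneg.2 h4) (sub_nonneg.2 h4)
    norm_num at *
    nlinarith
  refine ⟨?_,hx,?_,?_,?_,?_,?_,?_,?_,?_,?_⟩ <;> norm_num at * <;> linarith

lemma real_neg_axis {ux uy vx vy ax ay : ℝ → ℝ} 
    (h1 : ∀ t, HasDerivAt ux (vx t) t) (h2 : ∀ t, HasDerivAt uy (vy t) t)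
    (h3 : ∀ t, HasDerivAt vx (t * uy t) t) (h4 : ∀ t, HasDerivAt vy (-t * ux t) t)
    (h5 : ∀ t, HasDerivAt ax (ux t) t) (h6 : ∀ t, HasDerivAt ay (uy t) t)
    (i1 : ux 0 = airH 0 * (Real.sqrt 3/2)) (i2 : uy 0 = airH 0 * (1/2))
    (i3 : vx 0 = airH 1 * (1/2)) (i4 : vy 0 = airH 1 * (Real.sqrt 3/2))
    (i5 : ax 0 = airH 0 * airH 1) (i6 : ay 0 = 0) (t : ℝ) (ht : 0 ≤ t) :
    0 ≤ ux t * ax t + uy t * ay t := by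
  have q2 : Real.sqrt 3 * Real.sqrt 3 = 3 := Real.mul_self_sqrt (by norm_num)
  have H0p := airH_pos 0
  have H1p := airH_pos 1
  have qp : 0 < Real.sqrt 3 := by positivity
  obtain ⟨r, er⟩ : ∃ r, r = fun t => ux t * ax t + uy t * ay t := ⟨_, rfl⟩
  obtain ⟨r1, er1⟩ : ∃ r, r = fun t => vx t * ax t + vy t * ay t + (ux t * ux t + uy t * uy t) := ⟨_, rfl⟩
  have hr : ∀ t, HasDerivAt r (r1 t) t := by
    intro t; rw [er, er1]
    exact (((h1 t).mul (h5 t)).add ((h2 t).mul (h6 t))).congr_deriv (by ring)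
  have step : ∀ T, (∀ t ∈ Icc 0 T, 0 ≤ r t) → ∀ t ∈ Icc 0 T, 0 ≤ t * (uy t * ax t - ux t * ay t) + 3/2 * (2*(vx t * ux t + vy t * uy t)) := by
    intro T hT
    refine airy_neg_step (r := r) (r1 := r1) (c := fun t => uy t * ax t - ux t * ay t)
      (c1 := fun t => vy t * ax t - vx t * ay t) (b := fun t => ux t * ux t + uy t * uy t)
      (b1 := fun t => 2 * (vx t * ux t + vy t * uy t)) (b2 := fun t => 2 * (vx t * vx t + vy t * vy t))
      (j := fun t => vy t * ux t - vx t * uy t) (r0 := airH 0 * airH 1 * airH 0 * Real.sqrt 3/2) 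
      (r10 := airH 0 * airH 1 * airH 1/2 + airH 0 ^2)
      (c0 := airH 0 * airH 1 * airH 0/2) (c10 := Real.sqrt 3/2 * (airH 0 * airH 1) * airH 1)
      (B0 := airH 0^2) (B1 := Real.sqrt 3 * (airH 0 * airH 1)) (B2 := 2 * airH 1^2)
      (j0 := airH 0 * airH 1/2) hr ?_ ?_ ?_ ?_ ?_ ?_ ?_ ?_ ?_ ?_ ?_ ?_ ?_ ?_ ?_ ?_ ?_ ?_ ?_ hT
    · intro t; rw [er1]
      exact ((((h3 t).mul (h5 t)).add ((h4 t).mul (h6 t))).add (((h1 t).mul (h1 t)).add ((h2 t).mul (h2 t)))).congr_deriv (by ring)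
    · intro t
      exact (((h2 t).mul (h5 t)).sub ((h1 t).mul (h6 t))).congr_deriv (by ring)
    · intro t; rw [er]
      exact (((h4 t).mul (h5 t)).sub ((h3 t).mul (h6 t))).congr_deriv (by ring)
    · intro t
      exact (((h1 t).mul (h1 t)).add ((h2 t).mul (h2 t))).congr_deriv (by ring)
    · intro t
      exact ((((h3 t).mul (h1 t)).add ((h4 t).mul (h2 t))).const_mul 2).congr_deriv (by ring)
    · intro t
      exact ((((h3 t).mul (h3 t)).add ((h4 t).mul (h4 t))).const_mul 2).congr_deriv (by ring)
    · intro t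
      exact (((h4 t).mul (h1 t)).sub ((h3 t).mul (h2 t))).congr_deriv (by ring)
    · simp only [er, i1,i2,i3,i4,i5,i6]; ring
    · simp only [er1, i1,i2,i3,i4,i5,i6]; linear_combination airH 0^2/4*q2
    · simp only [i1,i2,i3,i4,i5,i6]; ring
    · simp only [i1,i2,i3,i4,i5,i6]; ring
    · simp only [i1,i2,i3,i4,i5,i6]; linear_combination airH 0^2/4*q2
    · simp only [i1,i2,i3,i4,i5,i6]; ring
    · simp only [i1,i2,i3,i4,i5,i6]; linear_combination airH 1^2/2*q2
    · simp only [i1,i2,i3,i4,i5,i6]; linear_combination airH 0*airH 1/4*q2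
    · intro t; nlinarith [mul_self_nonneg (vx t), mul_self_nonneg (vy t)]
    · positivity
    · positivity
    · intro t ht
      obtain ⟨k0,k1,k2,k3,k4,k5,k6,k7,k8,k9,k11⟩ := neg_coefs
      have hp := polyP_pos t ht
      have m1 := mul_nonneg ht (sub_nonneg.2 k1)
      have m2 := mul_nonneg (pow_nonneg ht 2) (sub_nonneg.2 k2)
      have m3 := mul_nonneg (pow_nonneg ht 3) (sub_nonneg.2 k3)
      have m4 := mul_nonneg (pow_nonneg ht 4) (sub_nonneg.2 k4)
      have m5 := mul_nonneg (pow_nonneg ht 5) (sub_nonneg.2 k5)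
      have m6 := mul_nonneg (pow_nonneg ht 6) (sub_nonneg.2 k6)
      have m7 := mul_nonneg (pow_nonneg ht 7) (sub_nonneg.2 k7)
      have m8 := mul_nonneg (pow_nonneg ht 8) (sub_nonneg.2 k8)
      have m9 := mul_nonneg (pow_nonneg ht 9) (sub_nonneg.2 k9)
      have m11 := mul_nonneg (pow_nonneg ht 11) (sub_nonneg.2 k11)
      simp only [pe]
      ring_nf at *
      linarith
  have hr1 : ∀ t, HasDerivAt r1 (t * (uy t * ax t - ux t * ay t) + 3/2 * (2*(vx t * ux t + vy t * uy t))) t := by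
    intro t; rw [er1]
    exact ((((h3 t).mul (h5 t)).add ((h4 t).mul (h6 t))).add (((h1 t).mul (h1 t)).add ((h2 t).mul (h2 t)))).congr_deriv (by ring)
  have hr0 : 0 < r 0 := by
    simp only [er, i1,i2,i3,i4,i5,i6]; ring_nf; positivity
  have hr10 : 0 ≤ r1 0 := by
    simp only [er1, i1,i2,i3,i4,i5,i6]; ring_nf; positivity
  have key : ∀ T, (∀ t ∈ Icc 0 T, 0 ≤ r t) → ∀ t ∈ Icc 0 T, 0 ≤ r t - r 0 := by
    intro T hT
    exact nn_of_deriv (fun t => (hr t).sub_const (r 0)) (by simp) (nn_of_deriv hr1 hr10 (step T hT))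
  have hcr : Continuous r := continuous_iff_continuousAt.2 fun t => (hr t).continuousAt
  suffices h : 0 ≤ r t by rw [er] at h; exact h
  by_contra hneg
  have hne : ({s | r s ≤ 0} ∩ Icc 0 t).Nonempty := ⟨t, (not_le.1 hneg).le, ht, le_refl t⟩
  have hcp : IsCompact ({s | r s ≤ 0} ∩ Icc 0 t) :=
    isCompact_Icc.inter_left (isClosed_le hcr continuous_const)
  obtain ⟨s0, ⟨hs0, hs0t⟩, hmin⟩ := hcp.exists_isLeast hne
  have hlt : ∀ s ∈ Ico 0 s0, 0 < r s := by
    intro s hs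
    by_contra hc
    exact absurd (hmin ⟨not_lt.1 hc, hs.1, hs.2.le.trans hs0t.2⟩) (not_le.2 hs.2)
  have h0s : 0 ≤ r s0 := by
    by_contra hc
    obtain ⟨s1, hs1, e⟩ := intermediate_value_Icc' hs0t.1 hcr.continuousOn
      (show (0:ℝ) ∈ Icc (r s0) (r 0) from ⟨hs0, hr0.le⟩)
    have : s1 ≠ s0 := by rintro rfl; exact hc e.ge
    exact absurd e (hlt s1 ⟨hs1.1, lt_of_le_of_ne hs1.2 this⟩).ne'
  have := key s0 (fun s hs => by
    rcases hs.2.eq_or_lt with h | h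
    · rw [h]; exact h0s
    · exact (hlt s ⟨hs.1, h⟩).le) s0 ⟨hs0t.1, le_refl _⟩
  have hs0' : r s0 ≤ 0 := hs0
  linarith

lemma hasDerivAt_re {f : ℝ → ℂ} {f' : ℂ} {t : ℝ} (h : HasDerivAt f f' t) :
    HasDerivAt (fun t => (f t).re) f'.re t := by
  exact (Complex.reCLM.hasFDerivAt.comp_hasDerivAt t h)

lemma hasDerivAt_im {f : ℝ → ℂ} {f' : ℂ} {t : ℝ} (h : HasDerivAt f f' t) :
    HasDerivAt (fun t => (f t).im) f'.im t := by
  exact (Complex.imCLM.hasFDerivAt.comp_hasDerivAt t h)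

lemma airy_neg_axis (t : ℝ) (ht : 0 ≤ t) :
    0 ≤ (airW 0 (-t) * (starRingEnd ℂ) (airA (-t))).re := by
  have h3 : (0:ℝ) < Real.sqrt 3 := by positivity
  have q2 : (Real.sqrt 3)^2 = 3 := Real.sq_sqrt (by norm_num)
  have hn : ∀ t : ℝ, HasDerivAt (fun t : ℝ => (-(t:ℂ))) (-1) t := fun t => (Complex.ofRealCLM.hasDerivAt (x := t)).neg
  have d0 : ∀ t : ℝ, HasDerivAt (fun t : ℝ => ((1/Real.sqrt 3 : ℝ):ℂ) * airW 0 (-t)) (((-1/Real.sqrt 3 : ℝ):ℂ) * airW 1 (-t)) t := fun t =>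
    (((airW_hasDerivAt 0 (-t)).comp t (hn t)).const_mul _).congr_deriv (by push_cast; ring)
  have d1 : ∀ t : ℝ, HasDerivAt (fun t : ℝ => ((-1/Real.sqrt 3 : ℝ):ℂ) * airW 1 (-t)) (-Complex.I * t * (((1/Real.sqrt 3 : ℝ):ℂ) * airW 0 (-t))) t := fun t =>
    (((airW_hasDerivAt 1 (-t)).comp t (hn t)).const_mul _).congr_deriv (by rw [airW_two]; push_cast; ring)
  have d2 : ∀ t : ℝ, HasDerivAt (fun t : ℝ => ((1/Real.sqrt 3 : ℝ):ℂ) * airA (-t)) (((1/Real.sqrt 3 : ℝ):ℂ) * airW 0 (-t)) t := fun t =>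
    (((airA_hasDerivAt (-t)).comp t (hn t)).const_mul _).congr_deriv (by push_cast; ring)
  have := real_neg_axis (fun t => hasDerivAt_re (d0 t)) (fun t => hasDerivAt_im (d0 t))
    (fun t => (hasDerivAt_re (d1 t)).congr_deriv (by simp)) (fun t => (hasDerivAt_im (d1 t)).congr_deriv (by simp))
    (fun t => hasDerivAt_re (d2 t)) (fun t => hasDerivAt_im (d2 t)) ?_ ?_ ?_ ?_ ?_ ?_ t ht
  · simp only [Complex.re_ofReal_mul, Complex.im_ofReal_mul] at this
    simp only [Complex.mul_re, Complex.conj_re, Complex.conj_im]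
    have e := mul_nonneg (mul_pos h3 h3).le this
    have : 1/√3 * √3 = 1 := by field_simp
    have e2 : √3 * √3 * (1 / √3 * (airW 0 (-↑t)).re * (1 / √3 * (airA (-↑t)).re) + 1 / √3 * (airW 0 (-↑t)).im * (1 / √3 * (airA (-↑t)).im)) = (airW 0 (-↑t)).re * (airA (-↑t)).re + (airW 0 (-↑t)).im * (airA (-↑t)).im := by
      field_simp
    rw [e2] at e; linarith
  all_goals
    simp [airW0_zero, airW1_zero, airA_zero, Complex.re_ofReal_mul, Complex.im_ofReal_mul]
    try field_simp
    try rw [q2]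

lemma nonpos_of_tendsto {f f' : ℝ → ℝ} (h : ∀ t, 0 ≤ t → HasDerivAt f (f' t) t)
    (hp : ∀ t, 0 ≤ t → 0 ≤ f' t) (hl : Tendsto f atTop (𝓝 0)) : ∀ t, 0 ≤ t → f t ≤ 0 := by
  have hm : MonotoneOn f (Ici 0) := by
    apply monotoneOn_of_deriv_nonneg (convex_Ici 0)
    · exact fun x hx => (h x hx).continuousAt.continuousWithinAt
    · intro x hx
      rw [interior_Ici] at hx
      exact (h x (le_of_lt hx)).differentiableAt.differentiableWithinAt
    · intro x hx
      rw [interior_Ici] at hx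
      rw [(h x (le_of_lt hx)).deriv]
      exact hp x (le_of_lt hx)
  intro t ht
  apply ge_of_tendsto hl
  filter_upwards [eventually_ge_atTop t] with s hs
  exact hm ht (ht.trans hs) hs

lemma nonneg_of_tendsto {f f' : ℝ → ℝ} (h : ∀ t, 0 ≤ t → HasDerivAt f (f' t) t)
    (hp : ∀ t, 0 ≤ t → f' t ≤ 0) (hl : Tendsto f atTop (𝓝 0)) : ∀ t, 0 ≤ t → 0 ≤ f t := by
  intro t ht
  have := nonpos_of_tendsto (f := fun t => - f t) (fun t ht => (h t ht).neg)
    (fun t ht => by have := hp t ht; linarith) (by simpa using hl.neg) t ht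
  linarith

/-- directions allowed for decay: along `y + e s`, `Im e ≤ 0`, `√3/2 Re e + Im e/2 ≥ 0`. -/
lemma ray_mem_airS (y e : ℂ) (he : e.im ≤ 0) (he2 : 0 ≤ (Real.sqrt 3/2) * e.re + e.im/2) :
    ∃ R, ∀ s : ℝ, 0 ≤ s → y + e * s ∈ airS R := by
  refine ⟨|y.im| + |(Real.sqrt 3/2) * y.re + y.im/2|, fun s hs => ⟨?_, ?_⟩⟩
  · simp
    have := mul_nonpos_of_nonpos_of_nonneg he hs
    have h1 := le_abs_self y.im
    have h2 := abs_nonneg ((Real.sqrt 3/2) * y.re + y.im/2)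
    linarith
  · simp
    have := mul_nonneg he2 hs
    have h1 := abs_nonneg y.im
    have h2 := neg_abs_le ((Real.sqrt 3/2) * y.re + y.im/2)
    nlinarith

lemma ray_tendsto {f : ℂ → ℂ} (y e : ℂ) (p : ℕ) (he0 : e ≠ 0) (he : e.im ≤ 0)
    (he2 : 0 ≤ (Real.sqrt 3/2) * e.re + e.im/2)
    (hf : ∀ p R, ∃ C, 0 ≤ C ∧ ∀ y ∈ airS R, ‖y‖^p * ‖f y‖ ≤ C) :
    Tendsto (fun s : ℝ => s^p * ‖f (y + e * s)‖) atTop (𝓝 0) := by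
  obtain ⟨R, hR⟩ := ray_mem_airS y e he he2
  obtain ⟨C, hC0, hC⟩ := hf (p+1) R
  have hep : 0 < ‖e‖ := norm_pos_iff.2 he0
  have hlim : Tendsto (fun s : ℝ => (2/‖e‖)^(p+1) * C * s⁻¹) atTop (𝓝 0) := by
    simpa using tendsto_inv_atTop_zero.const_mul ((2/‖e‖)^(p+1) * C)
  refine squeeze_zero' ?_ ?_ hlim
  · filter_upwards [eventually_ge_atTop (0:ℝ)] with s hs
    positivity
  · filter_upwards [eventually_ge_atTop (1:ℝ), eventually_ge_atTop (2*‖y‖/‖e‖)] with s hs hs2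
    have hs0 : 0 < s := by linarith
    have h1 : s * ‖e‖/2 ≤ ‖y + e * s‖ := by
      have : ‖e * s‖ ≤ ‖y + e * s‖ + ‖y‖ := by
        calc ‖e * s‖ = ‖(y + e*s) - y‖ := by congr 1; ring
          _ ≤ _ := norm_sub_le _ _
      rw [norm_mul, Complex.norm_real, Real.norm_of_nonneg hs0.le] at this
      rw [div_le_iff₀ hep] at hs2
      linarith
    have h2 := hC _ (hR s hs0.le)
    have h3 : (s * ‖e‖/2)^(p+1) * ‖f (y + e*s)‖ ≤ C := by
      refine le_trans ?_ h2
      gcongr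
    have : s^p * ‖f (y + e*s)‖ = (2/‖e‖)^(p+1) * ((s * ‖e‖/2)^(p+1) * ‖f (y + e*s)‖) * s⁻¹ := by
      rw [div_pow, div_pow, mul_pow]; field_simp; ring
    rw [this]
    gcongr

lemma airW_ray0 (k : ℕ) (y : ℂ) (p : ℕ) : Tendsto (fun s : ℝ => s^p * ‖airW k (y + s)‖) atTop (𝓝 0) := by
  have := ray_tendsto (f := airW k) y 1 p one_ne_zero (by simp) (by simp; positivity) (fun p R => airW_decay p R k)
  simpa using this

lemma airA_ray0 (y : ℂ) (p : ℕ) : Tendsto (fun s : ℝ => s^p * ‖airA (y + s)‖) atTop (𝓝 0) := by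
  have := ray_tendsto (f := airA) y 1 p one_ne_zero (by simp) (by simp; positivity) airA_decay
  simpa using this

lemma airW_ray (k : ℕ) (y : ℂ) : Tendsto (fun s : ℝ => airW k (y + s)) atTop (𝓝 0) := by
  rw [tendsto_zero_iff_norm_tendsto_zero]; simpa using airW_ray0 k y 0

lemma airA_ray (y : ℂ) : Tendsto (fun s : ℝ => airA (y + s)) atTop (𝓝 0) := by
  rw [tendsto_zero_iff_norm_tendsto_zero]; simpa using airA_ray0 y 0

lemma ray_deriv (y e : ℂ) (t : ℝ) : HasDerivAt (fun s : ℝ => y + e * s) e t := by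
  have := ((Complex.ofRealCLM.hasDerivAt (x := t)).const_mul e).const_add y
  exact this.congr_deriv (by simp)

lemma airW_ray_deriv (k : ℕ) (y : ℂ) (t : ℝ) :
    HasDerivAt (fun s : ℝ => airW k (y + s)) (airW (k+1) (y + t)) t := by
  have h := ray_deriv y 1 t
  simp only [one_mul] at h
  exact ((airW_hasDerivAt k (y + t)).comp t h).congr_deriv (by ring)

lemma airA_ray_deriv (y : ℂ) (t : ℝ) :
    HasDerivAt (fun s : ℝ => airA (y + s)) (-airW 0 (y + t)) t := by
  have h := ray_deriv y 1 t
  simp only [one_mul] at h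
  have h2 := (airA_hasDerivAt (y + t)).comp t h
  exact h2.congr_deriv (by ring)

lemma hasDerivAt_cross {f g : ℝ → ℂ} {f' g' : ℂ} {t : ℝ} (hf : HasDerivAt f f' t) (hg : HasDerivAt g g' t) :
    HasDerivAt (fun t => f t * (starRingEnd ℂ) (g t)) (f' * (starRingEnd ℂ) (g t) + f t * (starRingEnd ℂ) g') t := by
  have : HasDerivAt (fun t => (starRingEnd ℂ) (g t)) ((starRingEnd ℂ) g') t :=
    (Complex.conjCLE.toContinuousLinearMap.hasFDerivAt.comp_hasDerivAt t hg)
  exact hf.mul this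

lemma tendsto_cross {f g : ℝ → ℂ} {l : Filter ℝ} (hf : Tendsto f l (𝓝 0)) (hg : Tendsto g l (𝓝 0)) :
    Tendsto (fun t => f t * (starRingEnd ℂ) (g t)) l (𝓝 0) := by
  have : Tendsto (fun t => (starRingEnd ℂ) (g t)) l (𝓝 ((starRingEnd ℂ) 0)) :=
    (Complex.continuous_conj.tendsto 0).comp hg
  simpa using hf.mul this

lemma tendsto_re0 {f : ℝ → ℂ} {l : Filter ℝ} (hf : Tendsto f l (𝓝 0)) : Tendsto (fun t => (f t).re) l (𝓝 0) :=
  (Complex.continuous_re.tendsto 0).comp hf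
lemma tendsto_im0 {f : ℝ → ℂ} {l : Filter ℝ} (hf : Tendsto f l (𝓝 0)) : Tendsto (fun t => (f t).im) l (𝓝 0) :=
  (Complex.continuous_im.tendsto 0).comp hf

lemma airW_cross_nonpos (y : ℂ) (hy : y.im ≤ 0) (s : ℝ) (hs : 0 ≤ s) :
    (airW 1 (y+s) * (starRingEnd ℂ) (airW 0 (y+s))).re ≤ 0 := by
  refine nonpos_of_tendsto (f := fun s : ℝ => (airW 1 (y+s) * (starRingEnd ℂ) (airW 0 (y+s))).re)
    (fun t _ => hasDerivAt_re (hasDerivAt_cross (airW_ray_deriv 1 y t) (airW_ray_deriv 0 y t))) ?_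
    (tendsto_re0 (tendsto_cross (airW_ray 1 y) (airW_ray 0 y))) s hs
  intro t _
  rw [airW_two]
  simp [Complex.mul_re, Complex.mul_im]
  nlinarith [mul_self_nonneg (airW 0 (y+t)).re, mul_self_nonneg (airW 0 (y+t)).im, mul_self_nonneg (airW 1 (y+t)).re, mul_self_nonneg (airW 1 (y+t)).im]

lemma norm_antitone_ray {f : ℝ → ℂ} {f' : ℝ → ℂ} (h : ∀ t, HasDerivAt f (f' t) t)
    (hn : ∀ t, 0 ≤ t → (f' t * (starRingEnd ℂ) (f t)).re ≤ 0) (s t : ℝ) (hs : 0 ≤ s) (hst : s ≤ t) : ‖f t‖ ≤ ‖f s‖ := by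
  have ha : AntitoneOn (fun s => (f s * (starRingEnd ℂ) (f s)).re) (Ici 0) := by
    have hd := fun t => hasDerivAt_re (hasDerivAt_cross (h t) (h t))
    apply antitoneOn_of_deriv_nonpos (convex_Ici 0)
    · exact fun x hx => (hd x).continuousAt.continuousWithinAt
    · exact fun x hx => (hd x).differentiableAt.differentiableWithinAt
    · intro x hx
      rw [interior_Ici] at hx
      rw [(hd x).deriv]
      have := hn x (le_of_lt hx)
      simp [Complex.mul_re] at this ⊢
      linarith
  have := ha hs (hs.trans hst) hst
  simp only [Complex.mul_conj, Complex.ofReal_re] at this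
  rw [Complex.normSq_eq_norm_sq, Complex.normSq_eq_norm_sq] at this
  exact (sq_le_sq₀ (norm_nonneg _) (norm_nonneg _)).1 this

lemma airW_ray_le (y : ℂ) (hy : y.im ≤ 0) (s : ℝ) (hs : 0 ≤ s) : ‖airW 0 (y+s)‖ ≤ ‖airW 0 y‖ := by
  simpa using norm_antitone_ray (airW_ray_deriv 0 y) (airW_cross_nonpos y hy) 0 s le_rfl hs

lemma airW_zero_ne : airW 0 0 ≠ 0 := by
  rw [airW0_zero]
  have := (airH_pos 0).ne'
  refine mul_ne_zero (mul_ne_zero (by simp) (by exact_mod_cast this)) ?_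
  intro h
  have := congrArg Complex.im h
  norm_num at this

lemma airW_not_ray_zero (y : ℂ) (h : ∀ s : ℝ, 0 ≤ s → airW 0 (y+s) = 0) : False := by
  have hd : Differentiable ℂ (airW 0) := fun y => (airW_hasDerivAt 0 y).differentiableAt
  have ha : AnalyticOnNhd ℂ (airW 0) univ := fun z _ => hd.analyticAt z
  have := ha.eqOn_zero_of_preconnected_of_frequently_eq_zero isPreconnected_univ (mem_univ y) ?_
  · exact airW_zero_ne (this (mem_univ 0))
  · have ht : Tendsto (fun s : ℝ => y + s) (𝓝[>] 0) (𝓝[≠] y) := by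
      rw [tendsto_nhdsWithin_iff]
      constructor
      · have : Tendsto (fun s : ℝ => y + s) (𝓝 0) (𝓝 (y + (0:ℝ))) := by
          apply Continuous.tendsto; fun_prop
        simp only [Complex.ofReal_zero, add_zero] at this
        exact this.mono_left nhdsWithin_le_nhds
      · filter_upwards [self_mem_nhdsWithin] with s hs
        have : (s:ℂ) ≠ 0 := by exact_mod_cast (ne_of_gt hs)
        simpa using this
    refine ht.frequently (Eventually.frequently ?_)
    filter_upwards [self_mem_nhdsWithin] with s hs
    exact h s (le_of_lt hs)

lemma airW_ne (y : ℂ) (hy : y.im ≤ 0) : airW 0 y ≠ 0 := by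
  intro h
  refine airW_not_ray_zero y fun s hs => ?_
  have := airW_ray_le y hy s hs
  rw [h, norm_zero] at this
  exact norm_le_zero_iff.1 this

lemma airW1_le (y : ℂ) (hy : y.im ≤ 0) : ‖airW 1 y‖ ≤ (‖y‖+3) * ‖airW 0 y‖ := by
  have h1 : ∀ s ∈ Icc (0:ℝ) 1, ‖airW 1 (y+s) - airW 1 (y+(0:ℝ))‖ ≤ ((‖y‖+1) * ‖airW 0 y‖) * (s - 0) := by
    apply norm_image_sub_le_of_norm_deriv_le_segment' (f' := fun s => airW 2 (y+s))
    · exact fun s _ => (airW_ray_deriv 1 y s).hasDerivWithinAt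
    · intro s hs
      rw [airW_two, norm_mul, norm_mul, Complex.norm_I, one_mul]
      gcongr
      · refine (norm_add_le _ _).trans ?_
        rw [Complex.norm_real, Real.norm_of_nonneg hs.1]
        linarith [hs.2]
      · exact airW_ray_le y hy s hs.1
  have hd : ∀ s : ℝ, HasDerivAt (fun s : ℝ => airW 0 (y+s) - s * airW 1 y) (airW 1 (y+s) - airW 1 y) s := by
    intro s
    refine (airW_ray_deriv 0 y s).sub ?_
    simpa using (Complex.ofRealCLM.hasDerivAt (x := s)).mul_const (airW 1 y)
  have h2 := norm_image_sub_le_of_norm_deriv_le_segment' (a := (0:ℝ)) (b := 1)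
    (C := (‖y‖+1) * ‖airW 0 y‖) (fun s _ => (hd s).hasDerivWithinAt) (fun s hs => by
      have := h1 s ⟨hs.1, hs.2.le⟩
      simp only [Complex.ofReal_zero, add_zero, sub_zero] at this
      refine this.trans ?_
      have : 0 ≤ (‖y‖+1) * ‖airW 0 y‖ := by positivity
      nlinarith [hs.2]) 1 ⟨zero_le_one, le_rfl⟩
  have h3 := airW_ray_le y hy 1 zero_le_one
  simp only [Complex.ofReal_zero, Complex.ofReal_one, one_mul, zero_mul, add_zero, sub_zero, mul_one] at h2 h3
  have : airW 1 y = airW 0 (y+1) - airW 0 y - (airW 0 (y+1) - airW 1 y - airW 0 y) := by ring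
  calc ‖airW 1 y‖ = ‖airW 0 (y+1) - airW 0 y - (airW 0 (y+1) - airW 1 y - airW 0 y)‖ := by rw [← this]
    _ ≤ ‖airW 0 (y+1)‖ + ‖airW 0 y‖ + ‖airW 0 (y+1) - airW 1 y - airW 0 y‖ :=
      (norm_sub_le _ _).trans (by gcongr; exact norm_sub_le _ _)
    _ ≤ _ := by linarith

lemma ray_im_le (y : ℂ) (hy : y.im ≤ 0) (s : ℝ) : (y + s).im ≤ 0 := by simpa using hy

lemma airA_le1 (y : ℂ) (hy : y.im ≤ 0) (hy1 : 1 ≤ y.re) : ‖airA y‖ ≤ 6 * ‖airW 0 y‖ := by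
  have hz : ∀ s : ℝ, 0 ≤ s → 1 + s ≤ ‖y + s‖ := by
    intro s hs
    have := (le_abs_self _).trans (Complex.abs_re_le_norm (y+s))
    simp at this; linarith
  have hz0 : ∀ s : ℝ, 0 ≤ s → (y + s) ≠ 0 := by
    intro s hs h
    have := hz s hs
    rw [h, norm_zero] at this; linarith
  have hy0 : 1 ≤ ‖y‖ := by simpa using hz 0 le_rfl
  have hyne : y ≠ 0 := by simpa using hz0 0 le_rfl
  have hI := Complex.I_ne_zero
  obtain ⟨G, hG⟩ : ∃ G, G = fun s : ℝ => airA (y+s) + airW 1 (y+s) / (Complex.I * (y+s)) + airW 0 (y+s) / (Complex.I * (y+s)^2) := ⟨_, rfl⟩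
  have hzd : ∀ s : ℝ, HasDerivAt (fun s : ℝ => y + s) 1 s := by
    intro s; simpa using ray_deriv y 1 s
  have hGd : ∀ s : ℝ, 0 ≤ s → HasDerivAt G (-2 * airW 0 (y+s) / (Complex.I * (y+s)^3)) s := by
    intro s hs
    have hne := hz0 s hs
    rw [hG]
    have h := ((airA_ray_deriv y s).add ((airW_ray_deriv 1 y s).div ((hzd s).const_mul Complex.I) (mul_ne_zero hI hne))).add
      ((airW_ray_deriv 0 y s).div (((hzd s).pow 2).const_mul Complex.I) (mul_ne_zero hI (pow_ne_zero 2 hne)))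
    refine h.congr_deriv ?_
    simp only [Pi.pow_apply, Nat.reduceAdd]
    rw [airW_two]
    field_simp
    ring
  have hGl : Tendsto G atTop (𝓝 0) := by
    have hb : ∀ (k p : ℕ), Tendsto (fun s : ℝ => airW k (y+s) / (Complex.I * (y+s)^p)) atTop (𝓝 0) := by
      intro k p
      rw [tendsto_zero_iff_norm_tendsto_zero]
      have h0 := airW_ray0 k y 0
      simp only [pow_zero, one_mul] at h0
      refine squeeze_zero' (Eventually.of_forall fun s => norm_nonneg _) ?_ h0
      filter_upwards [eventually_ge_atTop (0:ℝ)] with s hs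
      rw [norm_div, norm_mul, Complex.norm_I, one_mul, norm_pow]
      apply div_le_self (norm_nonneg _)
      exact one_le_pow₀ (by linarith [hz s hs])
    rw [hG]
    have := ((airA_ray y).add (hb 1 1)).add (hb 0 2)
    simpa using this
  have hG0 : ‖G 0‖ ≤ ‖airW 0 y‖ := by
    obtain ⟨c, hc⟩ : ∃ c, c = (starRingEnd ℂ) (G 0) := ⟨_, rfl⟩
    have hcn : ‖c‖ = ‖G 0‖ := by rw [hc, RCLike.norm_conj]
    have hlim : Tendsto (fun s : ℝ => ‖c‖ * ‖airW 0 y‖ * ((1+s)^2)⁻¹) atTop (𝓝 0) := by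
      have : Tendsto (fun s : ℝ => ((1+s)^2)⁻¹) atTop (𝓝 0) :=
        tendsto_inv_atTop_zero.comp ((tendsto_pow_atTop two_ne_zero).comp (tendsto_atTop_add_const_left _ 1 tendsto_id))
      simpa using this.const_mul (‖c‖ * ‖airW 0 y‖)
    have hk : ∀ s : ℝ, 0 ≤ s → HasDerivAt (fun s : ℝ => ‖c‖ * ‖airW 0 y‖ * ((1+s)^2)⁻¹) (‖c‖ * ‖airW 0 y‖ * (-2 / (1+s)^3)) s := by
      intro s hs
      have h1 : (1 + s) ≠ 0 := by positivity
      have := ((((hasDerivAt_id s).const_add 1).pow 2).inv (pow_ne_zero 2 h1)).const_mul (‖c‖ * ‖airW 0 y‖)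
      refine this.congr_deriv ?_
      simp; left
      field_simp
    have := nonpos_of_tendsto (f := fun s => (c * G s).re - ‖c‖ * ‖airW 0 y‖ * ((1+s)^2)⁻¹)
      (fun s hs => (hasDerivAt_re ((hGd s hs).const_mul c)).sub (hk s hs)) ?_ ?_ 0 le_rfl
    · have e : (c * G 0).re = ‖G 0‖ * ‖G 0‖ := by
        rw [hc, mul_comm, Complex.mul_conj, Complex.ofReal_re, Complex.normSq_eq_norm_sq]; ring
      simp only [e, hcn] at this
      norm_num at this
      by_contra hcon
      push Not at hcon
      have hp : 0 < ‖G 0‖ := lt_of_le_of_lt (norm_nonneg _) hcon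
      nlinarith
    · intro s hs
      have h1 : ‖c * (-2 * airW 0 (y+s) / (Complex.I * (y+s)^3))‖ ≤ ‖c‖ * (2 * ‖airW 0 y‖ / (1+s)^3) := by
        rw [norm_mul, norm_div, norm_mul, norm_mul, Complex.norm_I, one_mul, norm_pow]
        have := airW_ray_le y hy s hs
        have := hz s hs
        rw [norm_neg, Complex.norm_ofNat]
        gcongr
      have h2 := (Complex.abs_re_le_norm (c * (-2 * airW 0 (y+s) / (Complex.I * (y+s)^3)))).trans h1
      have h3 := (abs_le.1 h2).1
      have e : ‖c‖ * ‖airW 0 y‖ * (-2 / (1+s)^3) = -(‖c‖ * (2 * ‖airW 0 y‖ / (1+s)^3)) := by ring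
      rw [e]; linarith
    · have h1 : Tendsto (fun s => (c * G s).re) atTop (𝓝 0) := tendsto_re0 (by simpa using hGl.const_mul c)
      simpa using h1.sub hlim
  have e : airA y = G 0 - airW 1 y / (Complex.I * y) - airW 0 y / (Complex.I * y^2) := by
    rw [hG]; simp; ring
  have h1 := airW1_le y hy
  have e1 : ‖airW 1 y / (Complex.I * y)‖ ≤ 4 * ‖airW 0 y‖ := by
    rw [norm_div, norm_mul, Complex.norm_I, one_mul, div_le_iff₀ (by linarith)]
    have := mul_nonneg (norm_nonneg (airW 0 y)) (sub_nonneg.2 hy0)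
    nlinarith
  have e2 : ‖airW 0 y / (Complex.I * y^2)‖ ≤ ‖airW 0 y‖ := by
    rw [norm_div, norm_mul, Complex.norm_I, one_mul, norm_pow]
    exact div_le_self (norm_nonneg _) (one_le_pow₀ hy0)
  rw [e]
  have := (norm_sub_le (G 0 - airW 1 y / (Complex.I * y)) (airW 0 y / (Complex.I * y^2))).trans (add_le_add_left (norm_sub_le _ _) _)
  linarith

lemma airA_le (y : ℂ) (hy : y.im ≤ 0) : ‖airA y‖ ≤ (7 + |y.re|) * ‖airW 0 y‖ := by
  obtain ⟨T, hT⟩ : ∃ T, T = 1 + |y.re| := ⟨_, rfl⟩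
  have hT0 : 0 ≤ T := by rw [hT]; positivity
  have h1 := norm_image_sub_le_of_norm_deriv_le_segment' (a := (0:ℝ)) (b := T) (C := ‖airW 0 y‖)
    (fun s _ => (airA_ray_deriv y s).hasDerivWithinAt) (fun s hs => by
      rw [norm_neg]; exact airW_ray_le y hy s hs.1) T ⟨hT0, le_rfl⟩
  have h2 := airA_le1 (y + T) (ray_im_le y hy T) (by
    simp; have := neg_abs_le y.re; linarith)
  have h3 := airW_ray_le y hy T hT0
  simp only [Complex.ofReal_zero, add_zero, sub_zero] at h1
  have := norm_sub_norm_le (airA y) (airA (y+T))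
  rw [norm_sub_rev] at this
  rw [show 7 + |y.re| = 6 + T by rw [hT]; ring]
  nlinarith

noncomputable def airQ (y : ℂ) : ℂ := airA y / airW 0 y

lemma airQ_le (y : ℂ) (hy : y.im ≤ 0) : ‖airQ y‖ ≤ 7 + |y.re| := by
  rw [airQ, norm_div, div_le_iff₀ (norm_pos_iff.2 (airW_ne y hy))]
  exact airA_le y hy

lemma airQ_re_iff (y : ℂ) (hy : y.im ≤ 0) : 0 ≤ (airQ y).re ↔ 0 ≤ (airW 0 y * (starRingEnd ℂ) (airA y)).re := by
  have hn : 0 < Complex.normSq (airW 0 y) := Complex.normSq_pos.2 (airW_ne y hy)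
  have : (airQ y).re = (airW 0 y * (starRingEnd ℂ) (airA y)).re / Complex.normSq (airW 0 y) := by
    rw [airQ, Complex.div_re]; simp; ring
  rw [this]
  constructor
  · intro h
    have := mul_nonneg h hn.le
    rwa [div_mul_cancel₀ _ hn.ne'] at this
  · intro h; exact div_nonneg h hn.le

/-- the logarithmic derivative -/
noncomputable def airN (y : ℂ) : ℂ := - airW 1 y / airW 0 y

lemma airN_le (y : ℂ) (hy : y.im ≤ 0) : ‖airN y‖ ≤ ‖y‖ + 3 := by
  rw [airN, norm_div, norm_neg, div_le_iff₀ (norm_pos_iff.2 (airW_ne y hy))]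
  exact airW1_le y hy

lemma airN_cross (y : ℂ) (hy : y.im ≤ 0) (e : ℂ) :
    (e * airW 1 y * (starRingEnd ℂ) (airW 0 y)) = - e * airN y * (Complex.normSq (airW 0 y) : ℂ) := by
  have := airW_ne y hy
  rw [airN, ← Complex.mul_conj]
  field_simp

lemma airN_im_nonneg (y : ℝ) (hy : 0 ≤ y) : 0 ≤ (airN y).im := by
  have h := nonpos_of_tendsto (f := fun s : ℝ => (airW 1 (y+s) * (starRingEnd ℂ) (airW 0 (y+s))).im)
    (fun t _ => hasDerivAt_im (hasDerivAt_cross (airW_ray_deriv 1 y t) (airW_ray_deriv 0 y t))) ?_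
    (tendsto_im0 (tendsto_cross (airW_ray 1 y) (airW_ray 0 y))) 0 le_rfl
  · have e := airN_cross y (by simp) 1
    simp only [one_mul] at e
    simp only [Complex.ofReal_zero, add_zero, e] at h
    have hn : 0 < Complex.normSq (airW 0 y) := Complex.normSq_pos.2 (airW_ne y (by simp))
    simp at h
    by_contra hc
    push Not at hc
    have := airW_ne y (by simp)
    nlinarith
  · intro t ht
    rw [airW_two]
    simp [Complex.mul_re, Complex.mul_im]
    have : 0 ≤ y + t := by linarith
    nlinarith [mul_nonneg this (mul_self_nonneg (airW 0 (y+t)).re), mul_nonneg this (mul_self_nonneg (airW 0 (y+t)).im)]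

lemma airN_re_ge_im (y : ℝ) (hy : 0 ≤ y) : (airN y).im ≤ (airN y).re := by
  obtain ⟨e, he⟩ : ∃ e : ℂ, e = ⟨1, -1⟩ := ⟨_, rfl⟩
  have he2 : e^2 = -2 * Complex.I := by
    rw [he]; apply Complex.ext <;> simp [pow_two]; norm_num
  have hed : ∀ k, ∀ t : ℝ, HasDerivAt (fun s : ℝ => airW k (y + e * s)) (e * airW (k+1) (y + e * t)) t := by
    intro k t
    have := (airW_hasDerivAt k (y + e*t)).comp t (ray_deriv y e t)
    exact this.congr_deriv (by ring)
  have hel : ∀ k, Tendsto (fun s : ℝ => airW k (y + e * s)) atTop (𝓝 0) := by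
    intro k
    rw [tendsto_zero_iff_norm_tendsto_zero]
    have := ray_tendsto (f := airW k) y e 0 (by rw [he]; intro h; simpa using congrArg Complex.re h) (by rw [he]; simp) (by
      rw [he]; simp
      have := sqrt3_bounds.1
      linarith) (fun p R => airW_decay p R k)
    simpa using this
  have h := nonneg_of_tendsto (f := fun s : ℝ => (e * airW 1 (y+e*s) * (starRingEnd ℂ) (airW 0 (y+e*s))).im)
    (fun t _ => hasDerivAt_im (hasDerivAt_cross ((hed 1 t).const_mul e) (hed 0 t))) ?_
    (tendsto_im0 (tendsto_cross (by simpa using (hel 1).const_mul e) (hel 0))) 0 le_rfl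
  · have e1 := airN_cross y (by simp) e
    simp only [Complex.ofReal_zero, mul_zero, add_zero, e1] at h
    have hn : 0 < Complex.normSq (airW 0 y) := Complex.normSq_pos.2 (airW_ne y (by simp))
    simp [he] at h
    by_contra hc
    push Not at hc
    nlinarith
  · intro t ht
    have e1 : e * (e * airW (1+1) (y + e*t)) = 2 * (y + e * t) * airW 0 (y+e*t) := by
      have : e * (e * airW (1+1) (y + e*t)) = e^2 * airW 2 (y + e*t) := by ring
      rw [this, airW_two, he2]
      linear_combination (-2 * (y + e * t) * airW 0 (y+e*t)) * Complex.I_sq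
    rw [e1, he]
    simp [Complex.mul_re, Complex.mul_im]
    nlinarith [mul_nonneg ht (mul_self_nonneg (airW 0 (y+(⟨1,-1⟩:ℂ)*t)).re), mul_nonneg ht (mul_self_nonneg (airW 0 (y+(⟨1,-1⟩:ℂ)*t)).im)]

lemma airN_ray_deriv (y : ℂ) (hy : y.im ≤ 0) (t : ℝ) :
    HasDerivAt (fun s : ℝ => airN (y + s)) (airN (y+t)^2 - Complex.I * (y+t)) t := by
  have hne := airW_ne (y+t) (ray_im_le y hy t)
  have := ((airW_ray_deriv 1 y t).neg).div (airW_ray_deriv 0 y t) hne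
  refine this.congr_deriv ?_
  rw [airN]
  simp only [Nat.reduceAdd]
  rw [airW_two]
  simp
  field_simp
  ring

lemma airQ_ray_deriv (y : ℂ) (hy : y.im ≤ 0) (t : ℝ) :
    HasDerivAt (fun s : ℝ => airQ (y + s)) (-1 + airN (y+t) * airQ (y+t)) t := by
  have hne := airW_ne (y+t) (ray_im_le y hy t)
  have := (airA_ray_deriv y t).div (airW_ray_deriv 0 y t) hne
  refine this.congr_deriv ?_
  rw [airN, airQ]
  simp only [Nat.reduceAdd]
  field_simp
  ring

lemma airWn_ray_deriv (y : ℂ) (hy : y.im ≤ 0) (t : ℝ) :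
    HasDerivAt (fun s : ℝ => ‖airW 0 (y + s)‖) (-(airN (y+t)).re * ‖airW 0 (y+t)‖) t := by
  have hne := airW_ne (y+t) (ray_im_le y hy t)
  have hp : 0 < ‖airW 0 (y+t)‖ := norm_pos_iff.2 hne
  have h1 := hasDerivAt_re (hasDerivAt_cross (airW_ray_deriv 0 y t) (airW_ray_deriv 0 y t))
  have e : ∀ s : ℝ, (airW 0 (y + s) * (starRingEnd ℂ) (airW 0 (y+s))).re = ‖airW 0 (y+s)‖^2 := by
    intro s
    rw [Complex.mul_conj, Complex.ofReal_re, Complex.normSq_eq_norm_sq]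
  have h2 := h1.sqrt (by rw [e]; positivity)
  simp only [e, Real.sqrt_sq (norm_nonneg _)] at h2
  refine h2.congr_deriv ?_
  have e2 := airN_cross (y+t) (ray_im_le y hy t) 1
  have e3 : (airW (0 + 1) (y + t) * (starRingEnd ℂ) (airW 0 (y + t)) + airW 0 (y + t) * (starRingEnd ℂ) (airW (0 + 1) (y + t))).re
     = 2 * (1 * airW 1 (y + t) * (starRingEnd ℂ) (airW 0 (y + t))).re := by
    simp [Complex.mul_re]; ring
  rw [e3, e2, Complex.normSq_eq_norm_sq]
  simp only [neg_mul, one_mul, Complex.neg_re, Complex.re_mul_ofReal]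
  field_simp

lemma airQ_pos_axis (y : ℝ) (hy : 0 ≤ y) : 0 ≤ (airQ y).re := by
  have him : ((y:ℂ)).im ≤ 0 := by simp
  have h := nonneg_of_tendsto (f := fun s : ℝ => ‖airW 0 (y + s)‖ * ((airQ (y+s)).re - 1/2 * (airN (y+s)).re * ((airQ (y+s)).re * (airQ (y+s)).re + (airQ (y+s)).im * (airQ (y+s)).im)))
    (fun t _ => (airWn_ray_deriv y him t).mul ((hasDerivAt_re (airQ_ray_deriv y him t)).sub
      (((hasDerivAt_re (airN_ray_deriv y him t)).const_mul (1/2)).mul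
        (((hasDerivAt_re (airQ_ray_deriv y him t)).mul (hasDerivAt_re (airQ_ray_deriv y him t))).add
        ((hasDerivAt_im (airQ_ray_deriv y him t)).mul (hasDerivAt_im (airQ_ray_deriv y him t))))))) ?_ ?_ 0 le_rfl
  · simp only [Complex.ofReal_zero, add_zero] at h
    have hp : 0 < ‖airW 0 y‖ := norm_pos_iff.2 (airW_ne y him)
    have h2 : 0 ≤ (airQ y).re - 1/2 * (airN y).re * ((airQ y).re * (airQ y).re + (airQ y).im * (airQ y).im) := by
      by_contra hc
      push Not at hc
      have := mul_neg_of_pos_of_neg hp hc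
      linarith
    have h3 : 0 ≤ (airN y).re := (airN_im_nonneg y hy).trans (airN_re_ge_im y hy)
    have : 0 ≤ 1/2 * (airN y).re * ((airQ y).re * (airQ y).re + (airQ y).im * (airQ y).im) := by
      have := mul_self_nonneg (airQ y).re
      have := mul_self_nonneg (airQ y).im
      positivity
    linarith
  · intro t ht
    have hb := airN_im_nonneg (y+t) (by linarith)
    have ha := airN_re_ge_im (y+t) (by linarith)
    have hm := norm_nonneg (airW 0 (y+t))
    push_cast at ha hb
    simp only [Complex.add_re, Complex.sub_re, Complex.mul_re, Complex.add_im, Complex.neg_re, Complex.one_re, Complex.neg_im, Complex.one_im, pow_two, Complex.mul_im, Complex.I_re, Complex.I_im, Complex.ofReal_re, Complex.ofReal_im]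
    generalize (airN (y+t)).re = α at *
    generalize (airN (y+t)).im = β at *
    generalize (airQ (y+t)).re = x at *
    generalize (airQ (y+t)).im = v at *
    generalize ‖airW 0 (y+t)‖ = m at *
    have key : -1 + (α*x-β*v) - 1/2*(2*α^2-β^2)*(x^2+v^2) ≤ 0 := by
      nlinarith [sq_nonneg (1/2*(α*x-β*v) - 1), sq_nonneg (α*v+β*x), mul_nonneg (sub_nonneg.2 ha) (add_nonneg hb (hb.trans ha)), mul_nonneg (mul_nonneg (sub_nonneg.2 ha) (add_nonneg hb (hb.trans ha))) (add_nonneg (sq_nonneg x) (sq_nonneg v))]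
    have := mul_nonneg hm (sub_nonneg.2 key)
    nlinarith
  · have hlim : Tendsto (fun s : ℝ => 1/2 * (s^2 * ‖airA (y+s)‖) + (1/2) * (2*y+10) * (s^1 * ‖airA (y+s)‖) + (1 + 1/2*(y+3)*(y+7)) * (s^0*‖airA (y+s)‖)) atTop (𝓝 0) := by
      have := (((airA_ray0 y 2).const_mul (1/2)).add ((airA_ray0 y 1).const_mul ((1/2) * (2*y+10)))).add ((airA_ray0 y 0).const_mul (1 + 1/2*(y+3)*(y+7)))
      simpa using this
    refine squeeze_zero_norm' ?_ hlim
    filter_upwards [eventually_ge_atTop (0:ℝ)] with s hs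
    have hp : 0 < ‖airW 0 (y+s)‖ := norm_pos_iff.2 (airW_ne _ (ray_im_le y him s))
    have hA : ‖airA (y+s)‖ = ‖airW 0 (y+s)‖ * ‖airQ (y+s)‖ := by
      rw [airQ, norm_div]; field_simp
    have hq := airQ_le (y+s) (ray_im_le y him s)
    have hn := airN_le (y+s) (ray_im_le y him s)
    have hz : ‖(y:ℂ)+s‖ = y + s := by
      rw [← Complex.ofReal_add, Complex.norm_real, Real.norm_of_nonneg (by linarith)]
    have hz2 : |((y:ℂ)+s).re| = y + s := by simp; linarith
    rw [hz] at hn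
    rw [hz2] at hq
    have h1 := Complex.abs_re_le_norm (airQ (y+s))
    have h2 := Complex.abs_re_le_norm (airN (y+s))
    have e : (airQ (y+s)).re * (airQ (y+s)).re + (airQ (y+s)).im * (airQ (y+s)).im = ‖airQ (y+s)‖ * ‖airQ (y+s)‖ := by
      rw [← Complex.normSq_apply, Complex.normSq_eq_norm_sq, pow_two]
    rw [e, norm_mul, norm_norm, Real.norm_eq_abs]
    have h3 : |(airQ (y+s)).re - 1/2 * (airN (y+s)).re * (‖airQ (y+s)‖ * ‖airQ (y+s)‖)| ≤ ‖airQ (y+s)‖ * (1 + 1/2 * (y+s+3) * (7 + (y+s))) := by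
      calc _ ≤ |(airQ (y+s)).re| + |1/2 * (airN (y+s)).re * (‖airQ (y+s)‖ * ‖airQ (y+s)‖)| := abs_sub _ _
        _ = |(airQ (y+s)).re| + 1/2 * |(airN (y+s)).re| * (‖airQ (y+s)‖ * ‖airQ (y+s)‖) := by
          rw [abs_mul, abs_mul, abs_of_nonneg (mul_self_nonneg ‖airQ (y+s)‖)]; norm_num
        _ ≤ ‖airQ (y+s)‖ + 1/2 * (y+s+3) * (‖airQ (y+s)‖ * (7 + (y+s))) := by
          gcongr; exact h2.trans hn
        _ = _ := by ring
    calc _ ≤ ‖airW 0 (y+s)‖ * (‖airQ (y+s)‖ * (1 + 1/2 * (y+s+3) * (7 + (y+s)))) := by gcongr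
      _ = _ := by rw [hA]; ring

lemma airQ_re_nonneg (y : ℂ) (hy : y.im ≤ 0) : 0 ≤ (airQ y).re := by
  have hreal : ∀ x : ℝ, 0 ≤ (airQ x).re := by
    intro x
    rcases le_total 0 x with h | h
    · exact airQ_pos_axis x h
    · rw [airQ_re_iff x (by simp)]
      have := airy_neg_axis (-x) (by linarith)
      simpa using this
  have hnorm : ∀ z : ℂ, ‖Complex.exp (- airQ (-Complex.I * z))‖ = Real.exp (-(airQ (-Complex.I * z)).re) := by
    intro z; rw [Complex.norm_exp]; simp
  have him : ∀ z : ℂ, (-Complex.I * z).im = - z.re := by intro z; simp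
  have h := PhragmenLindelof.right_half_plane_of_bounded_on_real (f := fun z => Complex.exp (- airQ (-Complex.I * z)))
    (C := 1) (z := Complex.I * y) ?_ ?_ ?_ ?_ ?_
  · rw [hnorm] at h
    have e : -Complex.I * (Complex.I * y) = y := by linear_combination -y * Complex.I_sq
    rw [e, Real.exp_le_one_iff] at h
    linarith
  · apply DifferentiableOn.diffContOnCl
    rw [Complex.closure_setOfPred_lt_re]
    intro z hz
    apply DifferentiableAt.differentiableWithinAt
    have hz' : (-Complex.I * z).im ≤ 0 := by rw [him]; simpa using hz
    have d1 : DifferentiableAt ℂ airQ (-Complex.I * z) :=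
      ((airA_hasDerivAt _).differentiableAt).div ((airW_hasDerivAt 0 _).differentiableAt) (airW_ne _ hz')
    have d2 : DifferentiableAt ℂ (fun z => -Complex.I * z) z := by fun_prop
    exact ((d1.comp z d2).neg).cexp
  · refine ⟨1, by norm_num, 1, ?_⟩
    rw [Asymptotics.isBigO_iff]
    refine ⟨Real.exp 7, ?_⟩
    rw [eventually_inf_principal]
    refine Eventually.of_forall fun z hz => ?_
    have hz' : (-Complex.I * z).im ≤ 0 := by rw [him]; simp at hz; linarith
    rw [hnorm, Real.norm_of_nonneg (Real.exp_pos _).le, ← Real.exp_add, Real.exp_le_exp, one_mul, Real.rpow_one]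
    have h1 := airQ_le _ hz'
    have h2 := (abs_le.1 (Complex.abs_re_le_norm (airQ (-Complex.I * z)))).1
    have h3 := Complex.abs_re_le_norm (-Complex.I * z)
    have h4 : ‖-Complex.I * z‖ = ‖z‖ := by simp
    linarith
  · refine isBoundedUnder_of_eventually_le (a := Real.exp 7) ?_
    filter_upwards [eventually_ge_atTop (0:ℝ)] with x hx
    have hz' : (-Complex.I * x).im ≤ 0 := by rw [him]; simpa using hx
    rw [hnorm, Real.exp_le_exp]
    have h1 := airQ_le _ hz'
    have h2 := (abs_le.1 (Complex.abs_re_le_norm (airQ (-Complex.I * x)))).1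
    have h3 : (-Complex.I * x).re = 0 := by simp
    rw [h3, abs_zero] at h1
    linarith
  · intro x
    rw [hnorm, Real.exp_le_one_iff]
    have e : -Complex.I * (x * Complex.I) = x := by linear_combination -x * Complex.I_sq
    rw [e]
    linarith [hreal x]
  · simpa using hy

lemma airA_ray_le (y : ℂ) (hy : y.im ≤ 0) (s t : ℝ) (hs : 0 ≤ s) (hst : s ≤ t) : ‖airA (y+t)‖ ≤ ‖airA (y+s)‖ := by
  refine norm_antitone_ray (f := fun s : ℝ => airA (y + s)) (airA_ray_deriv y) (fun t ht => ?_) s t hs hst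
  have := (airQ_re_iff (y+t) (ray_im_le y hy t)).1 (airQ_re_nonneg _ (ray_im_le y hy t))
  simp only [neg_mul, Complex.neg_re]
  linarith

lemma airA_ne (y : ℂ) (hy : y.im ≤ 0) : airA y ≠ 0 := by
  intro h
  have hz : ∀ s : ℝ, 0 ≤ s → airA (y+s) = 0 := by
    intro s hs
    have := airA_ray_le y hy 0 s le_rfl hs
    simp only [Complex.ofReal_zero, add_zero, h, norm_zero] at this
    exact norm_le_zero_iff.1 this
  refine airW_not_ray_zero (y+(1:ℝ)) fun s hs => ?_
  have h1 : HasDerivAt (fun s : ℝ => airA (y + s)) 0 (1+s) := by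
    refine (hasDerivAt_const (1+s) (0:ℂ)).congr_of_eventuallyEq ?_
    filter_upwards [lt_mem_nhds (show 0 < 1+s by linarith)] with t ht
    exact hz t (le_of_lt ht)
  have := (airA_ray_deriv y (1+s)).unique h1
  push_cast at this ⊢
  rw [← add_assoc] at this
  simpa using this

lemma ray_decay4 {f : ℂ → ℂ} (hf : ∀ p R, ∃ C, 0 ≤ C ∧ ∀ y ∈ airS R, ‖y‖^p * ‖f y‖ ≤ C) (y : ℂ) :
    ∃ K, 0 ≤ K ∧ ∀ s : ℝ, 0 ≤ s → (1+s)^4 * ‖f (y+s)‖ ≤ K := by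
  obtain ⟨R, hR⟩ := ray_mem_airS y 1 (by simp) (by simp; positivity)
  obtain ⟨C, hC0, hC⟩ := hf 0 R
  obtain ⟨D, hD0, hD⟩ := hf 4 R
  refine ⟨8 * ((1+‖y‖)^4 * C + D), by positivity, fun s hs => ?_⟩
  have hm := hR s hs
  rw [one_mul] at hm
  have h1 := hC _ hm
  have h2 := hD _ hm
  have h3 : 1 + s ≤ (1+‖y‖) + ‖y+s‖ := by
    have : ‖(s:ℂ)‖ ≤ ‖y+s‖ + ‖y‖ := by
      calc ‖(s:ℂ)‖ = ‖(y+s) - y‖ := by congr 1; ring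
        _ ≤ _ := norm_sub_le _ _
    rw [Complex.norm_real, Real.norm_of_nonneg hs] at this
    linarith
  have h4 : (1+s)^4 ≤ 8 * ((1+‖y‖)^4 + ‖y+s‖^4) := by
    calc (1+s)^4 ≤ ((1+‖y‖) + ‖y+s‖)^4 := by gcongr
      _ ≤ _ := by
        have := add_pow_le (show 0 ≤ 1+‖y‖ by positivity) (norm_nonneg (y+s)) 4
        norm_num at this; linarith
  calc (1+s)^4 * ‖f (y+s)‖ ≤ (8 * ((1+‖y‖)^4 + ‖y+s‖^4)) * ‖f (y+s)‖ := by gcongr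
    _ = 8 * ((1+‖y‖)^4 * (‖y+s‖^0 * ‖f (y+s)‖) + ‖y+s‖^4 * ‖f (y+s)‖) := by ring
    _ ≤ _ := by gcongr

lemma integrable_of_decay4 {f : ℝ → ℂ} (hf : Continuous f) {K : ℝ} (h : ∀ s, 0 ≤ s → (1+s)^4 * ‖f s‖ ≤ K) :
    IntegrableOn f (Ioi 0) := by
  have h1 : IntegrableOn (fun s : ℝ => (1+s)^(-4:ℝ)) (Ioi 0) := by
    have := integrableOn_add_rpow_Ioi_of_lt (a := -4) (c := 0) (m := 1) (by norm_num) (by norm_num)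
    refine this.congr_fun (fun s _ => by simp [add_comm]) measurableSet_Ioi
  refine Integrable.mono' (h1.const_mul K) hf.aestronglyMeasurable ?_
  rw [ae_restrict_iff' measurableSet_Ioi]
  refine Eventually.of_forall fun s hs => ?_
  have hs0 : (0:ℝ) < s := hs
  have : (1+s)^(-4:ℝ) = ((1+s)^4)⁻¹ := by
    rw [Real.rpow_neg (by linarith)]; norm_cast
  rw [this]
  rw [← div_eq_mul_inv, le_div_iff₀ (by positivity)]
  have := h s hs0.le
  linarith

lemma airB_ne (y : ℂ) (hy : y.im ≤ 0) (κ : ℝ) (hκ : 0 ≤ κ) :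
    ∫ s in Ioi (0:ℝ), airW 0 (y+s) * ((Real.exp (-κ*s) : ℝ):ℂ) ≠ 0 := by
  intro h0
  have hex : ∀ s : ℝ, 0 ≤ s → Real.exp (-κ*s) ≤ 1 := by
    intro s hs; rw [Real.exp_le_one_iff]; nlinarith
  have hcw : Continuous (fun s : ℝ => airW 0 (y+s)) := continuous_iff_continuousAt.2 fun t => (airW_ray_deriv 0 y t).continuousAt
  have hca : Continuous (fun s : ℝ => airA (y+s)) := continuous_iff_continuousAt.2 fun t => (airA_ray_deriv y t).continuousAt
  obtain ⟨K, hK0, hK⟩ := ray_decay4 (fun p R => airW_decay p R 0) y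
  obtain ⟨M, hM0, hM⟩ := ray_decay4 airA_decay y
  have hcomb : ∀ {f : ℝ → ℂ} {K : ℝ}, Continuous f → (∀ s, 0 ≤ s → (1+s)^4 * ‖f s‖ ≤ K) → 
      IntegrableOn (fun s => f s * ((Real.exp (-κ*s) : ℝ):ℂ)) (Ioi 0) := by
    intro f K hf hK
    refine integrable_of_decay4 (K := K) (by fun_prop) (fun s hs => le_trans ?_ (hK s hs))
    rw [norm_mul, Complex.norm_real, Real.norm_of_nonneg (Real.exp_pos _).le]
    gcongr
    exact mul_le_of_le_one_right (norm_nonneg _) (hex s hs)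
  have iw := hcomb hcw hK
  have ia := hcomb hca hM
  have hd : ∀ s : ℝ, HasDerivAt (fun s : ℝ => airA (y+s) * ((Real.exp (-κ*s) : ℝ):ℂ))
      (-(airW 0 (y+s) * ((Real.exp (-κ*s) : ℝ):ℂ)) - κ * (airA (y+s) * ((Real.exp (-κ*s) : ℝ):ℂ))) s := by
    intro s
    have he : HasDerivAt (fun s : ℝ => ((Real.exp (-κ*s) : ℝ):ℂ)) ((-κ * Real.exp (-κ*s) : ℝ):ℂ) s := by
      have : HasDerivAt (fun s : ℝ => Real.exp (-κ*s)) (-κ * Real.exp (-κ*s)) s :=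
        (((hasDerivAt_id s).const_mul (-κ)).exp).congr_deriv (by simp; ring)
      exact this.ofReal_comp
    refine ((airA_ray_deriv y s).mul he).congr_deriv ?_
    push_cast; ring
  have hlim : Tendsto (fun s : ℝ => airA (y+s) * ((Real.exp (-κ*s) : ℝ):ℂ)) atTop (𝓝 0) := by
    refine squeeze_zero_norm' ?_ (by simpa using airA_ray0 y 0)
    filter_upwards [eventually_ge_atTop (0:ℝ)] with s hs
    rw [norm_mul, Complex.norm_real, Real.norm_of_nonneg (Real.exp_pos _).le]
    exact mul_le_of_le_one_right (norm_nonneg _) (hex s hs)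
  have hI := integral_Ioi_of_hasDerivAt_of_tendsto (hd 0).continuousAt.continuousWithinAt (fun s _ => hd s)
    ((iw.neg).sub (ia.const_mul (κ:ℂ))) hlim
  have iw' : IntegrableOn (fun s : ℝ => -(airW 0 (y+s) * ((Real.exp (-κ*s) : ℝ):ℂ))) (Ioi 0) := iw.neg
  rw [integral_sub iw' (ia.const_mul (κ:ℂ)), integral_neg, h0, integral_const_mul] at hI
  simp only [neg_zero, zero_sub, Complex.ofReal_zero, add_zero, mul_zero, Real.exp_zero, Complex.ofReal_one, mul_one, neg_inj] at hI
  have hA0 := airA_ne y hy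
  have hApos : 0 < ‖airA y‖ := norm_pos_iff.2 hA0
  rcases hκ.eq_or_lt with hz | hκp
  · rw [← hz] at hI; simp at hI; exact hA0 hI.symm
  -- choose T
  obtain ⟨T, hT0, hT⟩ : ∃ T : ℝ, 0 ≤ T ∧ ‖airA (y+T)‖ ≤ ‖airA y‖/2 := by
    have h1 : ∀ᶠ s : ℝ in atTop, ‖airA (y+s)‖ < ‖airA y‖/2 := by
      have := airA_ray0 y 0
      simp only [pow_zero, one_mul] at this
      exact this.eventually (gt_mem_nhds (by linarith))
    obtain ⟨T, h2, h3⟩ := (h1.and (eventually_ge_atTop 0)).exists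
    exact ⟨T, h3, h2.le⟩
  -- comparison function
  have hie : IntegrableOn (fun s : ℝ => Real.exp (-κ*s)) (Ioi 0) := integrableOn_exp_mul_Ioi (by linarith) 0
  have hle : ‖∫ s in Ioi (0:ℝ), airA (y+s) * ((Real.exp (-κ*s) : ℝ):ℂ)‖ ≤ ∫ s in Ioi (0:ℝ), ((‖airA y‖ * Real.exp (-κ*s)) - (Ioi T).indicator (fun s => ‖airA y‖/2 * Real.exp (-κ*s)) s) := by
    refine norm_integral_le_of_norm_le ?_ ?_
    · exact (hie.const_mul _).sub ((hie.const_mul _).indicator measurableSet_Ioi)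
    · rw [ae_restrict_iff' measurableSet_Ioi]
      refine Eventually.of_forall fun s hs => ?_
      have hs0 : (0:ℝ) < s := hs
      have hep := Real.exp_pos (-κ*s)
      rw [norm_mul, Complex.norm_real, Real.norm_of_nonneg hep.le]
      by_cases hsT : s ∈ Ioi T
      · rw [indicator_of_mem hsT]
        have := airA_ray_le y hy T s hT0 (le_of_lt hsT)
        nlinarith
      · rw [indicator_of_notMem hsT]
        have := airA_ray_le y hy 0 s le_rfl hs0.le
        simp only [Complex.ofReal_zero, add_zero] at this
        nlinarith
  rw [integral_sub (hie.const_mul _) ((hie.const_mul _).indicator measurableSet_Ioi), integral_const_mul,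
    setIntegral_indicator measurableSet_Ioi, inter_eq_right.2 (Ioi_subset_Ioi hT0), integral_const_mul, integral_exp_mul_Ioi (by linarith), integral_exp_mul_Ioi (by linarith)] at hle
  have hfin : ‖airA y‖ ≤ κ * (‖airA y‖ * (-Real.exp (-κ * 0) / -κ) - ‖airA y‖ / 2 * (-Real.exp (-κ * T) / -κ)) := by
    calc ‖airA y‖ = ‖(κ:ℂ) * ∫ s in Ioi (0:ℝ), airA (y+s) * ((Real.exp (-κ*s) : ℝ):ℂ)‖ := by rw [hI]
      _ = κ * ‖∫ s in Ioi (0:ℝ), airA (y+s) * ((Real.exp (-κ*s) : ℝ):ℂ)‖ := by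
        rw [norm_mul, Complex.norm_real, Real.norm_of_nonneg hκ]
      _ ≤ _ := by gcongr
  have e : κ * (‖airA y‖ * (-Real.exp (-κ * 0) / -κ) - ‖airA y‖ / 2 * (-Real.exp (-κ * T) / -κ)) = ‖airA y‖ - ‖airA y‖/2 * Real.exp (-κ*T) := by
    rw [mul_zero, Real.exp_zero]; field_simp
  rw [e] at hfin
  have := mul_pos (half_pos hApos) (Real.exp_pos (-κ*T))
  linarith

/-- the key fact about the Airy profile -/
theorem airy_star (d κ : ℝ) (hκ : 0 ≤ κ) : ∃ (W W1 : ℝ → ℂ) (K : ℝ), 0 ≤ K ∧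
    (∀ s, HasDerivAt W (W1 s) s) ∧
    (∀ s : ℝ, HasDerivAt W1 ((Complex.I * (s + d) + (κ:ℂ)^2) * W s) s) ∧ W 0 = 1 ∧
    (∀ s, 0 ≤ s → (1+s)^4 * ‖W s‖ ≤ K ∧ (1+s)^4 * ‖W1 s‖ ≤ K) ∧
    ∫ s in Ioi (0:ℝ), W s * ((Real.exp (-κ*s) : ℝ):ℂ) ≠ 0 := by
  obtain ⟨y, hy⟩ : ∃ y : ℂ, y = d - Complex.I * κ^2 := ⟨_, rfl⟩
  have hyi : y.im ≤ 0 := by rw [hy]; simp; norm_cast; positivity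
  have hne := airW_ne y hyi
  obtain ⟨K, hK0, hK⟩ := ray_decay4 (fun p R => airW_decay p R 0) y
  obtain ⟨M, hM0, hM⟩ := ray_decay4 (fun p R => airW_decay p R 1) y
  have hp : 0 < ‖airW 0 y‖ := norm_pos_iff.2 hne
  refine ⟨fun s => airW 0 (y+s) / airW 0 y, fun s => airW 1 (y+s) / airW 0 y, (K+M)/‖airW 0 y‖, by positivity,
    fun s => (airW_ray_deriv 0 y s).div_const _, fun s => ?_, ?_, fun s hs => ⟨?_, ?_⟩, ?_⟩
  · refine ((airW_ray_deriv 1 y s).div_const _).congr_deriv ?_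
    simp only [Nat.reduceAdd]
    rw [airW_two]
    have : Complex.I * (y + s) = Complex.I * (s + d) + (κ:ℂ)^2 := by
      rw [hy]; linear_combination -(κ:ℂ)^2 * Complex.I_sq
    rw [this]; ring
  · simp [hne]
  · rw [norm_div, ← mul_div_assoc]
    gcongr
    linarith [hK s hs]
  · rw [norm_div, ← mul_div_assoc]
    gcongr
    linarith [hM s hs]
  · have := airB_ne y hyi κ hκ
    have e : ∀ s : ℝ, airW 0 (y+s) / airW 0 y * ((Real.exp (-κ*s) : ℝ):ℂ) = (airW 0 y)⁻¹ * (airW 0 (y+s) * ((Real.exp (-κ*s) : ℝ):ℂ)) := by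
      intro s; field_simp
    simp only [e]
    rw [integral_const_mul]
    exact mul_ne_zero (inv_ne_zero hne) this

/-- `L²` norm on `[a,b]` -/
noncomputable def N2 (a b : ℝ) (f : ℝ → ℂ) : ℝ := Real.sqrt (∫ x in a..b, ‖f x‖^2)

lemma N2_nonneg (a b : ℝ) (f : ℝ → ℂ) : 0 ≤ N2 a b f := Real.sqrt_nonneg _

lemma N2_sq {a b : ℝ} (hab : a ≤ b) (f : ℝ → ℂ) : N2 a b f ^ 2 = ∫ x in a..b, ‖f x‖^2 :=
  Real.sq_sqrt (intervalIntegral.integral_nonneg hab fun x _ => by positivity)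

lemma cs_real {a b : ℝ} (hab : a ≤ b) {f g : ℝ → ℝ} (hf : Continuous f) (hg : Continuous g) :
    ∫ x in a..b, f x * g x ≤ Real.sqrt (∫ x in a..b, f x ^ 2) * Real.sqrt (∫ x in a..b, g x ^ 2) := by
  have hA : 0 ≤ ∫ x in a..b, f x ^ 2 := intervalIntegral.integral_nonneg hab fun x _ => by positivity
  have hC : 0 ≤ ∫ x in a..b, g x ^ 2 := intervalIntegral.integral_nonneg hab fun x _ => by positivity
  have key : ∀ t : ℝ, 0 ≤ (∫ x in a..b, g x ^ 2) * (t * t) + (2 * ∫ x in a..b, f x * g x) * t + ∫ x in a..b, f x ^ 2 := by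
    intro t
    have h0 : 0 ≤ ∫ x in a..b, (f x + t * g x)^2 := intervalIntegral.integral_nonneg hab fun x _ => by positivity
    have e : (fun x => (f x + t * g x)^2) = fun x => f x ^ 2 + (2 * t) * (f x * g x) + (t*t) * g x ^ 2 := by
      funext x; ring
    rw [e, intervalIntegral.integral_add, intervalIntegral.integral_add, intervalIntegral.integral_const_mul, intervalIntegral.integral_const_mul] at h0
    · linarith
    all_goals apply Continuous.intervalIntegrable; fun_prop
  have := discrim_le_zero key
  rw [discrim] at this
  have h2 : (∫ x in a..b, f x * g x)^2 ≤ (Real.sqrt (∫ x in a..b, f x ^ 2) * Real.sqrt (∫ x in a..b, g x ^ 2))^2 := by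
    rw [mul_pow, Real.sq_sqrt hA, Real.sq_sqrt hC]; linarith
  exact (abs_le_of_sq_le_sq' h2 (by positivity)).2

lemma cs_norm {a b : ℝ} (hab : a ≤ b) {f g : ℝ → ℂ} (hf : Continuous f) (hg : Continuous g) :
    ∫ x in a..b, ‖f x‖ * ‖g x‖ ≤ N2 a b f * N2 a b g :=
  cs_real hab hf.norm hg.norm

lemma cs_inner {a b : ℝ} (hab : a ≤ b) {f g : ℝ → ℂ} (hf : Continuous f) (hg : Continuous g) :
    ‖∫ x in a..b, f x * (starRingEnd ℂ) (g x)‖ ≤ N2 a b f * N2 a b g := by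
  refine (intervalIntegral.norm_integral_le_integral_norm hab).trans ?_
  simp only [norm_mul, RCLike.norm_conj]
  exact cs_norm hab hf hg

lemma N2_mono {a b : ℝ} (hab : a ≤ b) {f g : ℝ → ℂ} (hf : Continuous f) (hg : Continuous g)
    (h : ∀ x ∈ Icc a b, ‖f x‖ ≤ ‖g x‖) : N2 a b f ≤ N2 a b g := by
  apply Real.sqrt_le_sqrt
  apply intervalIntegral.integral_mono_on hab
  · exact (hf.norm.pow 2).intervalIntegrable _ _
  · exact (hg.norm.pow 2).intervalIntegrable _ _
  · intro x hx
    have := h x hx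
    gcongr

lemma N2_add {a b : ℝ} (hab : a ≤ b) {f g : ℝ → ℂ} (hf : Continuous f) (hg : Continuous g) :
    N2 a b (fun x => f x + g x) ≤ N2 a b f + N2 a b g := by
  apply Real.sqrt_le_iff.2 
  refine ⟨add_nonneg (N2_nonneg _ _ _) (N2_nonneg _ _ _), ?_⟩
  have h1 : ∫ x in a..b, ‖f x + g x‖^2 ≤ ∫ x in a..b, (‖f x‖^2 + 2 * (‖f x‖ * ‖g x‖) + ‖g x‖^2) := by
    apply intervalIntegral.integral_mono_on hab
    · exact Continuous.intervalIntegrable (by fun_prop) _ _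
    · exact Continuous.intervalIntegrable (by fun_prop) _ _
    · intro x _
      calc ‖f x + g x‖^2 ≤ (‖f x‖ + ‖g x‖)^2 := by gcongr; exact norm_add_le _ _
        _ = _ := by ring
  rw [intervalIntegral.integral_add, intervalIntegral.integral_add, intervalIntegral.integral_const_mul] at h1
  · have := cs_norm hab hf hg
    rw [← N2_sq hab f, ← N2_sq hab g] at h1
    show ∫ x in a..b, ‖f x + g x‖^2 ≤ _
    nlinarith
  all_goals apply Continuous.intervalIntegrable; fun_prop

lemma N2_smul (a b : ℝ) (c : ℂ) (f : ℝ → ℂ) : N2 a b (fun x => c * f x) = ‖c‖ * N2 a b f := by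
  unfold N2
  simp only [norm_mul, mul_pow]
  rw [intervalIntegral.integral_const_mul, Real.sqrt_mul (by positivity), Real.sqrt_sq (norm_nonneg _)]

/-- `N2` comparison with a constant -/
lemma N2_le_mul {a b : ℝ} (hab : a ≤ b) {f g : ℝ → ℂ} (hf : Continuous f) (hg : Continuous g) (c : ℝ) (hc : 0 ≤ c)
    (h : ∀ x ∈ Icc a b, ‖f x‖ ≤ c * ‖g x‖) : N2 a b f ≤ c * N2 a b g := by
  have := N2_mono hab hf (show Continuous (fun x => (c:ℂ) * g x) by fun_prop) (fun x hx => by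
    rw [norm_mul, Complex.norm_real, Real.norm_of_nonneg hc]; exact h x hx)
  rwa [N2_smul, Complex.norm_real, Real.norm_of_nonneg hc] at this

lemma N2_le_of_bound {a b : ℝ} (hab : a ≤ b) {f : ℝ → ℂ} (hf : Continuous f) {g : ℝ → ℝ} (hg : Continuous g) {c : ℝ} (hc : 0 ≤ c)
    (h : ∀ x ∈ Icc a b, ‖f x‖^2 ≤ g x) (hgc : ∫ x in a..b, g x ≤ c^2) : N2 a b f ≤ c := by
  apply Real.sqrt_le_iff.2 ⟨hc, _⟩
  refine le_trans ?_ hgc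
  exact intervalIntegral.integral_mono_on hab ((hf.norm.pow 2).intervalIntegrable _ _) (hg.intervalIntegrable _ _) h

/-- `H^{-1}`-domination on `[a,b]` -/
def Dom (a b : ℝ) (G : ℝ → ℂ) (m : ℝ) : Prop :=
  ∀ p p1 : ℝ → ℂ, (∀ x, HasDerivAt p (p1 x) x) → Continuous p1 → p a = 0 → p b = 0 →
    ‖∫ x in a..b, G x * (starRingEnd ℂ) (p x)‖ ≤ m * (N2 a b p + N2 a b p1)

lemma Dom_add {a b : ℝ} {G H : ℝ → ℂ} {m n : ℝ} (hG : Dom a b G m) (hH : Dom a b H n)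
    (cG : Continuous G) (cH : Continuous H) : Dom a b (fun x => G x + H x) (m + n) := by
  intro p p1 hp cp1 ha hb
  have cp : Continuous p := continuous_iff_continuousAt.2 fun x => (hp x).continuousAt
  simp only [add_mul]
  rw [intervalIntegral.integral_add]
  · exact (norm_add_le _ _).trans (add_le_add (hG p p1 hp cp1 ha hb) (hH p p1 hp cp1 ha hb))
  · exact Continuous.intervalIntegrable (by fun_prop) _ _
  · exact Continuous.intervalIntegrable (by fun_prop) _ _

lemma Dom_L2 {a b : ℝ} (hab : a ≤ b) {G : ℝ → ℂ} (cG : Continuous G) : Dom a b G (N2 a b G) := by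
  intro p p1 hp cp1 ha hb
  have cp : Continuous p := continuous_iff_continuousAt.2 fun x => (hp x).continuousAt
  refine (cs_inner hab cG cp).trans ?_
  have := N2_nonneg a b G
  have := N2_nonneg a b p1
  gcongr; linarith

lemma Dom_mono {a b : ℝ} {G : ℝ → ℂ} {m n : ℝ} (hG : Dom a b G m) (h : m ≤ n) : Dom a b G n := by
  intro p p1 hp cp1 ha hb
  refine (hG p p1 hp cp1 ha hb).trans ?_
  have := N2_nonneg a b p
  have := N2_nonneg a b p1
  gcongr

lemma hasDerivAt_cross' {f g : ℝ → ℂ} {f' g' : ℂ} {t : ℝ} (hf : HasDerivAt f f' t) (hg : HasDerivAt g g' t) :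
    HasDerivAt (fun t => f t * (starRingEnd ℂ) (g t)) (f' * (starRingEnd ℂ) (g t) + f t * (starRingEnd ℂ) g') t := by
  have : HasDerivAt (fun t => (starRingEnd ℂ) (g t)) ((starRingEnd ℂ) g') t :=
    (Complex.conjCLE.toContinuousLinearMap.hasFDerivAt.comp_hasDerivAt t hg)
  exact hf.mul this

lemma ibp_cross {a b : ℝ} {f f1 p p1 : ℝ → ℂ} (hf : ∀ x, HasDerivAt f (f1 x) x) (hp : ∀ x, HasDerivAt p (p1 x) x)
    (cf1 : Continuous f1) (cp1 : Continuous p1) :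
    (∫ x in a..b, f1 x * (starRingEnd ℂ) (p x)) = f b * (starRingEnd ℂ) (p b) - f a * (starRingEnd ℂ) (p a) - ∫ x in a..b, f x * (starRingEnd ℂ) (p1 x) := by
  have cp : Continuous p := continuous_iff_continuousAt.2 fun x => (hp x).continuousAt
  have cf : Continuous f := continuous_iff_continuousAt.2 fun x => (hf x).continuousAt
  have := intervalIntegral.integral_eq_sub_of_hasDerivAt (a := a) (b := b) (fun x _ => hasDerivAt_cross' (hf x) (hp x))
    (Continuous.intervalIntegrable (by fun_prop) _ _)
  rw [intervalIntegral.integral_add] at this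
  · linear_combination this
  · exact Continuous.intervalIntegrable (by fun_prop) _ _
  · exact Continuous.intervalIntegrable (by fun_prop) _ _

noncomputable def th (Λ x : ℝ) : ℝ := (x-Λ)/(1+(x-Λ)^2)
noncomputable def th1 (Λ x : ℝ) : ℝ := (1-(x-Λ)^2)/(1+(x-Λ)^2)^2
noncomputable def om (Λ x : ℝ) : ℝ := (Real.sqrt (1+(x-Λ)^2))⁻¹

lemma th_deriv (Λ x : ℝ) : HasDerivAt (th Λ) (th1 Λ x) x := by
  have h0 : HasDerivAt (fun x : ℝ => x - Λ) 1 x := (hasDerivAt_id x).sub_const Λ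
  have h1 : HasDerivAt (fun x : ℝ => 1+(x-Λ)^2) (2*(x-Λ)) x := by
    have := (h0.pow 2).const_add 1
    simpa using this
  have := h0.div h1 (by positivity)
  have e : th1 Λ x = (1 * (1+(x-Λ)^2) - (x-Λ)*(2*(x-Λ)))/(1+(x-Λ)^2)^2 := by
    unfold th1; congr 1; ring
  rw [e]; exact this

lemma th_cont (Λ : ℝ) : Continuous (th Λ) := by
  unfold th
  exact Continuous.div (by fun_prop) (by fun_prop) (fun x => by positivity)
lemma th1_cont (Λ : ℝ) : Continuous (th1 Λ) := by
  unfold th1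
  exact Continuous.div (by fun_prop) (by fun_prop) (fun x => by positivity)
lemma om_cont (Λ : ℝ) : Continuous (om Λ) := by
  unfold om
  exact Continuous.inv₀ (by fun_prop) (fun x => by positivity)
lemma om_nonneg (Λ x : ℝ) : 0 ≤ om Λ x := by unfold om; positivity
lemma om_sq (Λ x : ℝ) : om Λ x ^ 2 = (1+(x-Λ)^2)⁻¹ := by
  unfold om; rw [inv_pow, Real.sq_sqrt (by positivity)]
lemma om_le_one (Λ x : ℝ) : om Λ x ≤ 1 := by
  have : om Λ x ^ 2 ≤ 1 := by
    rw [om_sq]; exact inv_le_one_of_one_le₀ (by nlinarith [sq_nonneg (x-Λ)])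
  nlinarith [om_nonneg Λ x]
lemma th_abs (Λ x : ℝ) : |th Λ x| ≤ om Λ x := by
  apply abs_le_of_sq_le_sq _ (om_nonneg _ _)
  rw [om_sq]; unfold th
  rw [div_pow, div_le_iff₀ (by positivity)]
  have : (1 + (x-Λ)^2)⁻¹ * (1+(x-Λ)^2)^2 = 1 + (x-Λ)^2 := by field_simp
  rw [this]; linarith
lemma th1_abs (Λ x : ℝ) : |th1 Λ x| ≤ om Λ x ^ 2 := by
  rw [om_sq]; unfold th1
  rw [abs_div, abs_of_pos (show 0 < (1+(x-Λ)^2)^2 by positivity), div_le_iff₀ (by positivity)]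
  have : (1 + (x-Λ)^2)⁻¹ * (1+(x-Λ)^2)^2 = 1 + (x-Λ)^2 := by field_simp
  rw [this, abs_le]; constructor <;> nlinarith [sq_nonneg (x-Λ)]
lemma th_id (Λ x : ℝ) : (x-Λ) * th Λ x = 1 - om Λ x ^2 := by
  rw [om_sq]; unfold th; field_simp; ring
lemma th_sq_le (Λ x : ℝ) : th Λ x ^2 ≤ (x-Λ) * th Λ x := by
  unfold th
  rw [div_pow, mul_div_assoc', div_le_div_iff₀ (by positivity) (by positivity)]
  nlinarith [sq_nonneg (x-Λ), mul_nonneg (sq_nonneg (x-Λ)) (sq_nonneg (x-Λ)), mul_nonneg (mul_nonneg (sq_nonneg (x-Λ)) (sq_nonneg (x-Λ))) (sq_nonneg (x-Λ))]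
lemma th_sum (Λ x : ℝ) : 1/2 ≤ th1 Λ x + (x-Λ) * th Λ x := by
  unfold th th1
  rw [mul_div_assoc', div_add_div _ _ (by positivity) (by positivity), div_le_div_iff₀ (by norm_num) (by positivity)]
  generalize x - Λ = X
  nlinarith [mul_nonneg (show (0:ℝ) ≤ 1 + X^2 by positivity) (sq_nonneg (X^2-1))]
lemma om_int (Λ a b : ℝ) : ∫ x in a..b, om Λ x ^ 2 ≤ Real.pi := by
  have : ∀ x ∈ uIcc a b, HasDerivAt (fun x => Real.arctan (x - Λ)) (om Λ x ^ 2) x := by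
    intro x _
    have h0 : HasDerivAt (fun x : ℝ => x - Λ) 1 x := (hasDerivAt_id x).sub_const Λ
    have := h0.arctan
    convert this using 1
    rw [om_sq]; simp
  rw [intervalIntegral.integral_eq_sub_of_hasDerivAt this (Continuous.intervalIntegrable (by have := om_cont Λ; fun_prop) _ _)]
  have := Real.arctan_lt_pi_div_two (b-Λ)
  have := Real.neg_pi_div_two_lt_arctan (a-Λ)
  linarith

structure Res (a b Λ c ε : ℝ) (v v1 v2 G : ℝ → ℂ) : Prop where
  hab : a ≤ b
  hc : 0 ≤ c
  hc1 : c ≤ 1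
  he : 0 ≤ ε
  he1 : ε ≤ 1/96
  d1 : ∀ x, HasDerivAt v (v1 x) x
  d2 : ∀ x, HasDerivAt v1 (v2 x) x
  c2 : Continuous v2
  va : v a = 0
  vb : v b = 0
  hG : ∀ x : ℝ, G x = -v2 x + (c:ℂ) * v x + Complex.I * ((x - Λ : ℝ) : ℂ) * v x - (ε:ℂ) * v x

namespace Res
variable {a b Λ c ε : ℝ} {v v1 v2 G : ℝ → ℂ}

lemma cv (h : Res a b Λ c ε v v1 v2 G) : Continuous v :=
  continuous_iff_continuousAt.2 fun x => (h.d1 x).continuousAt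
lemma c1 (h : Res a b Λ c ε v v1 v2 G) : Continuous v1 :=
  continuous_iff_continuousAt.2 fun x => (h.d2 x).continuousAt

lemma weak (h : Res a b Λ c ε v v1 v2 G) {p p1 : ℝ → ℂ} (hp : ∀ x, HasDerivAt p (p1 x) x)
    (cp1 : Continuous p1) (pa : p a = 0) (pb : p b = 0) :
    ∫ x in a..b, G x * (starRingEnd ℂ) (p x) = (∫ x in a..b, v1 x * (starRingEnd ℂ) (p1 x))
      + ((c - ε : ℝ):ℂ) * (∫ x in a..b, v x * (starRingEnd ℂ) (p x))
      + Complex.I * ∫ x in a..b, ((x-Λ:ℝ):ℂ) * (v x * (starRingEnd ℂ) (p x)) := by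
  have cp : Continuous p := continuous_iff_continuousAt.2 fun x => (hp x).continuousAt
  have cv := h.cv
  have c1 := h.c1
  have c2 := h.c2
  have e := ibp_cross (a := a) (b := b) h.d2 hp h.c2 cp1
  rw [pa, pb] at e
  simp only [map_zero, mul_zero, sub_zero, zero_sub] at e
  have e1 : (∫ x in a..b, v1 x * (starRingEnd ℂ) (p1 x)) = - ∫ x in a..b, v2 x * (starRingEnd ℂ) (p x) := by
    rw [e]; simp
  rw [e1, ← intervalIntegral.integral_const_mul, ← intervalIntegral.integral_const_mul, ← intervalIntegral.integral_neg,
    ← intervalIntegral.integral_add, ← intervalIntegral.integral_add]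
  · congr 1; funext x; rw [h.hG]; push_cast; ring
  all_goals apply Continuous.intervalIntegrable; fun_prop

end Res

lemma int_self {a b : ℝ} (r : ℝ → ℝ) (v : ℝ → ℂ) :
    ∫ x in a..b, (r x : ℂ) * (v x * (starRingEnd ℂ) (v x)) = ((∫ x in a..b, r x * ‖v x‖^2 : ℝ) : ℂ) := by
  rw [← intervalIntegral.integral_ofReal]
  congr 1; funext x
  rw [Complex.mul_conj, Complex.normSq_eq_norm_sq]; push_cast; ring

lemma N2_mulr_le {a b : ℝ} (hab : a ≤ b) {f : ℝ → ℂ} {r : ℝ → ℝ} (hf : Continuous f) (hr : Continuous r) {c : ℝ} (hc : 0 ≤ c)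
    (h : ∀ x, |r x| ≤ c) : N2 a b (fun x => (r x : ℂ) * f x) ≤ c * N2 a b f := by
  apply N2_le_mul hab (by fun_prop) hf c hc
  intro x _
  rw [norm_mul, Complex.norm_real, Real.norm_eq_abs]
  gcongr; exact h x

lemma N2_mulr_mono {a b : ℝ} (hab : a ≤ b) {f : ℝ → ℂ} {r s : ℝ → ℝ} (hf : Continuous f) (hr : Continuous r) (hs : Continuous s)
    (h : ∀ x, |r x| ≤ s x) : N2 a b (fun x => (r x : ℂ) * f x) ≤ N2 a b (fun x => (s x : ℂ) * f x) := by
  apply N2_mono hab (by fun_prop) (by fun_prop)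
  intro x _
  rw [norm_mul, norm_mul, Complex.norm_real, Complex.norm_real, Real.norm_eq_abs, Real.norm_eq_abs]
  exact mul_le_mul_of_nonneg_right ((h x).trans (le_abs_self _)) (norm_nonneg _)

lemma step1_alg {P Q m S ε T : ℝ} (hP : 0 ≤ P) (hQ : 0 ≤ Q) (hm : 0 ≤ m) (he1 : ε ≤ 1/96)
    (h1 : P^2 - ε * Q^2 ≤ m*(P+Q)) (h2 : S ≤ P*Q+m*(P+2*Q)) (h3 : Q^2/2 ≤ 2*P*T+S) (hT : T^2 ≤ S) :
    Q ≤ 130*m ∧ P ≤ 26 * m := by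
  have a1 : Q^2/2 ≤ P^2 + 2*S := by nlinarith [sq_nonneg (P-T)]
  have a2 : Q^2/2 ≤ 12*P^2+2*m^2+8*m*Q := by nlinarith [sq_nonneg (4*P-Q), sq_nonneg (P-m)]
  have a0 : ε * Q^2 ≤ Q^2/96 := by nlinarith [sq_nonneg Q]
  have a3 : P^2 ≤ m^2+2*m*Q+Q^2/48 := by nlinarith [sq_nonneg (P-m)]
  have a4 : Q^2 ≤ 16496 * m^2 := by nlinarith [sq_nonneg (Q-128*m)]
  have a5 : Q ≤ 130*m := by
    apply le_of_sq_le_sq _ (by positivity)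
    nlinarith [sq_nonneg m]
  refine ⟨a5, ?_⟩
  apply le_of_sq_le_sq _ (by positivity)
  nlinarith [sq_nonneg m, mul_le_mul_of_nonneg_left a5 hm]

namespace Res
variable {a b Λ c ε : ℝ} {v v1 v2 G : ℝ → ℂ}

lemma step1 (h : Res a b Λ c ε v v1 v2 G) {m : ℝ} (hm : 0 ≤ m) (hD : Dom a b G m) :
    N2 a b v ≤ 130 * m ∧ N2 a b v1 ≤ 26 * m := by
  have cv := h.cv
  have c1 := h.c1
  have hab := h.hab
  have cth := th_cont Λ
  have cth1 := th1_cont Λ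
  have b1 : ∀ x, |th Λ x| ≤ 1 := fun x => (th_abs Λ x).trans (om_le_one Λ x)
  have b2 : ∀ x, |th1 Λ x| ≤ 1 := fun x => (th1_abs Λ x).trans (by have := om_le_one Λ x; have := om_nonneg Λ x; nlinarith)
  set P := N2 a b v1 with hP
  set Q := N2 a b v with hQ
  have hP0 : 0 ≤ P := N2_nonneg _ _ _
  have hQ0 : 0 ≤ Q := N2_nonneg _ _ _
  have sv : ∫ x in a..b, v x * (starRingEnd ℂ) (v x) = ((Q^2:ℝ):ℂ) := by
    rw [hQ, N2_sq hab]; simpa using int_self (a:=a) (b:=b) (fun _ => 1) v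
  have sv1 : ∫ x in a..b, v1 x * (starRingEnd ℂ) (v1 x) = ((P^2:ℝ):ℂ) := by
    rw [hP, N2_sq hab]; simpa using int_self (a:=a) (b:=b) (fun _ => 1) v1
  -- (1)
  have h1 : P^2 - ε * Q^2 ≤ m*(P+Q) := by
    have e := h.weak h.d1 c1 h.va h.vb
    rw [sv, sv1, int_self (fun x => x - Λ) v] at e
    have hd := hD v v1 h.d1 c1 h.va h.vb
    rw [e] at hd
    have := (Complex.re_le_norm _).trans hd
    simp at this
    norm_cast at this
    nlinarith [h.hc, mul_nonneg h.hc (sq_nonneg Q)]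
  -- test function θ v
  set p : ℝ → ℂ := fun x => (th Λ x : ℂ) * v x with hp
  set p1 : ℝ → ℂ := fun x => (th1 Λ x : ℂ) * v x + (th Λ x : ℂ) * v1 x with hp1
  have dp : ∀ x, HasDerivAt p (p1 x) x := fun x => ((th_deriv Λ x).ofReal_comp).mul (h.d1 x)
  have cp1 : Continuous p1 := by fun_prop
  have cp : Continuous p := by fun_prop
  have pa : p a = 0 := by simp [hp, h.va]
  have pb : p b = 0 := by simp [hp, h.vb]
  have n1 : N2 a b p ≤ Q := by simpa using N2_mulr_le hab cv cth zero_le_one b1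
  have n2 : N2 a b p1 ≤ Q + P := by
    refine (N2_add hab (by fun_prop) (by fun_prop)).trans ?_
    have := N2_mulr_le hab cv cth1 zero_le_one b2
    have := N2_mulr_le hab c1 cth zero_le_one b1
    linarith
  set S := ∫ x in a..b, ((x-Λ) * th Λ x) * ‖v x‖^2 with hS
  have h2 : S ≤ P*Q+m*(P+2*Q) := by
    have e := h.weak dp cp1 pa pb
    have e1 : ∫ x in a..b, v x * (starRingEnd ℂ) (p x) = ((∫ x in a..b, th Λ x * ‖v x‖^2 : ℝ):ℂ) := by
      rw [← int_self]; congr 1; funext x; simp [hp]; ring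
    have e2 : ∫ x in a..b, ((x-Λ:ℝ):ℂ) * (v x * (starRingEnd ℂ) (p x)) = (S:ℂ) := by
      rw [hS, ← int_self]; congr 1; funext x; simp [hp]; ring
    have e3 : ∫ x in a..b, v1 x * (starRingEnd ℂ) (p1 x) = ((∫ x in a..b, th Λ x * ‖v1 x‖^2 : ℝ):ℂ) + ∫ x in a..b, v1 x * (starRingEnd ℂ) ((th1 Λ x : ℂ) * v x) := by
      rw [← int_self, ← intervalIntegral.integral_add]
      · congr 1; funext x; simp [hp1]; ring
      all_goals apply Continuous.intervalIntegrable; fun_prop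
    rw [e1, e2, e3] at e
    have hd := (hD p p1 dp cp1 pa pb)
    have hi := congrArg Complex.im e
    simp only [Complex.add_im, Complex.im_ofReal_mul, Complex.ofReal_im, Complex.I_mul_im, Complex.ofReal_re, mul_zero, zero_add, add_zero] at hi
    have q1 := (abs_le.1 ((Complex.abs_im_le_norm _).trans hd)).2
    have cs := cs_inner hab c1 (show Continuous (fun x => (th1 Λ x : ℂ) * v x) by fun_prop)
    have q2 := (abs_le.1 ((Complex.abs_im_le_norm _).trans cs)).1
    have q3 := N2_mulr_le hab cv cth1 zero_le_one b2
    have : m * (N2 a b p + N2 a b p1) ≤ m*(P+2*Q) := mul_le_mul_of_nonneg_left (by linarith) hm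
    have : P * N2 a b (fun x => (th1 Λ x : ℂ) * v x) ≤ P * Q := by gcongr; linarith
    linarith
  have hT : (N2 a b p)^2 ≤ S := by
    rw [N2_sq hab]
    apply intervalIntegral.integral_mono_on hab
    · exact Continuous.intervalIntegrable (by fun_prop) _ _
    · exact Continuous.intervalIntegrable (by fun_prop) _ _
    intro x _
    simp only [hp, norm_mul, mul_pow, Complex.norm_real, Real.norm_eq_abs, sq_abs]
    gcongr
    exact th_sq_le Λ x
  have h3 : Q^2/2 ≤ 2 * P * N2 a b p + S := by
    have e := ibp_cross (a := a) (b := b) h.d1 dp c1 cp1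
    rw [pa, pb] at e
    simp only [map_zero, mul_zero, sub_zero, zero_sub] at e
    have e3 : ∫ x in a..b, v x * (starRingEnd ℂ) (p1 x) = ((∫ x in a..b, th1 Λ x * ‖v x‖^2 : ℝ):ℂ) + ∫ x in a..b, p x * (starRingEnd ℂ) (v1 x) := by
      rw [← int_self, ← intervalIntegral.integral_add]
      · congr 1; funext x; simp [hp1, hp]; ring
      all_goals apply Continuous.intervalIntegrable; fun_prop
    rw [e3] at e
    have hr := congrArg Complex.re e
    simp only [Complex.add_re, Complex.neg_re, Complex.ofReal_re] at hr
    have q1 := (abs_le.1 ((Complex.abs_re_le_norm _).trans (cs_inner hab c1 cp))).1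
    have q2 := (abs_le.1 ((Complex.abs_re_le_norm _).trans (cs_inner hab cp c1))).1
    have q3 : Q^2/2 ≤ (∫ x in a..b, th1 Λ x * ‖v x‖^2) + S := by
      rw [hQ, N2_sq hab, hS, ← intervalIntegral.integral_add, ← intervalIntegral.integral_div]
      · apply intervalIntegral.integral_mono_on hab
        · exact Continuous.intervalIntegrable (by fun_prop) _ _
        · exact Continuous.intervalIntegrable (by fun_prop) _ _
        intro x _
        nlinarith [th_sum Λ x, sq_nonneg ‖v x‖]
      all_goals apply Continuous.intervalIntegrable; fun_prop
    linarith
  exact step1_alg hP0 hQ0 hm h.he1 h1 h2 h3 hT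

lemma pairing (h : Res a b Λ c ε v v1 v2 G) {m : ℝ} (hm : 0 ≤ m) (hD : Dom a b G m) {f f1 : ℝ → ℂ}
    (hf : ∀ x, HasDerivAt f (f1 x) x) (cf1 : Continuous f1) (fa : f a = 0) (fb : f b = 0) :
    ‖∫ x in a..b, v x * (starRingEnd ℂ) (f x)‖ ≤ 300 * m * (N2 a b (fun x => (om Λ x:ℂ) * f x) + N2 a b (fun x => (om Λ x:ℂ) * f1 x)) := by
  obtain ⟨hQ, hP⟩ := h.step1 hm hD
  have cv := h.cv
  have c1 := h.c1
  have hab := h.hab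
  have cth := th_cont Λ
  have cth1 := th1_cont Λ
  have com := om_cont Λ
  have cf : Continuous f := continuous_iff_continuousAt.2 fun x => (hf x).continuousAt
  have hsq : ∀ x, om Λ x ^ 2 ≤ om Λ x := fun x => by have := om_le_one Λ x; have := om_nonneg Λ x; nlinarith
  set p : ℝ → ℂ := fun x => (th Λ x : ℂ) * f x with hp
  set p1 : ℝ → ℂ := fun x => (th1 Λ x : ℂ) * f x + (th Λ x : ℂ) * f1 x with hp1
  have dp : ∀ x, HasDerivAt p (p1 x) x := fun x => ((th_deriv Λ x).ofReal_comp).mul (hf x)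
  have cp1 : Continuous p1 := by fun_prop
  have cp : Continuous p := by fun_prop
  have pa : p a = 0 := by simp [hp, fa]
  have pb : p b = 0 := by simp [hp, fb]
  set A := N2 a b (fun x => (om Λ x:ℂ) * f x)
  set B := N2 a b (fun x => (om Λ x:ℂ) * f1 x)
  have hA : 0 ≤ A := N2_nonneg _ _ _
  have hB : 0 ≤ B := N2_nonneg _ _ _
  have n1 : N2 a b p ≤ A := N2_mulr_mono hab cf cth com (th_abs Λ)
  have n2 : N2 a b p1 ≤ A + B := by
    refine (N2_add hab (by fun_prop) (by fun_prop)).trans ?_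
    exact add_le_add (N2_mulr_mono hab cf cth1 com (fun x => (th1_abs Λ x).trans (hsq x))) (N2_mulr_mono hab cf1 cth com (th_abs Λ))
  have n3 : N2 a b (fun x => ((om Λ x ^2:ℝ):ℂ) * f x) ≤ A := N2_mulr_mono hab cf (by fun_prop) com (fun x => by
    rw [abs_of_nonneg (by positivity)]; exact hsq x)
  have e := h.weak dp cp1 pa pb
  have e2 : ∫ x in a..b, ((x-Λ:ℝ):ℂ) * (v x * (starRingEnd ℂ) (p x)) = (∫ x in a..b, v x * (starRingEnd ℂ) (f x)) - ∫ x in a..b, v x * (starRingEnd ℂ) (((om Λ x ^2:ℝ):ℂ) * f x) := by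
    rw [← intervalIntegral.integral_sub]
    · congr 1; funext x
      have := congrArg (fun r : ℝ => (r:ℂ)) (th_id Λ x)
      simp only [hp, map_mul, Complex.conj_ofReal]
      push_cast at this ⊢
      linear_combination v x * (starRingEnd ℂ) (f x) * this
    all_goals apply Continuous.intervalIntegrable; fun_prop
  rw [e2] at e
  have e4 : ∫ x in a..b, v x * (starRingEnd ℂ) (f x) = -Complex.I * ((∫ x in a..b, G x * (starRingEnd ℂ) (p x)) - (∫ x in a..b, v1 x * (starRingEnd ℂ) (p1 x))
      - ((c - ε : ℝ):ℂ) * (∫ x in a..b, v x * (starRingEnd ℂ) (p x))) + ∫ x in a..b, v x * (starRingEnd ℂ) (((om Λ x ^2:ℝ):ℂ) * f x) := by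
    rw [e]; ring_nf; simp
  have t1 := (hD p p1 dp cp1 pa pb)
  have t2 := cs_inner hab c1 cp1
  have t3 := cs_inner hab cv cp
  have t4 := cs_inner hab cv (show Continuous (fun x => ((om Λ x ^2:ℝ):ℂ) * f x) by fun_prop)
  have t3' : ‖((c - ε : ℝ):ℂ) * (∫ x in a..b, v x * (starRingEnd ℂ) (p x))‖ ≤ 1 * (N2 a b v * N2 a b p) := by
    rw [norm_mul, Complex.norm_real, Real.norm_eq_abs]
    gcongr
    rw [abs_le]; constructor <;> linarith [h.hc, h.hc1, h.he, h.he1]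
  rw [e4]
  refine (norm_add_le _ _).trans ?_
  rw [norm_mul]
  have t5 := (norm_sub_le ((∫ x in a..b, G x * (starRingEnd ℂ) (p x)) - (∫ x in a..b, v1 x * (starRingEnd ℂ) (p1 x))) (((c - ε : ℝ):ℂ) * (∫ x in a..b, v x * (starRingEnd ℂ) (p x))))
  have t6 := norm_sub_le (∫ x in a..b, G x * (starRingEnd ℂ) (p x)) (∫ x in a..b, v1 x * (starRingEnd ℂ) (p1 x))
  simp only [norm_neg, Complex.norm_I, one_mul] at t3' ⊢
  have r1 : m * (N2 a b p + N2 a b p1) ≤ m * (2*A+B) := mul_le_mul_of_nonneg_left (by linarith) hm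
  have r2 : N2 a b v1 * N2 a b p1 ≤ (26*m) * (A+B) := mul_le_mul hP n2 (N2_nonneg _ _ _) (by positivity)
  have r3 : N2 a b v * N2 a b p ≤ (130*m) * A := mul_le_mul hQ n1 (N2_nonneg _ _ _) (by positivity)
  have r4 : N2 a b v * N2 a b (fun x => ((om Λ x ^2:ℝ):ℂ) * f x) ≤ (130*m) * A := mul_le_mul hQ n3 (N2_nonneg _ _ _) (by positivity)
  have := mul_nonneg hm hA
  have := mul_nonneg hm hB
  linarith

lemma L1bound (h : Res a b Λ c ε v v1 v2 G) : ∫ x in a..b, ‖v x‖ ≤ 300 * N2 a b G := by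
  have cv := h.cv
  have c1 := h.c1
  have c2 := h.c2
  have cG : Continuous G := by rw [funext h.hG]; fun_prop
  have hab := h.hab
  have com := om_cont Λ
  obtain ⟨hQ, hP⟩ := h.step1 (N2_nonneg a b G) (Dom_L2 hab cG)
  set m := N2 a b G
  have hm : 0 ≤ m := N2_nonneg _ _ _
  set p : ℝ → ℂ := fun x => ((x - Λ:ℝ) : ℂ) * v x with hp
  set p1 : ℝ → ℂ := fun x => (1 : ℂ) * v x + ((x-Λ:ℝ) : ℂ) * v1 x with hp1
  have dp : ∀ x, HasDerivAt p (p1 x) x := fun x => by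
    have := ((hasDerivAt_id x).sub_const Λ).ofReal_comp.mul (h.d1 x)
    simp only [Complex.ofReal_one, id] at this
    exact this
  have cp1 : Continuous p1 := by fun_prop
  have cp : Continuous p := by fun_prop
  have pa : p a = 0 := by simp [hp, h.va]
  have pb : p b = 0 := by simp [hp, h.vb]
  set Y := N2 a b p with hY
  have hY0 : 0 ≤ Y := N2_nonneg _ _ _
  have h2 : Y^2 ≤ N2 a b v1 * N2 a b v + m * Y := by
    have e := h.weak dp cp1 pa pb
    have e1 : ∫ x in a..b, v x * (starRingEnd ℂ) (p x) = ((∫ x in a..b, (x-Λ) * ‖v x‖^2 : ℝ):ℂ) := by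
      rw [← int_self]; congr 1; funext x; simp [hp]; ring
    have e2 : ∫ x in a..b, ((x-Λ:ℝ):ℂ) * (v x * (starRingEnd ℂ) (p x)) = ((Y^2:ℝ):ℂ) := by
      rw [hY, N2_sq hab]
      have : (fun x => ‖p x‖^2) = fun x => (x-Λ)^2 * ‖v x‖^2 := by
        funext x; simp only [hp, norm_mul, mul_pow, Complex.norm_real, Real.norm_eq_abs, sq_abs]
      rw [this, ← int_self]; congr 1; funext x; simp [hp]; ring
    have e3 : ∫ x in a..b, v1 x * (starRingEnd ℂ) (p1 x) = ((∫ x in a..b, (x-Λ) * ‖v1 x‖^2 : ℝ):ℂ) + ∫ x in a..b, v1 x * (starRingEnd ℂ) (v x) := by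
      rw [← int_self, ← intervalIntegral.integral_add]
      · congr 1; funext x; simp [hp1]; ring
      all_goals apply Continuous.intervalIntegrable; fun_prop
    rw [e1, e2, e3] at e
    have hi := congrArg Complex.im e
    simp only [Complex.add_im, Complex.im_ofReal_mul, Complex.ofReal_im, Complex.I_mul_im, Complex.ofReal_re, mul_zero, zero_add, add_zero] at hi
    have q1 := (abs_le.1 ((Complex.abs_im_le_norm _).trans (cs_inner hab cG cp))).2
    have q2 := (abs_le.1 ((Complex.abs_im_le_norm _).trans (cs_inner hab c1 cv))).1
    linarith
  have hPQ : N2 a b v1 * N2 a b v ≤ (26*m)*(130*m) := mul_le_mul hP hQ (N2_nonneg _ _ _) (by positivity)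
  have hYm : Y ≤ 60 * m := by
    by_contra hc
    push Not at hc
    nlinarith
  set g : ℝ → ℝ := fun x => Real.sqrt (1+(x-Λ)^2) * ‖v x‖ with hg
  have cg : Continuous g := by fun_prop
  have e0 : ∫ x in a..b, ‖v x‖ = ∫ x in a..b, om Λ x * g x := by
    congr 1; funext x; simp only [hg, om]
    have : Real.sqrt (1+(x-Λ)^2) ≠ 0 := by positivity
    field_simp
  have e1 : ∫ x in a..b, g x ^2 = N2 a b v ^2 + Y^2 := by
    rw [N2_sq hab, hY, N2_sq hab, ← intervalIntegral.integral_add]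
    · congr 1; funext x; simp only [hg, hp, mul_pow, norm_mul, Complex.norm_real, Real.norm_eq_abs, sq_abs]
      rw [Real.sq_sqrt (by positivity)]; ring
    all_goals apply Continuous.intervalIntegrable; fun_prop
  rw [e0]
  refine (cs_real hab com cg).trans ?_
  have s1 : Real.sqrt (∫ x in a..b, om Λ x ^2) ≤ 2 := Real.sqrt_le_iff.2 ⟨by norm_num, (om_int Λ a b).trans (by linarith [Real.pi_le_four])⟩
  have s2 : Real.sqrt (∫ x in a..b, g x ^2) ≤ 150 * m := by
    apply Real.sqrt_le_iff.2 ⟨by positivity, ?_⟩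
    rw [e1]
    nlinarith [N2_nonneg a b v]
  calc _ ≤ 2 * (150*m) := mul_le_mul s1 s2 (Real.sqrt_nonneg _) (by norm_num)
    _ = _ := by ring

end Res

noncomputable def es (κ ℓ s : ℝ) : ℝ := Real.sinh (κ*(ℓ-s)) / Real.sinh (κ*ℓ)
noncomputable def es1 (κ ℓ s : ℝ) : ℝ := -κ * Real.cosh (κ*(ℓ-s)) / Real.sinh (κ*ℓ)

lemma es_deriv (κ ℓ s : ℝ) : HasDerivAt (es κ ℓ) (es1 κ ℓ s) s := by
  have h0 : HasDerivAt (fun s : ℝ => κ*(ℓ-s)) (κ * (-1)) s := ((hasDerivAt_id s).const_sub ℓ).const_mul κ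
  have := (h0.sinh).div_const (Real.sinh (κ*ℓ))
  have e : es1 κ ℓ s = Real.cosh (κ*(ℓ-s)) * (κ * (-1)) / Real.sinh (κ*ℓ) := by unfold es1; ring
  rw [e]; exact this
lemma es1_deriv (κ ℓ s : ℝ) : HasDerivAt (es1 κ ℓ) (κ^2 * es κ ℓ s) s := by
  have h0 : HasDerivAt (fun s : ℝ => κ*(ℓ-s)) (κ * (-1)) s := ((hasDerivAt_id s).const_sub ℓ).const_mul κ
  have := ((h0.cosh).const_mul (-κ)).div_const (Real.sinh (κ*ℓ))
  have e : κ^2 * es κ ℓ s = -κ * (Real.sinh (κ*(ℓ-s)) * (κ * (-1))) / Real.sinh (κ*ℓ) := by unfold es; ring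
  rw [e]; exact this
lemma es_cont (κ ℓ : ℝ) : Continuous (es κ ℓ) := continuous_iff_continuousAt.2 fun x => (es_deriv κ ℓ x).continuousAt
lemma es1_cont (κ ℓ : ℝ) : Continuous (es1 κ ℓ) := continuous_iff_continuousAt.2 fun x => (es1_deriv κ ℓ x).continuousAt

lemma sinh_convex_le {x t : ℝ} (hx : 0 ≤ x) (ht : 0 ≤ t) (ht1 : t ≤ 1) : Real.sinh (t*x) ≤ t * Real.sinh x := by
  have hc : ConvexOn ℝ (Ici (0:ℝ)) Real.sinh := by
    apply convexOn_of_deriv2_nonneg' (convex_Ici 0)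
    · exact Real.differentiable_sinh.differentiableOn
    · rw [Real.deriv_sinh]; exact Real.differentiable_cosh.differentiableOn
    · intro y hy
      simp [Real.deriv_sinh, Real.deriv_cosh]
      exact hy
  have := hc.2 (show (0:ℝ) ∈ Ici (0:ℝ) by simp) (show x ∈ Ici (0:ℝ) from hx) (sub_nonneg.2 ht1) ht (by ring)
  simpa using this

section
variable {κ ℓ s : ℝ}
lemma sinhpos (hκ : 0 < κ) (hl : 0 < ℓ) : 0 < Real.sinh (κ*ℓ) := Real.sinh_pos_iff.2 (by positivity)
lemma es_zero (hκ : 0 < κ) (hl : 0 < ℓ) : es κ ℓ 0 = 1 := by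
  have := sinhpos hκ hl
  unfold es; rw [sub_zero, div_self this.ne']
lemma es_end : es κ ℓ ℓ = 0 := by unfold es; simp
lemma es_nonneg (hκ : 0 < κ) (hl : 0 < ℓ) (h1 : s ≤ ℓ) : 0 ≤ es κ ℓ s := by
  unfold es
  apply div_nonneg _ (sinhpos hκ hl).le
  rw [Real.sinh_nonneg_iff]; exact mul_nonneg hκ.le (by linarith)
lemma es_refl_le (hκ : 0 < κ) (hl : 0 < ℓ) (h0 : 0 ≤ s) (h1 : s ≤ ℓ) : es κ ℓ (ℓ - s) ≤ s/ℓ := by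
  have hp := sinhpos hκ hl
  unfold es
  rw [div_le_iff₀ hp]
  have := sinh_convex_le (x := κ*ℓ) (t := s/ℓ) (by positivity) (by positivity) (by rw [div_le_one hl]; exact h1)
  have e : s/ℓ*(κ*ℓ) = κ*(ℓ-(ℓ-s)) := by field_simp; ring
  rwa [e] at this
lemma es_diff (hκ : 0 < κ) (hl : 0 < ℓ) : Real.exp (-κ*s) - es κ ℓ s = Real.exp (-κ*ℓ) * es κ ℓ (ℓ - s) := by
  have hp := sinhpos hκ hl
  unfold es
  field_simp
  rw [Real.sinh_eq, Real.sinh_eq, Real.sinh_eq]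
  have a1 : Real.exp (-(κ*s)) * Real.exp (κ*ℓ) = Real.exp (κ*(ℓ-s)) := by rw [← Real.exp_add]; ring_nf
  have a2 : Real.exp (-(κ*s)) * Real.exp (-(κ*ℓ)) = Real.exp (-(κ*ℓ) + -(κ*s)) := by rw [← Real.exp_add]; ring_nf
  have a3 : Real.exp (-(κ*ℓ)) * Real.exp (κ*(ℓ-(ℓ-s))) = Real.exp (-(κ*(ℓ-s))) := by rw [← Real.exp_add]; ring_nf
  have a4 : Real.exp (-(κ*ℓ)) * Real.exp (-(κ*(ℓ-(ℓ-s)))) = Real.exp (-(κ*ℓ) + -(κ*s)) := by rw [← Real.exp_add]; ring_nf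
  linear_combination (1/2)*a1 - (1/2)*a2 - (1/2) *a3 + (1/2) *a4
lemma es_le_exp (hκ : 0 < κ) (hl : 0 < ℓ) (h0 : 0 ≤ s) : es κ ℓ s ≤ Real.exp (-κ*s) := by
  have := es_diff (s := s) hκ hl
  have h2 : 0 ≤ es κ ℓ (ℓ - s) := es_nonneg hκ hl (by linarith)
  have := mul_nonneg (Real.exp_pos (-κ*ℓ)).le h2
  linarith
lemma exp_sub_es_le (hκ : 0 < κ) (hl : 0 < ℓ) (h0 : 0 ≤ s) (h1 : s ≤ ℓ) : Real.exp (-κ*s) - es κ ℓ s ≤ s/ℓ := by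
  rw [es_diff hκ hl]
  have h2 : 0 ≤ es κ ℓ (ℓ - s) := es_nonneg hκ hl (by linarith)
  have h3 := es_refl_le hκ hl h0 h1
  have : Real.exp (-κ*ℓ) ≤ 1 := Real.exp_le_one_iff.2 (by nlinarith)
  nlinarith
lemma es1_abs (hκ : 0 < κ) (hl : 2 ≤ κ*ℓ) (h1 : s ≤ ℓ) : |es1 κ ℓ s| ≤ 3 * κ * Real.exp (-κ*s) := by
  have hp : 0 < Real.sinh (κ*ℓ) := Real.sinh_pos_iff.2 (by linarith)
  unfold es1
  rw [abs_div, abs_of_pos hp, div_le_iff₀ hp, abs_mul, abs_neg, abs_of_pos hκ, abs_of_pos (Real.cosh_pos _)]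
  have c : Real.cosh (κ*(ℓ-s)) ≤ Real.exp (κ*(ℓ-s)) := by
    rw [Real.cosh_eq]
    have : Real.exp (-(κ*(ℓ-s))) ≤ Real.exp (κ*(ℓ-s)) := Real.exp_le_exp.2 (by have := mul_nonneg hκ.le (sub_nonneg.2 h1); linarith)
    linarith
  have d : Real.exp (κ*ℓ) ≤ 3 * Real.sinh (κ*ℓ) := by
    rw [Real.sinh_eq]
    have a : Real.exp (-(κ*ℓ)) ≤ 1 := Real.exp_le_one_iff.2 (by linarith)
    have b := Real.add_one_le_exp (κ*ℓ)
    linarith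
  have e : Real.exp (κ*(ℓ-s)) = Real.exp (-κ*s) * Real.exp (κ*ℓ) := by rw [← Real.exp_add]; ring_nf
  calc κ * Real.cosh (κ*(ℓ-s)) ≤ κ * (Real.exp (-κ*s) * Real.exp (κ*ℓ)) := by rw [← e]; gcongr
    _ ≤ κ * (Real.exp (-κ*s) * (3 * Real.sinh (κ*ℓ))) := by gcongr
    _ = _ := by ring
end

/-- boundary corrector -/
structure Corr (C δ κ ε d ℓ : ℝ) (W W1 W2 : ℝ → ℂ) : Prop where
  d1 : ∀ s, HasDerivAt W (W1 s) s
  d2 : ∀ s, HasDerivAt W1 (W2 s) s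
  c2 : Continuous W2
  w0 : W 0 = 1
  wl : W ℓ = 0
  ha : ∫ s in (0:ℝ)..ℓ, ‖W s‖ ≤ C * ‖∫ s in (0:ℝ)..ℓ, W s * (es κ ℓ s : ℂ)‖
  hb : ∫ s in (0:ℝ)..ℓ, ‖W s‖^2 ≤ C * Real.sqrt (1+|d|) * ‖∫ s in (0:ℝ)..ℓ, W s * (es κ ℓ s : ℂ)‖^2
  hc : (∫ s in (0:ℝ)..ℓ, s * ‖W s‖) * Real.sqrt (1+|d|) ≤ C * ‖∫ s in (0:ℝ)..ℓ, W s * (es κ ℓ s : ℂ)‖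
  hd : ∫ s in (0:ℝ)..ℓ, s * ‖W s‖^2 ≤ C * ‖∫ s in (0:ℝ)..ℓ, W s * (es κ ℓ s : ℂ)‖^2
  he : N2 0 ℓ (fun s => W2 s - ((κ:ℂ)^2 - (ε:ℂ) + Complex.I * ((s+d:ℝ):ℂ)) * W s) ≤ δ * ‖∫ s in (0:ℝ)..ℓ, W s * (es κ ℓ s : ℂ)‖

lemma exp_int0 {r ℓ : ℝ} (hr : 0 < r) (hl : 0 ≤ ℓ) : ∫ s in (0:ℝ)..ℓ, Real.exp (-r*s) ≤ 1/r := by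
  have h : ∀ s ∈ uIcc (0:ℝ) ℓ, HasDerivAt (fun s => -(1/r) * Real.exp (-r*s)) (Real.exp (-r*s)) s := by
    intro s _
    have h0 : HasDerivAt (fun s : ℝ => -r*s) (-r) s := by simpa using (hasDerivAt_id s).const_mul (-r)
    have := h0.exp.const_mul (-(1/r))
    refine HasDerivAt.congr_deriv this ?_
    field_simp
  rw [intervalIntegral.integral_eq_sub_of_hasDerivAt h (Continuous.intervalIntegrable (by fun_prop) _ _)]
  have : 0 < 1/r * Real.exp (-r*ℓ) := by positivity
  simp at this ⊢; linarith
lemma exp_int1 {r ℓ : ℝ} (hr : 0 < r) (hl : 0 ≤ ℓ) : ∫ s in (0:ℝ)..ℓ, s * Real.exp (-r*s) ≤ 1/r^2 := by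
  have h : ∀ s ∈ uIcc (0:ℝ) ℓ, HasDerivAt (fun s => -(s/r + 1/r^2) * Real.exp (-r*s)) (s * Real.exp (-r*s)) s := by
    intro s _
    have h0 : HasDerivAt (fun s : ℝ => -r*s) (-r) s := by simpa using (hasDerivAt_id s).const_mul (-r)
    have h1 : HasDerivAt (fun s : ℝ => -(s/r + 1/r^2)) (-(1/r)) s := (((hasDerivAt_id s).div_const r).add_const _).neg
    have := h1.mul h0.exp
    refine HasDerivAt.congr_deriv this ?_
    field_simp; ring
  rw [intervalIntegral.integral_eq_sub_of_hasDerivAt h (Continuous.intervalIntegrable (by fun_prop) _ _)]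
  have : 0 < (ℓ/r + 1/r^2) * Real.exp (-r*ℓ) := by positivity
  simp at this ⊢; linarith
lemma exp_int2 {r ℓ : ℝ} (hr : 0 < r) (hl : 0 ≤ ℓ) : ∫ s in (0:ℝ)..ℓ, s^2 * Real.exp (-r*s) ≤ 2/r^3 := by
  have h : ∀ s ∈ uIcc (0:ℝ) ℓ, HasDerivAt (fun s => -(s^2/r + 2*s/r^2 + 2/r^3) * Real.exp (-r*s)) (s^2 * Real.exp (-r*s)) s := by
    intro s _
    have h0 : HasDerivAt (fun s : ℝ => -r*s) (-r) s := by simpa using (hasDerivAt_id s).const_mul (-r)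
    have h1 : HasDerivAt (fun s : ℝ => -(s^2/r + 2*s/r^2 + 2/r^3)) (-(2*s/r + 2/r^2)) s := by
      have a := ((hasDerivAt_id s).pow 2).div_const r
      have b := ((hasDerivAt_id s).const_mul 2).div_const (r^2)
      have := ((a.add b).add_const (2/r^3)).neg
      refine HasDerivAt.congr_deriv this ?_
      simp
    have := h1.mul h0.exp
    refine HasDerivAt.congr_deriv this ?_
    field_simp; ring
  rw [intervalIntegral.integral_eq_sub_of_hasDerivAt h (Continuous.intervalIntegrable (by fun_prop) _ _)]
  have : 0 < (ℓ^2/r + 2*ℓ/r^2+2/r^3) * Real.exp (-r*ℓ) := by positivity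
  simp at this ⊢; linarith

lemma norm_csinh_le (z : ℂ) (hz : 0 ≤ z.re) : ‖Complex.sinh z‖ ≤ Real.exp z.re := by
  rw [Complex.sinh]
  rw [norm_div]
  have := norm_sub_le (Complex.exp z) (Complex.exp (-z))
  rw [Complex.norm_exp, Complex.norm_exp, Complex.neg_re] at this
  have h : Real.exp (-z.re) ≤ Real.exp z.re := Real.exp_le_exp.2 (by linarith)
  have h2 : ‖(2:ℂ)‖ = 2 := by simp
  rw [h2]; linarith
lemma norm_csinh_ge (z : ℂ) (hz : 2 ≤ z.re) : Real.exp z.re / 3 ≤ ‖Complex.sinh z‖ := by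
  rw [Complex.sinh, norm_div]
  have := norm_sub_norm_le (Complex.exp z) (Complex.exp (-z))
  rw [Complex.norm_exp, Complex.norm_exp, Complex.neg_re] at this
  have a : Real.exp (-z.re) ≤ 1 := Real.exp_le_one_iff.2 (by linarith)
  have b := Real.add_one_le_exp z.re
  have h2 : ‖(2:ℂ)‖ = 2 := by simp
  rw [h2]; linarith
lemma norm_ccosh_ge (z : ℂ) (hz : 2 ≤ z.re) : Real.exp z.re / 3 ≤ ‖Complex.cosh z‖ := by
  rw [Complex.cosh, norm_div]
  have := norm_sub_norm_le (Complex.exp z) (-Complex.exp (-z))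
  rw [norm_neg, sub_neg_eq_add, Complex.norm_exp, Complex.norm_exp, Complex.neg_re] at this
  have a : Real.exp (-z.re) ≤ 1 := Real.exp_le_one_iff.2 (by linarith)
  have b := Real.add_one_le_exp z.re
  have h2 : ‖(2:ℂ)‖ = 2 := by simp
  rw [h2]; linarith

lemma exists_root (z : ℂ) : ∃ η : ℂ, η^2 = z ∧ 0 ≤ η.re := by
  obtain ⟨η, h⟩ := IsAlgClosed.exists_pow_nat_eq z (n := 2) (by norm_num)
  rcases le_total 0 η.re with h0 | h0
  · exact ⟨η, h, h0⟩
  · exact ⟨-η, by rw [neg_sq, h], by simpa using h0⟩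

set_option maxHeartbeats 1600000 in
lemma corr_large (δ : ℝ) (hδ : 0 < δ) : ∃ D0 : ℝ, 0 < D0 ∧ ∀ κ ε d ℓ : ℝ, 0 < κ → κ ≤ 1 → 2 ≤ κ*ℓ → 0 ≤ ε → ε ≤ 1 → D0 ≤ |d| →
    ∃ W W1 W2 : ℝ → ℂ, Corr 6000 δ κ ε d ℓ W W1 W2 := by
  refine ⟨(40 + 10400/δ^2)^2, by positivity, ?_⟩
  intro κ ε d ℓ hκ hκ1 hkl he he1 hd
  have hl : 2 ≤ ℓ := by nlinarith
  have hl0 : 0 < ℓ := by linarith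
  set q := Real.sqrt |d| with hq
  have hq2 : q^2 = |d| := Real.sq_sqrt (abs_nonneg d)
  have hqb : 40 + 10400/δ^2 ≤ q := Real.le_sqrt_of_sq_le hd
  have hq40 : 40 ≤ q := by have : 0 < 10400/δ^2 := by positivity
                           linarith
  have hqδ : 10400 ≤ δ^2 * q := by
    have : 10400/δ^2 ≤ q := by linarith
    rwa [div_le_iff₀' (by positivity)] at this
  obtain ⟨η, hη, hr0⟩ := exists_root ((κ:ℂ)^2 - (ε:ℂ) + Complex.I * (d:ℂ))
  set r := η.re with hr
  have hn : ‖η‖^2 = ‖(κ:ℂ)^2 - (ε:ℂ) + Complex.I * (d:ℂ)‖ := by rw [← norm_pow, hη]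
  have him : q^2 ≤ ‖η‖^2 := by
    rw [hn, hq2]
    have := Complex.abs_im_le_norm ((κ:ℂ)^2 - (ε:ℂ) + Complex.I * (d:ℂ))
    simpa [pow_two] using this
  have hηq : q ≤ ‖η‖ := le_of_sq_le_sq him (norm_nonneg _)
  have hre : r^2 - η.im^2 = κ^2 - ε := by
    have := congrArg Complex.re hη
    simp [pow_two] at this
    rw [hr]; linarith
  have hnn : ‖η‖^2 = r^2 + η.im^2 := by rw [Complex.sq_norm, Complex.normSq_apply]; ring
  have hrq : q/2 ≤ r := by
    apply le_of_sq_le_sq _ hr0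
    nlinarith
  have hr20 : 20 ≤ r := by linarith
  have hR : 2 ≤ (η*ℓ).re := by simp; rw [← hr]; nlinarith
  have hs0 : Complex.sinh (η*ℓ) ≠ 0 := by
    have := norm_csinh_ge _ hR
    rw [← norm_pos_iff]
    exact lt_of_lt_of_le (by positivity) this
  set W : ℝ → ℂ := fun s => Complex.sinh (η*((ℓ:ℂ)-(s:ℂ))) / Complex.sinh (η*ℓ) with hW
  set W1 : ℝ → ℂ := fun s => Complex.cosh (η*((ℓ:ℂ)-(s:ℂ))) * (-η) / Complex.sinh (η*ℓ) with hW1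
  set W2 : ℝ → ℂ := fun s => η^2 * W s with hW2
  have hin : ∀ s : ℝ, HasDerivAt (fun s : ℝ => η*((ℓ:ℂ)-(s:ℂ))) (-η) s := by
    intro s
    have := ((hasDerivAt_id s).ofReal_comp.const_sub (ℓ:ℂ)).const_mul η
    refine HasDerivAt.congr_deriv this ?_
    simp
  have d1 : ∀ s, HasDerivAt W (W1 s) s := fun s => by
    exact ((Complex.hasDerivAt_sinh _).comp s (hin s)).div_const _
  have d2 : ∀ s, HasDerivAt W1 (W2 s) s := fun s => by
    have := (((Complex.hasDerivAt_cosh _).comp s (hin s)).mul_const (-η)).div_const (Complex.sinh (η*ℓ))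
    refine HasDerivAt.congr_deriv this ?_
    simp only [hW2, hW]; ring
  have cW : Continuous W := continuous_iff_continuousAt.2 fun x => (d1 x).continuousAt
  have cW1 : Continuous W1 := continuous_iff_continuousAt.2 fun x => (d2 x).continuousAt
  have c2 : Continuous W2 := by fun_prop
  have ces := es_cont κ ℓ
  have w0 : W 0 = 1 := by simp [hW, hs0]
  have wl : W ℓ = 0 := by simp [hW]
  have bW : ∀ s ∈ Icc (0:ℝ) ℓ, ‖W s‖ ≤ 3 * Real.exp (-r*s) := by
    intro s hs
    have a := norm_csinh_ge _ hR
    have hre2 : (η*((ℓ:ℂ)-(s:ℂ))).re = r*(ℓ-s) := by simp [hr]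
    have hre3 : (η*(ℓ:ℂ)).re = r*ℓ := by simp [hr]
    have b := norm_csinh_le (η*((ℓ:ℂ)-(s:ℂ))) (by rw [hre2]; exact mul_nonneg hr0 (by linarith [hs.2]))
    rw [hre2] at b
    rw [hre3] at a
    simp only [hW, norm_div]
    rw [div_le_iff₀ (by rw [norm_pos_iff]; exact hs0)]
    have e : Real.exp (r*(ℓ-s)) = Real.exp (-r*s) * Real.exp (r*ℓ) := by rw [← Real.exp_add]; ring_nf
    calc _ ≤ Real.exp (-r*s) * Real.exp (r*ℓ) := by rw [← e]; exact b
      _ = 3 * Real.exp (-r*s) * (Real.exp (r*ℓ)/3) := by ring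
      _ ≤ _ := by gcongr
  have bW2 : ∀ s ∈ Icc (0:ℝ) ℓ, ‖W s‖^2 ≤ 9 * Real.exp (-(2*r)*s) := by
    intro s hs
    have := bW s hs
    calc ‖W s‖^2 ≤ (3 * Real.exp (-r*s))^2 := by gcongr
      _ = 9 * (Real.exp (-r*s) * Real.exp (-r*s)) := by ring
      _ = _ := by rw [← Real.exp_add]; ring_nf
  set g := ‖∫ s in (0:ℝ)..ℓ, W s * (es κ ℓ s : ℂ)‖ with hg
  -- lower bound for g
  have key : 1/(24*q) ≤ g := by
    have i1 : ∫ s in (0:ℝ)..ℓ, (W2 s * (es κ ℓ s : ℂ) - W s * ((κ^2 * es κ ℓ s : ℝ):ℂ)) = -W1 0 + (es1 κ ℓ 0 : ℂ) := by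
      have hd : ∀ s ∈ uIcc (0:ℝ) ℓ, HasDerivAt (fun s => W1 s * (es κ ℓ s : ℂ) - W s * (es1 κ ℓ s : ℂ)) (W2 s * (es κ ℓ s : ℂ) - W s * ((κ^2 * es κ ℓ s : ℝ):ℂ)) s := by
        intro s _
        have := ((d2 s).mul (es_deriv κ ℓ s).ofReal_comp).sub ((d1 s).mul (es1_deriv κ ℓ s).ofReal_comp)
        refine HasDerivAt.congr_deriv this ?_
        ring
      rw [intervalIntegral.integral_eq_sub_of_hasDerivAt hd (Continuous.intervalIntegrable (by fun_prop) _ _)]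
      rw [es_end, wl, w0, es_zero hκ hl0]
      push_cast; ring
    have i2 : ∫ s in (0:ℝ)..ℓ, (W2 s * (es κ ℓ s : ℂ) - W s * ((κ^2 * es κ ℓ s : ℝ):ℂ)) = (η^2 - (κ:ℂ)^2) * ∫ s in (0:ℝ)..ℓ, W s * (es κ ℓ s : ℂ) := by
      rw [← intervalIntegral.integral_const_mul]
      congr 1; funext s; simp only [hW2]; push_cast; ring
    have i3 : ‖η^2 - (κ:ℂ)^2‖ * g = ‖-W1 0 + (es1 κ ℓ 0 : ℂ)‖ := by rw [← i1, i2, norm_mul]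
    have n1 : ‖η^2 - (κ:ℂ)^2‖ ≤ 2*q^2 := by
      rw [hη]
      have : (κ:ℂ)^2 - (ε:ℂ) + Complex.I * (d:ℂ) - (κ:ℂ)^2 = -(ε:ℂ) + Complex.I * (d:ℂ) := by ring
      rw [this]
      refine (norm_add_le _ _).trans ?_
      rw [norm_neg, norm_mul, Complex.norm_I, Complex.norm_real, Complex.norm_real, Real.norm_eq_abs, Real.norm_eq_abs, ← hq2, abs_of_nonneg he]
      nlinarith
    have n2 : ‖(es1 κ ℓ 0 : ℂ)‖ ≤ 3 := by
      rw [Complex.norm_real, Real.norm_eq_abs]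
      refine (es1_abs hκ hkl hl0.le).trans ?_
      simp; linarith
    have n3 : ‖η‖/3 ≤ ‖W1 0‖ := by
      simp only [hW1, norm_div, norm_mul, norm_neg, Complex.ofReal_zero, sub_zero]
      rw [le_div_iff₀ (by rw [norm_pos_iff]; exact hs0)]
      have a := norm_ccosh_ge _ hR
      have b := norm_csinh_le (η*ℓ) (by linarith)
      nlinarith [norm_nonneg η]
    have n4 : q/12 ≤ ‖-W1 0 + (es1 κ ℓ 0 : ℂ)‖ := by
      have := norm_sub_norm_le (W1 0) (es1 κ ℓ 0 : ℂ)
      have e : ‖-W1 0 + (es1 κ ℓ 0 : ℂ)‖ = ‖W1 0 - (es1 κ ℓ 0 : ℂ)‖ := by rw [← norm_neg]; congr 1; ring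
      rw [e]; linarith
    rw [← i3] at n4
    have : q/12 ≤ 2*q^2*g := n4.trans (by gcongr)
    rw [div_le_iff₀ (by positivity)]
    have h3 : q * 1 ≤ q * (g*(24*q)) := by nlinarith
    exact le_of_mul_le_mul_left h3 (by linarith)
  have hg0 : 0 ≤ g := norm_nonneg _
  have hq0 : 0 < q := by linarith
  have key' : 1 ≤ 24*(q*g) := by
    rw [div_le_iff₀ (by positivity)] at key; linarith
  have sD1 : q ≤ Real.sqrt (1+|d|) := Real.sqrt_le_sqrt (by linarith)
  have sD2 : Real.sqrt (1+|d|) ≤ 2*q := by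
    rw [← hq2]
    apply Real.sqrt_le_iff.2 ⟨by positivity, by nlinarith⟩
  have hrp : 0 < r := by linarith
  have ir : 1/r ≤ 2/q := by rw [div_le_div_iff₀ hrp hq0]; linarith
  refine ⟨W, W1, W2, d1, d2, c2, w0, wl, ?_, ?_, ?_, ?_, ?_⟩ <;> rw [← hg]
  · calc ∫ s in (0:ℝ)..ℓ, ‖W s‖ ≤ ∫ s in (0:ℝ)..ℓ, 3 * Real.exp (-r*s) :=
          intervalIntegral.integral_mono_on hl0.le (Continuous.intervalIntegrable (by fun_prop) _ _) (Continuous.intervalIntegrable (by fun_prop) _ _) bW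
      _ ≤ 3 * (1/r) := by rw [intervalIntegral.integral_const_mul]; gcongr; exact exp_int0 hrp hl0.le
      _ ≤ 3 * (2/q) := by gcongr
      _ = 144 * (1/(24*q)) := by field_simp; norm_num
      _ ≤ 144 * g := by gcongr
      _ ≤ 6000 * g := by linarith
  · calc ∫ s in (0:ℝ)..ℓ, ‖W s‖^2 ≤ ∫ s in (0:ℝ)..ℓ, 9 * Real.exp (-(2*r)*s) :=
          intervalIntegral.integral_mono_on hl0.le (Continuous.intervalIntegrable (by fun_prop) _ _) (Continuous.intervalIntegrable (by fun_prop) _ _) bW2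
      _ ≤ 9 * (1/(2*r)) := by rw [intervalIntegral.integral_const_mul]; gcongr; exact exp_int0 (by positivity) hl0.le
      _ = (9/2) * (1/r) := by field_simp
      _ ≤ (9/2) * (2/q) := by gcongr
      _ = 5184 * q * (1/(24*q))^2 := by field_simp; norm_num
      _ ≤ 5184 * q * g^2 := by gcongr
      _ ≤ 6000 * Real.sqrt (1+|d|) * g^2 := by gcongr; norm_num
  · have : ∫ s in (0:ℝ)..ℓ, s * ‖W s‖ ≤ 12 /q^2 := by
      calc ∫ s in (0:ℝ)..ℓ, s * ‖W s‖ ≤ ∫ s in (0:ℝ)..ℓ, 3 * (s * Real.exp (-r*s)) :=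
            intervalIntegral.integral_mono_on hl0.le (Continuous.intervalIntegrable (by fun_prop) _ _) (Continuous.intervalIntegrable (by fun_prop) _ _) (fun s hs => by
              have := mul_le_mul_of_nonneg_left (bW s hs) hs.1; linarith)
        _ ≤ 3 * (1/r^2) := by rw [intervalIntegral.integral_const_mul]; gcongr; exact exp_int1 hrp hl0.le
        _ = 3 * (1/r)^2 := by field_simp
        _ ≤ 3 * (2/q)^2 := by gcongr
        _ = 12/q^2 := by field_simp; norm_num
    calc _ ≤ 12/q^2 * (2*q) := by gcongr
      _ = 576 * (1/(24*q)) := by field_simp; norm_num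
      _ ≤ 576 * g := by gcongr
      _ ≤ 6000 * g := by linarith
  · calc ∫ s in (0:ℝ)..ℓ, s * ‖W s‖^2 ≤ ∫ s in (0:ℝ)..ℓ, 9 * (s * Real.exp (-(2*r)*s)) :=
          intervalIntegral.integral_mono_on hl0.le (Continuous.intervalIntegrable (by fun_prop) _ _) (Continuous.intervalIntegrable (by fun_prop) _ _) (fun s hs => by
            have := mul_le_mul_of_nonneg_left (bW2 s hs) hs.1; linarith)
      _ ≤ 9 * (1/(2*r)^2) := by rw [intervalIntegral.integral_const_mul]; gcongr; exact exp_int1 (by positivity) hl0.le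
      _ = (9/4) * (1/r)^2 := by field_simp; norm_num
      _ ≤ (9/4) * (2/q)^2 := by gcongr
      _ = 5184 * (1/(24*q))^2 := by field_simp; norm_num
      _ ≤ 5184 * g^2 := by gcongr
      _ ≤ 6000 * g^2 := by nlinarith [sq_nonneg g]
  · refine N2_le_of_bound hl0.le (g := fun s => 9 * (s^2 * Real.exp (-(2*r)*s))) (by fun_prop) (by fun_prop) (by positivity) ?_ ?_
    · intro s hs
      have e : W2 s - ((κ:ℂ)^2 - (ε:ℂ) + Complex.I * ((s+d:ℝ):ℂ)) * W s = (-Complex.I * (s:ℂ)) * W s := by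
        simp only [hW2]; rw [hη]; push_cast; ring
      rw [e, norm_mul, norm_mul, norm_neg, Complex.norm_I, one_mul, Complex.norm_real, Real.norm_eq_abs, mul_pow, sq_abs]
      have := mul_le_mul_of_nonneg_left (bW2 s hs) (sq_nonneg s)
      linarith
    · calc ∫ s in (0:ℝ)..ℓ, 9 * (s^2 * Real.exp (-(2*r)*s)) ≤ 9 * (2/(2*r)^3) := by
            rw [intervalIntegral.integral_const_mul]; gcongr; exact exp_int2 (by positivity) hl0.le
        _ = (9/4) * (1/r)^3 := by field_simp; norm_num
        _ ≤ (9/4) * (2/q)^3 := by gcongr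
        _ = 18/q^3 := by field_simp; norm_num
        _ ≤ (δ * (1/(24*q)))^2 := by
            rw [div_le_iff₀ (by positivity)]
            have : (δ * (1/(24*q)))^2 * q^3 = δ^2*q/576 := by field_simp; norm_num
            rw [this]; linarith
        _ ≤ (δ*g)^2 := by gcongr

lemma exp_lip1 {a b : ℝ} (ha : 0 ≤ a) (hab : a ≤ b) : |Real.exp (-a) - Real.exp (-b)| ≤ b - a := by
  have h1 : Real.exp (-b) ≤ Real.exp (-a) := Real.exp_le_exp.2 (by linarith)
  rw [abs_of_nonneg (by linarith)]
  have h2 : Real.exp (-b) = Real.exp (-a) * Real.exp (a-b) := by rw [← Real.exp_add]; ring_nf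
  have h3 := Real.add_one_le_exp (a-b)
  have h4 : Real.exp (-a) ≤ 1 := Real.exp_le_one_iff.2 (by linarith)
  have h5 := Real.exp_pos (-a)
  rw [h2]; nlinarith
lemma exp_lip {a b : ℝ} (ha : 0 ≤ a) (hb : 0 ≤ b) : |Real.exp (-a) - Real.exp (-b)| ≤ |a - b| := by
  rcases le_total a b with h | h
  · rw [abs_of_nonpos (show a - b ≤ 0 by linarith)]; linarith [exp_lip1 ha h]
  · rw [abs_of_nonneg (show 0 ≤ a - b by linarith), abs_sub_comm]; exact exp_lip1 hb h

lemma dec_bounds {x s K : ℝ} (hx : 0 ≤ x) (hs : 0 ≤ s) (h : (1+s)^4 * x ≤ K) :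
    x ≤ K * om 0 s ^ 2 ∧ s * x ≤ K * om 0 s ^ 2 ∧ x^2 ≤ K^2 * om 0 s ^ 2 ∧ s * x^2 ≤ K^2 * om 0 s^2 := by
  have hA := om_sq 0 s
  rw [sub_zero] at hA
  have h1 : x * (1+s^2) ≤ K := by
    refine le_trans ?_ h
    rw [mul_comm]
    apply mul_le_mul_of_nonneg_right _ hx
    nlinarith [pow_nonneg hs 3, pow_nonneg hs 4, pow_nonneg hs 2]
  have h2 : (s * x) * (1+s^2) ≤ K := by
    refine le_trans ?_ h
    have : (s * x) * (1+s^2) = (s * (1+s^2)) * x := by ring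
    rw [this]
    apply mul_le_mul_of_nonneg_right _ hx
    nlinarith [pow_nonneg hs 3, pow_nonneg hs 4, pow_nonneg hs 2]
  have e1 : x ≤ K * om 0 s ^ 2 := by
    rw [hA, ← div_eq_mul_inv, le_div_iff₀ (by positivity)]; exact h1
  have e2 : s * x ≤ K * om 0 s ^ 2 := by
    rw [hA, ← div_eq_mul_inv, le_div_iff₀ (by positivity)]; exact h2
  have hxK : x ≤ K := by nlinarith [mul_nonneg hx (sq_nonneg s)]
  have hK : 0 ≤ K := hx.trans hxK
  have hA0 : 0 ≤ om 0 s ^2 := sq_nonneg _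
  refine ⟨e1, e2, ?_, ?_⟩
  · calc x^2 = x * x := by ring
      _ ≤ K * (K * om 0 s ^2) := mul_le_mul hxK e1 hx hK
      _ = _ := by ring
  · calc s * x^2 = x * (s * x) := by ring
      _ ≤ K * (K * om 0 s ^2) := mul_le_mul hxK e2 (by positivity) hK
      _ = _ := by ring

lemma int_om_bound {ℓ K : ℝ} (hl : 0 ≤ ℓ) (hK : 0 ≤ K) {f : ℝ → ℝ} (hf : Continuous f) (h : ∀ s ∈ Icc (0:ℝ) ℓ, f s ≤ K * om 0 s ^2) :
    ∫ s in (0:ℝ)..ℓ, f s ≤ 4 * K := by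
  have com := om_cont 0
  calc ∫ s in (0:ℝ)..ℓ, f s ≤ ∫ s in (0:ℝ)..ℓ, K * om 0 s ^2 :=
        intervalIntegral.integral_mono_on hl (hf.intervalIntegrable _ _) (Continuous.intervalIntegrable (by fun_prop) _ _) h
    _ = K * ∫ s in (0:ℝ)..ℓ, om 0 s ^2 := by rw [intervalIntegral.integral_const_mul]
    _ ≤ K * 4 := by gcongr; exact (om_int 0 0 ℓ).trans Real.pi_le_four
    _ = _ := by ring

set_option maxHeartbeats 1600000 in
lemma corr_base (δ d0 κ0 : ℝ) (hδ : 0 < δ) (hκ0 : 0 ≤ κ0) (hκ01 : κ0 ≤ 1) : ∃ ρ C ℓ0 : ℝ, 0 < ρ ∧ 0 < C ∧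
    ∀ κ ε d ℓ : ℝ, |d - d0| < ρ → |κ - κ0| < ρ → 0 < κ → κ ≤ 1 → 0 ≤ ε → ε ≤ ρ → ℓ0 ≤ ℓ →
    ∃ W W1 W2 : ℝ → ℂ, Corr C δ κ ε d ℓ W W1 W2 := by
  obtain ⟨V, V1, K, hK, dV, dV1, V0, hdec, hJ⟩ := airy_star d0 κ0 hκ0
  have cV : Continuous V := continuous_iff_continuousAt.2 fun x => (dV x).continuousAt
  have cV1 : Continuous V1 := continuous_iff_continuousAt.2 fun x => (dV1 x).continuousAt
  set I0 := ∫ s in Ioi (0:ℝ), V s * ((Real.exp (-κ0*s) : ℝ):ℂ) with hI0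
  set J := ‖I0‖ with hJd
  have hJ0 : 0 < J := norm_pos_iff.2 hJ
  have hintg : IntegrableOn (fun s : ℝ => V s * ((Real.exp (-κ0*s) : ℝ):ℂ)) (Ioi 0) := by
    apply integrable_of_decay4 (K := K) (by fun_prop)
    intro s hs
    refine le_trans ?_ (hdec s hs).1
    rw [norm_mul, Complex.norm_real, Real.norm_eq_abs, abs_of_pos (Real.exp_pos _)]
    have : Real.exp (-κ0*s) ≤ 1 := Real.exp_le_one_iff.2 (by nlinarith)
    gcongr
    nlinarith [norm_nonneg (V s)]
  have hlim := (intervalIntegral_tendsto_integral_Ioi (0:ℝ) hintg tendsto_id).norm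
  have hev := hlim.eventually (lt_mem_nhds (show 3/4*J < ‖∫ s in Ioi (0:ℝ), V s * ((Real.exp (-κ0*s) : ℝ):ℂ)‖ by
    rw [← hI0, ← hJd]; linarith))
  obtain ⟨ℓ1, hℓ1⟩ := eventually_atTop.1 hev
  set K' := 4*(K+1) with hK'
  have hK'0 : 0 < K' := by positivity
  have hKK : 4*K ≤ K' := by linarith
  set τ := min 1 (min (J/(32*K')) (δ*J/(32*K'))) with hτ
  have hτ0 : 0 < τ := by rw [hτ]; positivity
  have t1 : τ ≤ 1 := min_le_left _ _
  have t2 : τ * K' ≤ J/32 := by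
    have : τ ≤ J/(32*K') := (min_le_right _ _).trans (min_le_left _ _)
    rw [le_div_iff₀ (by positivity)] at this; linarith
  have t3 : τ * K' ≤ δ*J/32 := by
    have : τ ≤ δ*J/(32*K') := (min_le_right _ _).trans (min_le_right _ _)
    rw [le_div_iff₀ (by positivity)] at this; linarith
  refine ⟨τ, 2*K'*(2+|d0|)/J + 4*K'^2/J^2, max ℓ1 (1/τ), hτ0, by positivity, ?_⟩
  intro κ ε d ℓ hd hκκ hκ hκ1 he he1 hl
  have hlτ : 1/τ ≤ ℓ := (le_max_right _ _).trans hl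
  have hl0 : 0 < ℓ := lt_of_lt_of_le (by positivity) hlτ
  have hil : 1/ℓ ≤ τ := by
    rw [div_le_iff₀ hτ0] at hlτ
    rw [div_le_iff₀ hl0]; linarith
  have hJl : 3/4*J < ‖∫ s in (0:ℝ)..ℓ, V s * ((Real.exp (-κ0*s) : ℝ):ℂ)‖ := hℓ1 ℓ ((le_max_left _ _).trans hl)
  set χ : ℝ → ℂ := fun s => 1 - (s:ℂ)/(ℓ:ℂ) with hχ
  have dχ : ∀ s, HasDerivAt χ (-(1/(ℓ:ℂ))) s := fun s => by
    have := ((hasDerivAt_id s).ofReal_comp.div_const (ℓ:ℂ)).const_sub 1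
    refine HasDerivAt.congr_deriv this ?_
    simp
  have cχ : Continuous χ := by fun_prop
  have nχ : ∀ s ∈ Icc (0:ℝ) ℓ, ‖χ s‖ ≤ 1 := by
    intro s hs
    have : χ s = ((1 - s/ℓ : ℝ):ℂ) := by simp [hχ]
    rw [this, Complex.norm_real, Real.norm_eq_abs, abs_le]
    have : s/ℓ ≤ 1 := by rw [div_le_one hl0]; exact hs.2
    have : 0 ≤ s/ℓ := div_nonneg hs.1 hl0.le
    constructor <;> linarith
  set W : ℝ → ℂ := fun s => V s * χ s with hW
  set W1 : ℝ → ℂ := fun s => V1 s * χ s + V s * (-(1/(ℓ:ℂ))) with hW1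
  set W2 : ℝ → ℂ := fun s => ((Complex.I * (s + d0) + (κ0:ℂ)^2) * V s) * χ s + V1 s * (-(1/(ℓ:ℂ))) + V1 s * (-(1/(ℓ:ℂ))) with hW2
  have d1 : ∀ s, HasDerivAt W (W1 s) s := fun s => (dV s).mul (dχ s)
  have d2 : ∀ s, HasDerivAt W1 (W2 s) s := fun s => ((dV1 s).mul (dχ s)).add ((dV s).mul_const _)
  have c2 : Continuous W2 := by fun_prop
  have cW : Continuous W := by fun_prop
  have ces := es_cont κ ℓ
  have w0 : W 0 = 1 := by simp [hW, hχ, V0]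
  have wl : W ℓ = 0 := by
    have : (ℓ:ℂ) ≠ 0 := by exact_mod_cast hl0.ne'
    simp [hW, hχ, div_self this]
  have bW : ∀ s ∈ Icc (0:ℝ) ℓ, (1+s)^4*‖W s‖ ≤ K := by
    intro s hs
    refine le_trans ?_ (hdec s hs.1).1
    have h1 := hs.1
    gcongr
    rw [hW]; simp only [norm_mul]
    nlinarith [nχ s hs, norm_nonneg (V s), norm_nonneg (χ s)]
  have hM0 : ∫ s in (0:ℝ)..ℓ, ‖W s‖ ≤ K' := (int_om_bound hl0.le hK (by fun_prop) (fun s hs => (dec_bounds (norm_nonneg _) hs.1 (bW s hs)).1)).trans hKK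
  have hM1 : ∫ s in (0:ℝ)..ℓ, s * ‖W s‖ ≤ K' := (int_om_bound hl0.le hK (by fun_prop) (fun s hs => (dec_bounds (norm_nonneg _) hs.1 (bW s hs)).2.1)).trans hKK
  have hKK2 : 4*K^2 ≤ K'^2 := by nlinarith
  have hM2 : ∫ s in (0:ℝ)..ℓ, ‖W s‖^2 ≤ K'^2 := (int_om_bound hl0.le (sq_nonneg K) (by fun_prop) (fun s hs => (dec_bounds (norm_nonneg _) hs.1 (bW s hs)).2.2.1)).trans hKK2
  have hM3 : ∫ s in (0:ℝ)..ℓ, s * ‖W s‖^2 ≤ K'^2 := (int_om_bound hl0.le (sq_nonneg K) (by fun_prop) (fun s hs => (dec_bounds (norm_nonneg _) hs.1 (bW s hs)).2.2.2)).trans hKK2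
  have hV1 : ∫ s in (0:ℝ)..ℓ, s * ‖V s‖ ≤ K' := (int_om_bound hl0.le hK (by fun_prop) (fun s hs => (dec_bounds (norm_nonneg _) hs.1 (hdec s hs.1).1).2.1)).trans hKK
  set g := ‖∫ s in (0:ℝ)..ℓ, W s * (es κ ℓ s : ℂ)‖ with hg
  have hgJ : J ≤ 2 * g := by
    have e : (∫ s in (0:ℝ)..ℓ, V s * ((Real.exp (-κ0*s) : ℝ):ℂ)) = (∫ s in (0:ℝ)..ℓ, W s * (es κ ℓ s : ℂ)) + ∫ s in (0:ℝ)..ℓ, V s * (((Real.exp (-κ0*s) : ℝ):ℂ) - χ s * (es κ ℓ s : ℂ)) := by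
      rw [← intervalIntegral.integral_add]
      · congr 1; funext s; simp only [hW]; ring
      all_goals apply Continuous.intervalIntegrable; fun_prop
    have n : ‖∫ s in (0:ℝ)..ℓ, V s * (((Real.exp (-κ0*s) : ℝ):ℂ) - χ s * (es κ ℓ s : ℂ))‖ ≤ (3*τ) * K' := by
      refine (intervalIntegral.norm_integral_le_integral_norm hl0.le).trans ?_
      calc _ ≤ ∫ s in (0:ℝ)..ℓ, (3*τ) * (s * ‖V s‖) := by
            apply intervalIntegral.integral_mono_on hl0.le (Continuous.intervalIntegrable (by fun_prop) _ _) (Continuous.intervalIntegrable (by fun_prop) _ _)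
            intro s hs
            have hsl : s/ℓ ≤ τ*s := by
              have := mul_le_mul_of_nonneg_right hil hs.1
              calc s/ℓ = 1/ℓ*s := by ring
                _ ≤ _ := this
            have a1 := exp_sub_es_le hκ hl0 hs.1 hs.2
            have a2 := es_le_exp (s := s) hκ hl0 hs.1
            have a3 := es_nonneg (s := s) hκ hl0 hs.2
            have a4 : Real.exp (-κ*s) ≤ 1 := Real.exp_le_one_iff.2 (by nlinarith [hs.1])
            have a5 := exp_lip (a := κ0*s) (b := κ*s) (mul_nonneg hκ0 hs.1) (mul_nonneg hκ.le hs.1)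
            have a6 : |κ0*s - κ*s| ≤ τ * s := by
              rw [← sub_mul, abs_mul, abs_of_nonneg hs.1, abs_sub_comm]
              exact mul_le_mul_of_nonneg_right hκκ.le hs.1
            have ee : (((Real.exp (-κ0*s) : ℝ):ℂ) - χ s * (es κ ℓ s : ℂ)) = ((Real.exp (-κ0*s) - (1-s/ℓ) * es κ ℓ s : ℝ):ℂ) := by
              simp [hχ]
            have b1 : |Real.exp (-κ0*s) - (1-s/ℓ) * es κ ℓ s| ≤ 3*τ*s := by
              have a7 := abs_le.1 (a5.trans a6)
              rw [neg_mul] at a1 a2 a4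
              rw [neg_mul]
              have b0 : 0 ≤ s/ℓ * es κ ℓ s := mul_nonneg (div_nonneg hs.1 hl0.le) a3
              have b2 : s/ℓ * es κ ℓ s ≤ s/ℓ := mul_le_of_le_one_right (div_nonneg hs.1 hl0.le) (a2.trans a4)
              have : 0 ≤ τ*s := mul_nonneg hτ0.le hs.1
              rw [abs_le]; constructor
              · nlinarith
              · nlinarith
            rw [norm_mul, ee, Complex.norm_real, Real.norm_eq_abs]
            nlinarith [norm_nonneg (V s)]
        _ = (3*τ) * ∫ s in (0:ℝ)..ℓ, s * ‖V s‖ := by rw [intervalIntegral.integral_const_mul]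
        _ ≤ _ := by gcongr
    rw [e] at hJl
    have := norm_add_le (∫ s in (0:ℝ)..ℓ, W s * (es κ ℓ s : ℂ)) (∫ s in (0:ℝ)..ℓ, V s * (((Real.exp (-κ0*s) : ℝ):ℂ) - χ s * (es κ ℓ s : ℂ)))
    rw [← hg] at this
    linarith
  have hg0 : 0 ≤ g := norm_nonneg _
  set C := 2*K'*(2+|d0|)/J + 4*K'^2/J^2 with hC
  have hd0 := abs_nonneg d0
  have C1 : K' * (2+|d0|) ≤ C * g := by
    calc K' * (2+|d0|) = (2*K'*(2+|d0|)/J) * (J/2) := by field_simp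
      _ ≤ C * g := by
        apply mul_le_mul _ (by linarith) (by linarith) (by positivity)
        have : 0 ≤ 4*K'^2/J^2 := by positivity
        linarith
  have C2 : K'^2 ≤ C * g^2 := by
    calc K'^2 = (4*K'^2/J^2) * (J/2)^2 := by field_simp; norm_num
      _ ≤ C * g^2 := by
        apply mul_le_mul _ (by gcongr; linarith) (by positivity) (by positivity)
        have : 0 ≤ 2*K'*(2+|d0|)/J := by positivity
        linarith
  have sD1 : 1 ≤ Real.sqrt (1+|d|) := Real.one_le_sqrt.2 (by linarith [abs_nonneg d])
  have sD2 : Real.sqrt (1+|d|) ≤ 2+|d0| := by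
    have : |d| ≤ |d0| + 1 := by
      have := abs_sub_abs_le_abs_sub d d0
      linarith
    apply Real.sqrt_le_iff.2 ⟨by positivity, by nlinarith⟩
  refine ⟨W, W1, W2, d1, d2, c2, w0, wl, ?_, ?_, ?_, ?_, ?_⟩ <;> rw [← hg]
  · nlinarith
  · have : 0 ≤ C * g^2 := by positivity
    nlinarith
  · calc _ ≤ K' * (2+|d0|) := by gcongr
      _ ≤ _ := C1
  · linarith
  · refine le_trans ?_ (show 6*τ*K' ≤ δ*g by nlinarith)
    have com := om_cont 0
    refine N2_le_of_bound hl0.le (g := fun s => (6*τ*K)^2 * om 0 s^2) (by fun_prop) (by fun_prop) (by positivity) ?_ ?_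
    · intro s hs
      have e : W2 s - ((κ:ℂ)^2 - (ε:ℂ) + Complex.I * ((s+d:ℝ):ℂ)) * W s = ((κ0^2-κ^2+ε:ℝ) + Complex.I * ((d0-d:ℝ):ℂ)) * W s - (2:ℂ) * ((1/ℓ:ℝ):ℂ) * V1 s := by
        simp only [hW2, hW]; push_cast; ring
      have n1 : ‖(((κ0^2-κ^2+ε:ℝ):ℂ) + Complex.I * ((d0-d:ℝ):ℂ))‖ ≤ 4*τ := by
        refine (norm_add_le _ _).trans ?_
        rw [norm_mul, Complex.norm_I, Complex.norm_real, Complex.norm_real, Real.norm_eq_abs, Real.norm_eq_abs, abs_sub_comm d0 d]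
        have : |κ0^2-κ^2+ε| ≤ 3*τ := by
          have := abs_lt.1 hκκ
          rw [abs_le]; constructor <;> nlinarith
        linarith
      have n2 : ‖(2:ℂ) * ((1/ℓ:ℝ):ℂ)‖ ≤ 2*τ := by
        rw [norm_mul, Complex.norm_real, Real.norm_eq_abs, abs_of_pos (by positivity)]
        simp only [Complex.norm_ofNat]; linarith
      rw [e]
      have h1s : 0 < (1+s)^4 := by have := hs.1; positivity
      have hx : (1+s)^4 * ‖((κ0^2-κ^2+ε:ℝ) + Complex.I * ((d0-d:ℝ):ℂ)) * W s - (2:ℂ) * ((1/ℓ:ℝ):ℂ) * V1 s‖ ≤ 6*τ*K := by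
        have := norm_sub_le (((κ0^2-κ^2+ε:ℝ) + Complex.I * ((d0-d:ℝ):ℂ)) * W s) ((2:ℂ) * ((1/ℓ:ℝ):ℂ) * V1 s)
        rw [norm_mul _ (W s), norm_mul _ (V1 s)] at this
        calc _ ≤ (1+s)^4 * (4*τ * ‖W s‖ + 2*τ*‖V1 s‖) := by
              gcongr
              exact this.trans (add_le_add (mul_le_mul_of_nonneg_right n1 (norm_nonneg _)) (mul_le_mul_of_nonneg_right n2 (norm_nonneg _)))
          _ = 4*τ * ((1+s)^4*‖W s‖) + 2*τ * ((1+s)^4 * ‖V1 s‖) := by ring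
          _ ≤ 4*τ * K + 2*τ*K := by
              gcongr
              · exact bW s hs
              · exact (hdec s hs.1).2
          _ = _ := by ring
      exact (dec_bounds (norm_nonneg _) hs.1 hx).2.2.1
    · rw [intervalIntegral.integral_const_mul]
      calc _ ≤ (6*τ*K)^2 * 4 := by gcongr; exact (om_int 0 0 ℓ).trans Real.pi_le_four
        _ = (6*τ*(2*K))^2 := by ring
        _ ≤ (6*τ*K')^2 := by gcongr; linarith

lemma Corr.mono {C C' δ κ ε d ℓ : ℝ} {W W1 W2 : ℝ → ℂ} (h : Corr C δ κ ε d ℓ W W1 W2) (hC : C ≤ C') : Corr C' δ κ ε d ℓ W W1 W2 where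
  d1 := h.d1
  d2 := h.d2
  c2 := h.c2
  w0 := h.w0
  wl := h.wl
  ha := h.ha.trans (by gcongr)
  hb := h.hb.trans (by gcongr)
  hc := h.hc.trans (by gcongr)
  hd := h.hd.trans (by gcongr)
  he := h.he

lemma corr_exists (δ : ℝ) (hδ : 0 < δ) : ∃ C ε0 ℓ0 : ℝ, 0 < C ∧ 0 < ε0 ∧ ∀ κ ε d ℓ : ℝ, 0 < κ → κ ≤ 1 → 2 ≤ κ*ℓ →
    0 ≤ ε → ε ≤ ε0 → ℓ0 ≤ ℓ → ∃ W W1 W2 : ℝ → ℂ, Corr C δ κ ε d ℓ W W1 W2 := by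
  obtain ⟨D0, hD0, hlarge⟩ := corr_large δ hδ
  have hcomp : IsCompact (Icc (-D0) D0 ×ˢ Icc (0:ℝ) 1) := isCompact_Icc.prod isCompact_Icc
  have hsmall := hcomp.induction_on (p := fun S : Set (ℝ × ℝ) => ∃ C ε0 ℓ0 : ℝ, 0 < C ∧ 0 < ε0 ∧ ∀ κ ε d ℓ : ℝ, (d, κ) ∈ S → 0 < κ → κ ≤ 1 →
    0 ≤ ε → ε ≤ ε0 → ℓ0 ≤ ℓ → ∃ W W1 W2 : ℝ → ℂ, Corr C δ κ ε d ℓ W W1 W2)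
    ⟨1, 1, 1, one_pos, one_pos, fun κ ε d ℓ h => absurd h (by simp)⟩
    (by
      rintro S T hST ⟨C, ε0, ℓ0, hC, he, h⟩
      exact ⟨C, ε0, ℓ0, hC, he, fun κ ε d ℓ hm => h κ ε d ℓ (hST hm)⟩)
    (by
      rintro S T ⟨C, ε0, ℓ0, hC, he, h⟩ ⟨C', ε0', ℓ0', hC', he', h'⟩
      refine ⟨max C C', min ε0 ε0', max ℓ0 ℓ0', lt_max_of_lt_left hC, lt_min he he', ?_⟩
      intro κ ε d ℓ hm h1 h2 h3 h4 h5
      rcases hm with hm | hm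
      · obtain ⟨W, W1, W2, hW⟩ := h κ ε d ℓ hm h1 h2 h3 (h4.trans (min_le_left _ _)) ((le_max_left _ _).trans h5)
        exact ⟨W, W1, W2, hW.mono (le_max_left _ _)⟩
      · obtain ⟨W, W1, W2, hW⟩ := h' κ ε d ℓ hm h1 h2 h3 (h4.trans (min_le_right _ _)) ((le_max_right _ _).trans h5)
        exact ⟨W, W1, W2, hW.mono (le_max_right _ _)⟩)
    (by
      rintro ⟨d0, κ0⟩ ⟨_, hκ⟩
      obtain ⟨ρ, C, ℓ0, hρ, hC, h⟩ := corr_base δ d0 κ0 hδ hκ.1 hκ.2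
      refine ⟨Metric.ball (d0, κ0) ρ, mem_nhdsWithin_of_mem_nhds (Metric.ball_mem_nhds _ hρ), C, ρ, ℓ0, hC, hρ, ?_⟩
      intro κ ε d ℓ hm h1 h2 h3 h4 h5
      rw [Metric.mem_ball, Prod.dist_eq, max_lt_iff, Real.dist_eq, Real.dist_eq] at hm
      exact h κ ε d ℓ hm.1 hm.2 h1 h2 h3 h4 h5)
  obtain ⟨C, ε0, ℓ0, hC, he, h⟩ := hsmall
  refine ⟨max C 6000, min ε0 1, ℓ0, lt_max_of_lt_left hC, lt_min he one_pos, ?_⟩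
  intro κ ε d ℓ h1 h2 h3 h4 h5 h6
  rcases le_total D0 |d| with hd | hd
  · obtain ⟨W, W1, W2, hW⟩ := hlarge κ ε d ℓ h1 h2 h3 h4 (h5.trans (min_le_right _ _)) hd
    exact ⟨W, W1, W2, hW.mono (le_max_right _ _)⟩
  · obtain ⟨W, W1, W2, hW⟩ := h κ ε d ℓ ⟨⟨(abs_le.1 hd).1, (abs_le.1 hd).2⟩, ⟨h1.le, h2⟩⟩ h1 h2 h4 (h5.trans (min_le_left _ _)) h6
    exact ⟨W, W1, W2, hW.mono (le_max_left _ _)⟩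

/-- reflected conjugate -/
noncomputable def rf (ℓ : ℝ) (f : ℝ → ℂ) : ℝ → ℂ := fun s => (starRingEnd ℂ) (f (ℓ - s))

lemma rf_deriv {ℓ : ℝ} {f f1 : ℝ → ℂ} (h : ∀ x, HasDerivAt f (f1 x) x) (x : ℝ) : HasDerivAt (rf ℓ f) (-(rf ℓ f1 x)) x := by
  have h0 : HasDerivAt (fun s : ℝ => ℓ - s) (-1) x := (hasDerivAt_id x).const_sub ℓ
  have h1 := (h (ℓ - x)).scomp x h0
  have h2 := (Complex.conjCLE.toContinuousLinearMap.hasFDerivAt.comp_hasDerivAt x h1)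
  refine HasDerivAt.congr_deriv h2 ?_
  simp [rf]
lemma rf_cont {ℓ : ℝ} {f : ℝ → ℂ} (h : Continuous f) : Continuous (rf ℓ f) := by
  unfold rf
  fun_prop
lemma rf_int (ℓ : ℝ) (f : ℝ → ℂ) : ∫ s in (0:ℝ)..ℓ, rf ℓ f s = (starRingEnd ℂ) (∫ s in (0:ℝ)..ℓ, f s) := by
  unfold rf
  have := intervalIntegral.integral_comp_sub_left (a := 0) (b := ℓ) (fun s => (starRingEnd ℂ) (f s)) ℓ
  rw [this, sub_self, sub_zero]
  rw [intervalIntegral.intervalIntegral_eq_integral_uIoc, intervalIntegral.intervalIntegral_eq_integral_uIoc, integral_conj]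
  split_ifs <;> simp
lemma int_reflect (ℓ : ℝ) (f : ℝ → ℝ) : ∫ s in (0:ℝ)..ℓ, f (ℓ - s) = ∫ s in (0:ℝ)..ℓ, f s := by
  rw [intervalIntegral.integral_comp_sub_left, sub_self, sub_zero]
lemma N2_rf (ℓ : ℝ) (f : ℝ → ℂ) : N2 0 ℓ (rf ℓ f) = N2 0 ℓ f := by
  unfold N2 rf
  simp only [RCLike.norm_conj]
  rw [int_reflect ℓ (fun s => ‖f s‖^2)]
lemma N2_neg (a b : ℝ) (f : ℝ → ℂ) : N2 a b (fun x => -f x) = N2 a b f := by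
  unfold N2; simp

lemma Dom_rf {ℓ m : ℝ} {G : ℝ → ℂ} (h : Dom 0 ℓ G m) : Dom 0 ℓ (rf ℓ G) m := by
  intro p p1 hp cp1 p0 pl
  have h1 := h (rf ℓ p) (fun x => -(rf ℓ p1 x)) (rf_deriv hp) (rf_cont cp1).neg (by simp [rf, pl]) (by simp [rf, p0])
  rw [N2_neg, N2_rf, N2_rf] at h1
  have e : ∫ s in (0:ℝ)..ℓ, rf ℓ G s * (starRingEnd ℂ) (p s) = (starRingEnd ℂ) (∫ s in (0:ℝ)..ℓ, G s * (starRingEnd ℂ) (rf ℓ p s)) := by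
    rw [← rf_int]; congr 1; funext s; simp [rf]
  rw [e, RCLike.norm_conj]; exact h1

lemma Res.reflect {ℓ Λ c ε : ℝ} {v v1 v2 G : ℝ → ℂ} (h : Res 0 ℓ Λ c ε v v1 v2 G) :
    Res 0 ℓ (ℓ-Λ) c ε (rf ℓ v) (fun x => -(rf ℓ v1 x)) (rf ℓ v2) (rf ℓ G) where
  hab := h.hab
  hc := h.hc
  hc1 := h.hc1
  he := h.he
  he1 := h.he1
  d1 := rf_deriv h.d1
  d2 := fun x => by
    have := (rf_deriv (ℓ := ℓ) h.d2 x).neg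
    rw [neg_neg] at this; exact this
  c2 := rf_cont h.c2
  va := by simp [rf, h.vb]
  vb := by simp [rf, h.va]
  hG := fun x => by
    simp only [rf, h.hG]
    simp only [map_add, map_sub, map_mul, map_neg, Complex.conj_ofReal, Complex.conj_I]
    push_cast; ring

lemma v_pointwise {ℓ : ℝ} {v v1 : ℝ → ℂ} (d1 : ∀ x, HasDerivAt v (v1 x) x) (c1 : Continuous v1) (v0 : v 0 = 0) {s : ℝ} (hs : s ∈ Icc (0:ℝ) ℓ) :
    ‖v s‖ ≤ Real.sqrt s * N2 0 ℓ v1 := by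
  have e : v s = ∫ x in (0:ℝ)..s, v1 x := by
    rw [intervalIntegral.integral_eq_sub_of_hasDerivAt (fun x _ => d1 x) (c1.intervalIntegrable _ _), v0, sub_zero]
  have e2 := cs_real hs.1 (f := fun _ => 1) (g := fun x => ‖v1 x‖) continuous_const c1.norm
  simp only [one_mul, one_pow, intervalIntegral.integral_const, sub_zero, smul_eq_mul, mul_one] at e2
  have e3 : Real.sqrt (∫ x in (0:ℝ)..s, ‖v1 x‖^2) ≤ N2 0 ℓ v1 := by
    apply Real.sqrt_le_sqrt
    apply intervalIntegral.integral_mono_interval le_rfl hs.1 hs.2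
    · exact Filter.Eventually.of_forall fun x => by positivity
    · exact (c1.norm.pow 2).intervalIntegrable _ _
  rw [e]
  refine (intervalIntegral.norm_integral_le_integral_norm hs.1).trans (e2.trans ?_)
  gcongr

lemma om_exp_bound {Λ ℓ r : ℝ} (hl : 0 ≤ ℓ) (hr : 0 < r) :
    ∫ s in (0:ℝ)..ℓ, (om Λ s * Real.exp (-r*s))^2 ≤ 4/((1+|Λ|)^2*r) + 4 * Real.exp (-r*|Λ|) := by
  have com := om_cont Λ
  have hD : 0 < 1+|Λ| := by positivity
  have pt : ∀ s ∈ Icc (0:ℝ) ℓ, (om Λ s * Real.exp (-r*s))^2 ≤ 8/(1+|Λ|)^2 * Real.exp (-(2*r)*s) + Real.exp (-r*|Λ|) * om Λ s^2 := by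
    intro s hs
    have e : (Real.exp (-r*s))^2 = Real.exp (-(2*r)*s) := by rw [pow_two, ← Real.exp_add]; ring_nf
    rw [mul_pow, e]
    have hp := Real.exp_pos (-(2*r)*s)
    have hq := Real.exp_pos (-r*|Λ|)
    have ho := sq_nonneg (om Λ s)
    by_cases hc : |Λ|/2 ≤ s
    · have : Real.exp (-(2*r)*s) ≤ Real.exp (-r*|Λ|) := Real.exp_le_exp.2 (by nlinarith)
      have : 0 ≤ 8/(1+|Λ|)^2 * Real.exp (-(2*r)*s) := by positivity
      nlinarith
    · push Not at hc
      have : om Λ s^2 ≤ 8/(1+|Λ|)^2 := by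
        rw [om_sq, inv_eq_one_div, div_le_div_iff₀ (by positivity) (by positivity)]
        have h1 : (|Λ|/2)^2 ≤ (s-Λ)^2 := by
          rw [← sq_abs (s-Λ)]
          have := abs_sub_abs_le_abs_sub Λ s
          rw [abs_of_nonneg hs.1, abs_sub_comm] at this
          apply pow_le_pow_left₀ (by positivity)
          linarith
        nlinarith [sq_nonneg (|Λ|-1)]
      have : 0 ≤ Real.exp (-r*|Λ|) * om Λ s^2 := by positivity
      nlinarith
  calc _ ≤ ∫ s in (0:ℝ)..ℓ, (8/(1+|Λ|)^2 * Real.exp (-(2*r)*s) + Real.exp (-r*|Λ|) * om Λ s^2) :=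
        intervalIntegral.integral_mono_on hl (Continuous.intervalIntegrable (by fun_prop) _ _) (Continuous.intervalIntegrable (by fun_prop) _ _) pt
    _ = 8/(1+|Λ|)^2 * (∫ s in (0:ℝ)..ℓ, Real.exp (-(2*r)*s)) + Real.exp (-r*|Λ|) * ∫ s in (0:ℝ)..ℓ, om Λ s^2 := by
        rw [intervalIntegral.integral_add, intervalIntegral.integral_const_mul, intervalIntegral.integral_const_mul]
        all_goals apply Continuous.intervalIntegrable; fun_prop
    _ ≤ 8/(1+|Λ|)^2 * (1/(2*r)) + Real.exp (-r*|Λ|) * 4 := by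
        gcongr
        · exact exp_int0 (by positivity) hl
        · exact (om_int Λ 0 ℓ).trans Real.pi_le_four
    _ = _ := by field_simp; ring

/-- general splitting bound for the pairing with `es` -/
lemma pair_split {ℓ Λ κ c ε m τ t : ℝ} {v v1 v2 G : ℝ → ℂ} (h : Res 0 ℓ Λ c ε v v1 v2 G) (hm : 0 ≤ m) (hD : Dom 0 ℓ G m)
    (hκ : 0 < κ) (hκ1 : κ ≤ 1) (hkl : 2 ≤ κ*ℓ) (ht : 1 ≤ t) (hτ : τ = t^2) :
    ‖∫ s in (0:ℝ)..ℓ, v s * (es κ ℓ s : ℂ)‖ ≤ 300*m*(4 * Real.sqrt (∫ s in (0:ℝ)..ℓ, (om Λ s * Real.exp (-κ*s))^2)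
      + τ * Real.sqrt (∫ s in (0:ℝ)..ℓ, (om Λ s * Real.exp (-τ*s))^2)) + 26*m/t^3 := by
  have hl0 : 0 < ℓ := by nlinarith
  have ht0 : 0 < t := by linarith
  have hτ0 : 0 < τ := by rw [hτ]; positivity
  have com := om_cont Λ
  have ces := es_cont κ ℓ
  have ces1 := es1_cont κ ℓ
  have cv := h.cv
  set f : ℝ → ℝ := fun s => es κ ℓ s * (1 - Real.exp (-τ*s)) with hf
  set f1 : ℝ → ℝ := fun s => es1 κ ℓ s * (1 - Real.exp (-τ*s)) + es κ ℓ s * (τ * Real.exp (-τ*s)) with hf1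
  have df : ∀ s, HasDerivAt f (f1 s) s := fun s => by
    have h0 : HasDerivAt (fun s : ℝ => -τ*s) (-τ) s := by simpa using (hasDerivAt_id s).const_mul (-τ)
    have := (es_deriv κ ℓ s).mul (h0.exp.const_sub 1)
    refine HasDerivAt.congr_deriv this ?_
    simp only [hf1]; ring
  have cf : Continuous f := by fun_prop
  have cf1 : Continuous f1 := by fun_prop
  have e1 : ∫ s in (0:ℝ)..ℓ, v s * (es κ ℓ s : ℂ) = (∫ s in (0:ℝ)..ℓ, v s * (starRingEnd ℂ) (f s : ℂ)) + ∫ s in (0:ℝ)..ℓ, v s * ((es κ ℓ s * Real.exp (-τ*s) : ℝ):ℂ) := by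
    rw [← intervalIntegral.integral_add]
    · congr 1; funext s; simp only [hf, Complex.conj_ofReal]; push_cast; ring
    all_goals apply Continuous.intervalIntegrable; fun_prop
  have b1 := h.pairing hm hD (f := fun s => (f s:ℂ)) (f1 := fun s => (f1 s:ℂ)) (fun s => (df s).ofReal_comp) (by fun_prop) (by simp [hf]) (by simp [hf, es_end])
  set A := Real.sqrt (∫ s in (0:ℝ)..ℓ, (om Λ s * Real.exp (-κ*s))^2) with hA
  set B := Real.sqrt (∫ s in (0:ℝ)..ℓ, (om Λ s * Real.exp (-τ*s))^2) with hB
  have hA' : N2 0 ℓ (fun s => (om Λ s : ℂ) * (Real.exp (-κ*s) : ℂ)) = A := by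
    unfold N2; rw [hA]; congr 2; funext s
    beta_reduce
    rw [← Complex.ofReal_mul, Complex.norm_real, Real.norm_eq_abs, sq_abs]
  have hB' : N2 0 ℓ (fun s => (om Λ s : ℂ) * (Real.exp (-τ*s) : ℂ)) = B := by
    unfold N2; rw [hB]; congr 2; funext s
    beta_reduce
    rw [← Complex.ofReal_mul, Complex.norm_real, Real.norm_eq_abs, sq_abs]
  have pe : ∀ s ∈ Icc (0:ℝ) ℓ, 0 ≤ 1 - Real.exp (-τ*s) ∧ 1 - Real.exp (-τ*s) ≤ 1 := by
    intro s hs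
    have : Real.exp (-τ*s) ≤ 1 := Real.exp_le_one_iff.2 (by nlinarith [hs.1])
    have := Real.exp_pos (-τ*s)
    constructor <;> linarith
  have bf : ∀ s ∈ Icc (0:ℝ) ℓ, |f s| ≤ Real.exp (-κ*s) := by
    intro s hs
    have a0 := es_nonneg hκ hl0 hs.2
    have a1 := es_le_exp hκ hl0 hs.1
    obtain ⟨p0, p1⟩ := pe s hs
    simp only [hf]
    rw [abs_of_nonneg (mul_nonneg a0 p0)]
    nlinarith
  have bf1 : ∀ s ∈ Icc (0:ℝ) ℓ, |f1 s| ≤ 3 * Real.exp (-κ*s) + τ * Real.exp (-τ*s) := by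
    intro s hs
    have a0 := es_nonneg hκ hl0 hs.2
    have a1 := es_le_exp hκ hl0 hs.1
    have a2 := es1_abs hκ hkl hs.2
    have a3 : Real.exp (-κ*s) ≤ 1 := Real.exp_le_one_iff.2 (by nlinarith [hs.1])
    obtain ⟨p0, p1⟩ := pe s hs
    have q := Real.exp_pos (-κ*s)
    have q2 := Real.exp_pos (-τ*s)
    simp only [hf1]
    refine (abs_add_le _ _).trans (add_le_add ?_ ?_)
    · rw [abs_mul, abs_of_nonneg p0]
      have : |es1 κ ℓ s| ≤ 3 * Real.exp (-κ*s) := a2.trans (by nlinarith)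
      nlinarith [abs_nonneg (es1 κ ℓ s)]
    · rw [abs_of_nonneg (by positivity)]
      exact mul_le_of_le_one_left (by positivity) (a1.trans a3)
  have n1 : N2 0 ℓ (fun x => (om Λ x:ℂ) * (f x:ℂ)) ≤ A := by
    rw [← hA']
    apply N2_mono hl0.le (by fun_prop) (by fun_prop)
    intro s hs
    rw [norm_mul, norm_mul, Complex.norm_real, Complex.norm_real, Complex.norm_real, Real.norm_eq_abs (f s), Real.norm_of_nonneg (Real.exp_pos _).le]
    gcongr
    exact bf s hs
  have n2 : N2 0 ℓ (fun x => (om Λ x:ℂ) * (f1 x:ℂ)) ≤ 3*A + τ*B := by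
    have s1 : N2 0 ℓ (fun x => (om Λ x:ℂ) * (f1 x:ℂ)) ≤ N2 0 ℓ (fun s => (3:ℂ) * ((om Λ s : ℂ) * (Real.exp (-κ*s) : ℂ)) + (τ:ℂ) * ((om Λ s : ℂ) * (Real.exp (-τ*s) : ℂ))) := by
      apply N2_mono hl0.le (by fun_prop) (by fun_prop)
      intro s hs
      have : (3:ℂ) * ((om Λ s : ℂ) * (Real.exp (-κ*s) : ℂ)) + (τ:ℂ) * ((om Λ s : ℂ) * (Real.exp (-τ*s) : ℂ)) = (om Λ s : ℂ) * ((3 * Real.exp (-κ*s) + τ * Real.exp (-τ*s) : ℝ):ℂ) := by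
        push_cast; ring
      rw [this, norm_mul, norm_mul, Complex.norm_real, Complex.norm_real, Complex.norm_real, Real.norm_eq_abs (f1 s)]
      gcongr
      exact (bf1 s hs).trans (le_abs_self _)
    refine s1.trans ((N2_add hl0.le (by fun_prop) (by fun_prop)).trans ?_)
    rw [N2_smul, N2_smul, hA', hB', Complex.norm_real, Real.norm_of_nonneg hτ0.le]
    simp
  obtain ⟨hQ, hP⟩ := h.step1 hm hD
  have b2 : ‖∫ s in (0:ℝ)..ℓ, v s * ((es κ ℓ s * Real.exp (-τ*s) : ℝ):ℂ)‖ ≤ 26*m/t^3 := by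
    refine (intervalIntegral.norm_integral_le_integral_norm hl0.le).trans ?_
    calc _ ≤ ∫ s in (0:ℝ)..ℓ, (13*m) * ((1/t) * Real.exp (-τ*s) + t * (s * Real.exp (-τ*s))) := by
          apply intervalIntegral.integral_mono_on hl0.le (Continuous.intervalIntegrable (by fun_prop) _ _) (Continuous.intervalIntegrable (by fun_prop) _ _)
          intro s hs
          have a0 := es_nonneg hκ hl0 hs.2
          have a1 := es_le_exp hκ hl0 hs.1
          have a3 : Real.exp (-κ*s) ≤ 1 := Real.exp_le_one_iff.2 (by nlinarith [hs.1])
          have q2 := Real.exp_pos (-τ*s)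
          have vp := v_pointwise h.d1 h.c1 h.va hs
          rw [norm_mul, Complex.norm_real, Real.norm_of_nonneg (by positivity)]
          have r1 : Real.sqrt s ≤ (1/2) * (1/t + t*s) := by
            have ss := Real.sq_sqrt hs.1
            have : 0 ≤ (1 - t * Real.sqrt s)^2 := sq_nonneg _
            have e : (1/2) * (1/t + t*s) - Real.sqrt s = (1 - t * Real.sqrt s)^2/(2*t) := by
              field_simp
              nlinarith
            have : 0 ≤ (1 - t * Real.sqrt s)^2/(2*t) := by positivity
            linarith
          have r2 : ‖v s‖ ≤ ((1/2) * (1/t + t*s)) * (26*m) := vp.trans (mul_le_mul r1 hP (N2_nonneg _ _ _) (by have := hs.1; positivity))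
          have r3 : es κ ℓ s * Real.exp (-τ*s) ≤ Real.exp (-τ*s) := mul_le_of_le_one_left q2.le (a1.trans a3)
          calc _ ≤ (((1/2) * (1/t + t*s)) * (26*m)) * Real.exp (-τ*s) := mul_le_mul r2 r3 (by positivity) (by have := hs.1; positivity)
            _ = _ := by ring
      _ = (13*m) * ((1/t) * (∫ s in (0:ℝ)..ℓ, Real.exp (-τ*s)) + t * ∫ s in (0:ℝ)..ℓ, s * Real.exp (-τ*s)) := by
          rw [intervalIntegral.integral_const_mul, intervalIntegral.integral_add, intervalIntegral.integral_const_mul, intervalIntegral.integral_const_mul]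
          all_goals apply Continuous.intervalIntegrable; fun_prop
      _ ≤ (13*m) * ((1/t) * (1/τ) + t * (1/τ^2)) := by
          gcongr
          · exact exp_int0 hτ0 hl0.le
          · exact exp_int1 hτ0 hl0.le
      _ = _ := by rw [hτ]; field_simp; ring
  rw [e1]
  refine (norm_add_le _ _).trans (add_le_add (b1.trans ?_) b2)
  apply mul_le_mul_of_nonneg_left _ (by positivity)
  linarith

lemma left_A {ℓ Λ κ c ε m : ℝ} {v v1 v2 G : ℝ → ℂ} (h : Res 0 ℓ Λ c ε v v1 v2 G) (hm : 0 ≤ m) (hD : Dom 0 ℓ G m)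
    (hκ : 0 < κ) (hκ1 : κ ≤ 1) (hkl : 2 ≤ κ*ℓ) :
    ‖∫ s in (0:ℝ)..ℓ, v s * (es κ ℓ s : ℂ)‖ ≤ 6100*m := by
  have hl0 : 0 < ℓ := by nlinarith
  have com := om_cont Λ
  have hb : ∀ r : ℝ, 0 < r → Real.sqrt (∫ s in (0:ℝ)..ℓ, (om Λ s * Real.exp (-r*s))^2) ≤ 2 := by
    intro r hr
    apply Real.sqrt_le_iff.2 ⟨by norm_num, ?_⟩
    calc _ ≤ ∫ s in (0:ℝ)..ℓ, om Λ s^2 := by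
          apply intervalIntegral.integral_mono_on hl0.le (Continuous.intervalIntegrable (by fun_prop) _ _) (Continuous.intervalIntegrable (by fun_prop) _ _)
          intro s hs
          have : Real.exp (-r*s) ≤ 1 := Real.exp_le_one_iff.2 (by nlinarith [hs.1])
          have := Real.exp_pos (-r*s)
          have := om_nonneg Λ s
          gcongr
          nlinarith
      _ ≤ 4 := (om_int Λ 0 ℓ).trans Real.pi_le_four
      _ = _ := by norm_num
  have := pair_split h hm hD hκ hκ1 hkl (le_refl (1:ℝ)) (τ := 1) (by norm_num)
  have h1 := hb κ hκ
  have h2 := hb 1 one_pos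
  have : 300*m*(4 * Real.sqrt (∫ s in (0:ℝ)..ℓ, (om Λ s * Real.exp (-κ*s))^2)
      + 1 * Real.sqrt (∫ s in (0:ℝ)..ℓ, (om Λ s * Real.exp (-1*s))^2)) ≤ 300*m*(4*2+1*2) := by gcongr
  norm_num at *
  linarith

lemma left_B {ℓ Λ κ c ε m k4 z : ℝ} {v v1 v2 G : ℝ → ℂ} (h : Res 0 ℓ Λ c ε v v1 v2 G) (hm : 0 ≤ m) (hD : Dom 0 ℓ G m)
    (hκ : 0 < κ) (hκ1 : κ ≤ 1) (hkl : 2 ≤ κ*ℓ) (hk4 : 0 < k4) (hk : k4^4 = κ) (hz0 : 0 < z) (hz : z^4 = 1+|Λ|) (hDk : 1 ≤ z*k4) :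
    z * k4 * ‖∫ s in (0:ℝ)..ℓ, v s * (es κ ℓ s : ℂ)‖ ≤ 6100*m := by
  have hl0 : 0 < ℓ := by nlinarith
  have hz1 : 1 ≤ z := by
    have : (1:ℝ) ≤ z^4 := by rw [hz]; linarith [abs_nonneg Λ]
    exact (one_le_pow_iff_of_nonneg hz0.le (by norm_num)).1 this
  have hk41 : k4 ≤ 1 := by
    rw [← hk] at hκ1
    exact (pow_le_one_iff_of_nonneg hk4.le (by norm_num)).1 hκ1
  set y := z*k4 with hy
  have hyz : y ≤ z := mul_le_of_le_one_right hz0.le hk41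
  have hy4 : y^4 = κ * (1+|Λ|) := by rw [hy, mul_pow, hz, hk]; ring
  have hy2 : y^2 ≤ y^4 := by nlinarith [sq_nonneg (y^2), one_le_pow₀ hDk (n := 2)]
  have b1 : Real.sqrt (∫ s in (0:ℝ)..ℓ, (om Λ s * Real.exp (-κ*s))^2) ≤ 4/y := by
    apply Real.sqrt_le_iff.2 ⟨by positivity, ?_⟩
    refine (om_exp_bound hl0.le hκ).trans ?_
    have i1 : 4/((1+|Λ|)^2*κ) ≤ 4/y^4 := by
      rw [hy4]; gcongr 4/?_
      have := abs_nonneg Λ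
      nlinarith [mul_nonneg hκ.le this]
    have i2 : Real.exp (-κ*|Λ|) ≤ 3/y^4 := by
      have e : Real.exp (-κ*|Λ|) = Real.exp κ * Real.exp (-(y^4)) := by rw [hy4, ← Real.exp_add]; ring_nf
      have e1 : Real.exp κ ≤ 3 := by
        have : Real.exp κ ≤ Real.exp 1 := Real.exp_le_exp.2 hκ1
        linarith [Real.exp_one_lt_d9]
      have e2 : Real.exp (-(y^4)) ≤ 1/y^4 := by
        rw [Real.exp_neg, ← one_div]
        gcongr 1/?_
        linarith [Real.add_one_le_exp (y^4)]
      rw [e]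
      calc _ ≤ 3 * (1/y^4) := by gcongr
        _ = _ := by ring
    calc _ ≤ 4/y^4 + 4*(3/y^4) := by gcongr
      _ = 16/y^4 := by ring
      _ ≤ 16/y^2 := by gcongr
      _ = (4/y)^2 := by field_simp; norm_num
  have b2 : z^2 * Real.sqrt (∫ s in (0:ℝ)..ℓ, (om Λ s * Real.exp (-(z^2)*s))^2) ≤ 4/z := by
    have : Real.sqrt (∫ s in (0:ℝ)..ℓ, (om Λ s * Real.exp (-(z^2)*s))^2) ≤ 4/z^3 := by
      apply Real.sqrt_le_iff.2 ⟨by positivity, ?_⟩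
      refine (om_exp_bound hl0.le (by positivity)).trans ?_
      rw [← hz]
      have i1 : 4/((z^4)^2*z^2) ≤ 4/z^6 := by
        gcongr 4/?_
        calc z^6 ≤ z^10 := pow_le_pow_right₀ hz1 (by norm_num)
          _ = _ := by ring
      have i2 : Real.exp (-(z^2)*|Λ|) ≤ 2/z^6 := by
        have e : -(z^2)*|Λ| = -(z^6-z^2) := by
          have : |Λ| = z^4-1 := by linarith
          rw [this]; ring
        rw [e, Real.exp_neg, ← one_div, div_le_div_iff₀ (Real.exp_pos _) (by positivity)]
        have := Real.add_one_le_exp (z^6-z^2)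
        have hz2 : 1 ≤ z^2 := one_le_pow₀ hz1
        have : z^6 = z^2*z^2*z^2 := by ring
        nlinarith [mul_nonneg (sub_nonneg.2 hz2) (sub_nonneg.2 hz2), mul_nonneg (mul_nonneg (sub_nonneg.2 hz2) (sub_nonneg.2 hz2)) (sub_nonneg.2 hz2)]
      calc _ ≤ 4/z^6 + 4*(2/z^6) := by gcongr
        _ = 12/z^6 := by ring
        _ ≤ 16/z^6 := by gcongr; norm_num
        _ = (4/z^3)^2 := by field_simp; norm_num
    calc _ ≤ z^2*(4/z^3) := by gcongr
      _ = _ := by field_simp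
  have := pair_split h hm hD hκ hκ1 hkl hz1 (τ := z^2) rfl
  have hz3 : 1/z^3 ≤ 1/z := by
    gcongr 1/?_
    calc z = z^1 := by ring
      _ ≤ _ := pow_le_pow_right₀ hz1 (by norm_num)
  have hzy : 1/z ≤ 1/y := by gcongr
  have hfin : ‖∫ s in (0:ℝ)..ℓ, v s * (es κ ℓ s : ℂ)‖ ≤ 300*m*(4*(4/y) + 4/z) + 26*m/z^3 := by
    refine this.trans ?_
    gcongr
  calc _ ≤ y * (300*m*(4*(4/y) + 4*(1/z)) + 26*m*(1/z^3)) := by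
        gcongr
        refine hfin.trans (le_of_eq ?_); ring
    _ ≤ y * (300*m*(4*(4/y) + 4*(1/y)) + 26*m*(1/y)) := by
        have := hz3.trans hzy
        apply mul_le_mul_of_nonneg_left _ (by positivity)
        apply add_le_add
        · apply mul_le_mul_of_nonneg_left (by linarith) (by positivity)
        · apply mul_le_mul_of_nonneg_left (by linarith) (by positivity)
    _ = 6026 * m := by field_simp; norm_num
    _ ≤ _ := by linarith

/-- orthogonality to the decaying solution of `f'' = κ² f` -/
lemma orth {ℓ κ : ℝ} {w Φ Φ1 : ℝ → ℂ} (cw : Continuous w) (hΦ : ∀ x, HasDerivAt Φ (Φ1 x) x)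
    (hΦ1 : ∀ x, HasDerivAt Φ1 (w x + (κ:ℂ)^2 * Φ x) x) (a0 : Φ 0 = 0) (al : Φ ℓ = 0) (b0 : Φ1 0 = 0) (bl : Φ1 ℓ = 0) :
    ∫ s in (0:ℝ)..ℓ, w s * (es κ ℓ s : ℂ) = 0 := by
  have ces := es_cont κ ℓ
  have hd : ∀ x, HasDerivAt (fun s => Φ1 s * (es κ ℓ s : ℂ) - Φ s * (es1 κ ℓ s : ℂ)) (w x * (es κ ℓ x : ℂ)) x := by
    intro x
    have := ((hΦ1 x).mul (es_deriv κ ℓ x).ofReal_comp).sub ((hΦ x).mul (es1_deriv κ ℓ x).ofReal_comp)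
    refine HasDerivAt.congr_deriv this ?_
    push_cast; ring
  rw [intervalIntegral.integral_eq_sub_of_hasDerivAt (fun x _ => hd x) (Continuous.intervalIntegrable (by fun_prop) _ _)]
  simp [a0, al, b0, bl]

lemma Corr.cw {C δ κ ε d ℓ : ℝ} {W W1 W2 : ℝ → ℂ} (h : Corr C δ κ ε d ℓ W W1 W2) : Continuous W :=
  continuous_iff_continuousAt.2 fun x => (h.d1 x).continuousAt

lemma cross_bound {C δ κ ε d ℓ : ℝ} {W W1 W2 : ℝ → ℂ} (h : Corr C δ κ ε d ℓ W W1 W2) (hκ : 0 < κ) (hl : 0 < ℓ) :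
    ‖∫ s in (0:ℝ)..ℓ, rf ℓ W s * (es κ ℓ s : ℂ)‖ * (ℓ * Real.sqrt (1+|d|)) ≤ C * ‖∫ s in (0:ℝ)..ℓ, W s * (es κ ℓ s : ℂ)‖ := by
  have cw := h.cw
  have ces := es_cont κ ℓ
  have h1 : ‖∫ s in (0:ℝ)..ℓ, rf ℓ W s * (es κ ℓ s : ℂ)‖ ≤ (1/ℓ) * ∫ s in (0:ℝ)..ℓ, s * ‖W s‖ := by
    calc _ ≤ ∫ s in (0:ℝ)..ℓ, ‖rf ℓ W s * (es κ ℓ s : ℂ)‖ := intervalIntegral.norm_integral_le_integral_norm hl.le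
      _ = ∫ s in (0:ℝ)..ℓ, ‖W (ℓ - s)‖ * |es κ ℓ (ℓ - (ℓ - s))| := by
          congr 1; funext s; simp [rf, Complex.norm_real]
      _ = ∫ s in (0:ℝ)..ℓ, ‖W s‖ * |es κ ℓ (ℓ - s)| := int_reflect ℓ (fun s => ‖W s‖ * |es κ ℓ (ℓ - s)|)
      _ ≤ ∫ s in (0:ℝ)..ℓ, (1/ℓ) * (s * ‖W s‖) := by
          apply intervalIntegral.integral_mono_on hl.le (Continuous.intervalIntegrable (by fun_prop) _ _) (Continuous.intervalIntegrable (by fun_prop) _ _)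
          intro s hs
          have p := es_refl_le hκ hl hs.1 hs.2
          rw [abs_of_nonneg (es_nonneg hκ hl (by linarith [hs.1]))]
          calc _ ≤ ‖W s‖ * (s/ℓ) := by gcongr
            _ = _ := by ring
      _ = _ := by rw [intervalIntegral.integral_const_mul]
  calc _ ≤ ((1/ℓ) * ∫ s in (0:ℝ)..ℓ, s * ‖W s‖) * (ℓ * Real.sqrt (1+|d|)) := by gcongr
    _ = (∫ s in (0:ℝ)..ℓ, s * ‖W s‖) * Real.sqrt (1+|d|) := by field_simp
    _ ≤ _ := h.hc

/-- left boundary coefficient estimates -/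
lemma left_est {C δ κ ε ℓ Λ m dL dR k4 z : ℝ} {w v v1 v2 G WL WL1 WL2 W W1 W2 : ℝ → ℂ} {a b : ℂ}
    (h : Res 0 ℓ Λ (κ^2) ε v v1 v2 G) (hm : 0 ≤ m) (hD : Dom 0 ℓ G m)
    (hκ : 0 < κ) (hκ1 : κ ≤ 1) (hkl : 2 ≤ κ*ℓ) (hl1 : 1 ≤ ℓ) (hC : 0 ≤ C)
    (cL : Corr C δ κ ε dL ℓ WL WL1 WL2) (cR : Corr C δ κ ε dR ℓ W W1 W2) (hdR : |Λ| ≤ ℓ + |dR|)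
    (hw : ∀ s, w s = v s + b * WL s + a * rf ℓ W s) (ho : ∫ s in (0:ℝ)..ℓ, w s * (es κ ℓ s : ℂ) = 0)
    (hk4 : 0 < k4) (hk : k4^4 = κ) (hz0 : 0 < z) (hz : z^4 = 1+|Λ|) :
    ‖b‖ * ‖∫ s in (0:ℝ)..ℓ, WL s * (es κ ℓ s : ℂ)‖ ≤ 6100 * m + C/ℓ * (‖a‖ * ‖∫ s in (0:ℝ)..ℓ, W s * (es κ ℓ s : ℂ)‖) ∧
    z * k4 * (‖b‖ * ‖∫ s in (0:ℝ)..ℓ, WL s * (es κ ℓ s : ℂ)‖) ≤ 6100 * m + 2*C* (‖a‖ * ‖∫ s in (0:ℝ)..ℓ, W s * (es κ ℓ s : ℂ)‖)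
      + ‖b‖ * ‖∫ s in (0:ℝ)..ℓ, WL s * (es κ ℓ s : ℂ)‖ := by
  have hl0 : 0 < ℓ := by linarith
  have ces := es_cont κ ℓ
  have cv := h.cv
  have cwl := cL.cw
  have crf : Continuous (rf ℓ W) := rf_cont cR.cw
  have e : (∫ s in (0:ℝ)..ℓ, v s * (es κ ℓ s : ℂ)) + b * (∫ s in (0:ℝ)..ℓ, WL s * (es κ ℓ s : ℂ)) + a * (∫ s in (0:ℝ)..ℓ, rf ℓ W s * (es κ ℓ s : ℂ)) = 0 := by
    rw [← ho, ← intervalIntegral.integral_const_mul, ← intervalIntegral.integral_const_mul, ← intervalIntegral.integral_add, ← intervalIntegral.integral_add]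
    · congr 1; funext s; rw [hw]; ring
    all_goals apply Continuous.intervalIntegrable; fun_prop
  have cb := cross_bound cR hκ hl0
  set gL := ∫ s in (0:ℝ)..ℓ, WL s * (es κ ℓ s : ℂ)
  set gR := ∫ s in (0:ℝ)..ℓ, W s * (es κ ℓ s : ℂ)
  set q := ∫ s in (0:ℝ)..ℓ, rf ℓ W s * (es κ ℓ s : ℂ)
  set p := ∫ s in (0:ℝ)..ℓ, v s * (es κ ℓ s : ℂ) with hp
  have hb : ‖b‖ * ‖gL‖ ≤ ‖p‖ + ‖a‖ * ‖q‖ := by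
    rw [← norm_mul, ← norm_mul]
    have : b * gL = -(p + a*q) := by linear_combination e
    rw [this, norm_neg]; exact norm_add_le _ _
  have hs1 : 1 ≤ Real.sqrt (1+|dR|) := Real.one_le_sqrt.2 (by linarith [abs_nonneg dR])
  have hss := Real.sq_sqrt (show 0 ≤ 1+|dR| by positivity)
  set r := Real.sqrt (1+|dR|)
  have hlr : 0 < ℓ * r := by positivity
  have hq : ‖q‖ ≤ C * ‖gR‖ / (ℓ*r) := (le_div_iff₀ hlr).2 cb
  have hq1 : ‖q‖ ≤ C / ℓ * ‖gR‖ := by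
    refine hq.trans ?_
    rw [div_mul_eq_mul_div]
    gcongr
    exact le_mul_of_one_le_right hl0.le hs1
  constructor
  · have := left_A h hm hD hκ hκ1 hkl
    rw [← hp] at this
    have : ‖a‖ * ‖q‖ ≤ ‖a‖ * (C / ℓ * ‖gR‖) := by gcongr
    linarith
  · have hB : 0 ≤ ‖b‖ * ‖gL‖ := by positivity
    have hA : 0 ≤ 2*C* (‖a‖ * ‖gR‖) := by positivity
    by_cases hc : 1 ≤ z*k4
    · have l := left_B h hm hD hκ hκ1 hkl hk4 hk hz0 hz hc
      rw [← hp] at l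
      have hk41 : k4 ≤ 1 := by
        rw [← hk] at hκ1
        exact (pow_le_one_iff_of_nonneg hk4.le (by norm_num)).1 hκ1
      have hz2 : z ≤ 2*(ℓ*r) := by
        have : z^4 ≤ (2*(ℓ*r))^4 := by
          rw [hz]
          have h1 : 1 ≤ ℓ*r := by nlinarith
          have h2 : 1 + |Λ| ≤ ℓ + r^2 := by rw [hss]; linarith
          have h3 : ℓ + r^2 ≤ 2*(ℓ*r)^2 := by
            have : 1 ≤ r^2 := one_le_pow₀ hs1
            have : 1 ≤ ℓ^2 := one_le_pow₀ hl1
            nlinarith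
          have h4 : (ℓ*r)^2 ≤ (ℓ*r)^4 := pow_le_pow_right₀ h1 (by norm_num)
          have h5 : 0 ≤ (ℓ*r)^4 := by positivity
          have h6 : (2*(ℓ*r))^4 = 16 * (ℓ*r)^4 := by ring
          linarith
        exact (pow_le_pow_iff_left₀ hz0.le (by positivity) (by norm_num)).1 this
      have hzq : z * k4 * ‖q‖ ≤ 2*C*‖gR‖ := by
        calc z * k4 * ‖q‖ ≤ (2*(ℓ*r)) * 1 * ‖q‖ := by gcongr
          _ = 2 * (‖q‖ * (ℓ*r)) := by ring
          _ ≤ 2 * (C * ‖gR‖) := by linarith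
          _ = _ := by ring
      calc z * k4 * (‖b‖ * ‖gL‖) ≤ z*k4*(‖p‖ + ‖a‖ * ‖q‖) := by gcongr
        _ = z*k4*‖p‖ + ‖a‖ * (z*k4*‖q‖) := by ring
        _ ≤ 6100*m + ‖a‖ * (2*C*‖gR‖) := by gcongr
        _ ≤ _ := by linarith
    · push Not at hc
      have : z*k4*(‖b‖ * ‖gL‖) ≤ 1 * (‖b‖ * ‖gL‖) := by gcongr
      linarith

/-- subtracting the boundary correctors -/
lemma decomp {C δ κ ε ℓ Λ : ℝ} {w w1 w2 G WL WL1 WL2 W W1 W2 : ℝ → ℂ}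
    (hl : 0 ≤ ℓ) (hκ0 : 0 ≤ κ) (hκ1 : κ ≤ 1) (he : 0 ≤ ε) (he1 : ε ≤ 1/96)
    (d1 : ∀ x, HasDerivAt w (w1 x) x) (d2 : ∀ x, HasDerivAt w1 (w2 x) x) (c2 : Continuous w2)
    (hG : ∀ x : ℝ, G x = -w2 x + ((κ^2:ℝ):ℂ) * w x + Complex.I * ((x - Λ : ℝ) : ℂ) * w x - (ε:ℂ) * w x)
    (cL : Corr C δ κ ε (-Λ) ℓ WL WL1 WL2) (cR : Corr C δ κ ε (Λ-ℓ) ℓ W W1 W2) :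
    ∃ v v1 v2 H : ℝ → ℂ, Res 0 ℓ Λ (κ^2) ε v v1 v2 (fun s => G s + H s) ∧ Continuous H ∧
      N2 0 ℓ H ≤ δ * (‖w 0‖ * ‖∫ s in (0:ℝ)..ℓ, WL s * (es κ ℓ s : ℂ)‖ + ‖w ℓ‖ * ‖∫ s in (0:ℝ)..ℓ, W s * (es κ ℓ s : ℂ)‖) ∧
      ∀ s, w s = v s + w 0 * WL s + w ℓ * rf ℓ W s := by
  have cwL := cL.cw
  have cwR := cR.cw
  have c2L := cL.c2
  have c2R := cR.c2
  set RL : ℝ → ℂ := fun s => WL2 s - ((κ:ℂ)^2 - (ε:ℂ) + Complex.I * ((s+(-Λ):ℝ):ℂ)) * WL s with hRL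
  set RR : ℝ → ℂ := fun s => W2 s - ((κ:ℂ)^2 - (ε:ℂ) + Complex.I * ((s+(Λ-ℓ):ℝ):ℂ)) * W s with hRR
  have cRL : Continuous RL := by fun_prop
  have cRR : Continuous RR := by fun_prop
  have crRR := rf_cont (ℓ := ℓ) cRR
  have rfd2 : ∀ x, HasDerivAt (fun x => -(rf ℓ W1 x)) (rf ℓ W2 x) x := fun x => by
    have := (rf_deriv (ℓ := ℓ) cR.d2 x).neg
    rw [neg_neg] at this; exact this
  have crf2 := rf_cont (ℓ := ℓ) c2R
  refine ⟨fun s => w s - w 0 * WL s - w ℓ * rf ℓ W s, fun s => w1 s - w 0 * WL1 s - w ℓ * (-(rf ℓ W1 s)),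
    fun s => w2 s - w 0 * WL2 s - w ℓ * rf ℓ W2 s, fun s => w 0 * RL s + w ℓ * rf ℓ RR s, ?_, ?_, ?_, ?_⟩
  · exact
    { hab := hl
      hc := by positivity
      hc1 := by nlinarith
      he := he
      he1 := he1
      d1 := fun x => (((d1 x).sub ((cL.d1 x).const_mul _)).sub ((rf_deriv cR.d1 x).const_mul _))
      d2 := fun x => (((d2 x).sub ((cL.d2 x).const_mul _)).sub ((rfd2 x).const_mul _))
      c2 := by fun_prop
      va := by simp [cL.w0, rf, cR.wl]
      vb := by simp [cL.wl, rf, cR.w0]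
      hG := fun x => by
        rw [hG]
        simp only [hRL, hRR, rf, map_add, map_sub, map_mul, map_pow, Complex.conj_ofReal, Complex.conj_I]
        push_cast; ring }
  · fun_prop
  · refine (N2_add hl (by fun_prop) (by fun_prop)).trans ?_
    rw [N2_smul, N2_smul, N2_rf]
    have h1 := cL.he
    have h2 := cR.he
    rw [mul_add]
    apply add_le_add
    · calc _ ≤ ‖w 0‖ * _ := mul_le_mul_of_nonneg_left h1 (norm_nonneg _)
        _ = _ := by ring
    · calc _ ≤ ‖w ℓ‖ * _ := mul_le_mul_of_nonneg_left h2 (norm_nonneg _)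
        _ = _ := by ring
  · intro s; ring

/-- hypotheses of the rescaled problem -/
structure Core (ℓ Λ κ ε : ℝ) (w w1 w2 Φ Φ1 G : ℝ → ℂ) : Prop where
  d1 : ∀ x, HasDerivAt w (w1 x) x
  d2 : ∀ x, HasDerivAt w1 (w2 x) x
  c2 : Continuous w2
  hG : ∀ x : ℝ, G x = -w2 x + ((κ^2:ℝ):ℂ) * w x + Complex.I * ((x - Λ : ℝ) : ℂ) * w x - (ε:ℂ) * w x
  hΦ : ∀ x, HasDerivAt Φ (Φ1 x) x
  hΦ1 : ∀ x, HasDerivAt Φ1 (w x + (κ:ℂ)^2 * Φ x) x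
  a0 : Φ 0 = 0
  al : Φ ℓ = 0
  b0 : Φ1 0 = 0
  bl : Φ1 ℓ = 0

lemma Core.cw {ℓ Λ κ ε : ℝ} {w w1 w2 Φ Φ1 G : ℝ → ℂ} (h : Core ℓ Λ κ ε w w1 w2 Φ Φ1 G) : Continuous w :=
  continuous_iff_continuousAt.2 fun x => (h.d1 x).continuousAt
lemma Core.cΦ {ℓ Λ κ ε : ℝ} {w w1 w2 Φ Φ1 G : ℝ → ℂ} (h : Core ℓ Λ κ ε w w1 w2 Φ Φ1 G) : Continuous Φ :=
  continuous_iff_continuousAt.2 fun x => (h.hΦ x).continuousAt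
lemma Core.cΦ1 {ℓ Λ κ ε : ℝ} {w w1 w2 Φ Φ1 G : ℝ → ℂ} (h : Core ℓ Λ κ ε w w1 w2 Φ Φ1 G) : Continuous Φ1 :=
  continuous_iff_continuousAt.2 fun x => (h.hΦ1 x).continuousAt
lemma Core.cG {ℓ Λ κ ε : ℝ} {w w1 w2 Φ Φ1 G : ℝ → ℂ} (h : Core ℓ Λ κ ε w w1 w2 Φ Φ1 G) : Continuous G := by
  have e : G = fun x : ℝ => -w2 x + ((κ^2:ℝ):ℂ) * w x + Complex.I * ((x - Λ : ℝ) : ℂ) * w x - (ε:ℂ) * w x := funext h.hG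
  have := h.cw
  have := h.c2
  rw [e]; fun_prop

lemma Core.orth_left {ℓ Λ κ ε : ℝ} {w w1 w2 Φ Φ1 G : ℝ → ℂ} (h : Core ℓ Λ κ ε w w1 w2 Φ Φ1 G) :
    ∫ s in (0:ℝ)..ℓ, w s * (es κ ℓ s : ℂ) = 0 := orth h.cw h.hΦ h.hΦ1 h.a0 h.al h.b0 h.bl

lemma Core.orth_right {ℓ Λ κ ε : ℝ} {w w1 w2 Φ Φ1 G : ℝ → ℂ} (h : Core ℓ Λ κ ε w w1 w2 Φ Φ1 G) :
    ∫ s in (0:ℝ)..ℓ, rf ℓ w s * (es κ ℓ s : ℂ) = 0 := by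
  apply orth (Φ := rf ℓ Φ) (Φ1 := fun x => -(rf ℓ Φ1 x)) (rf_cont h.cw) (rf_deriv h.hΦ)
  · intro x
    have := (rf_deriv (ℓ := ℓ) h.hΦ1 x).neg
    rw [neg_neg] at this
    refine HasDerivAt.congr_deriv this ?_
    simp [rf]
  all_goals simp [rf, h.a0, h.al, h.b0, h.bl]

set_option maxHeartbeats 1600000 in
lemma core_S {C κ ε ℓ Λ m k4 zL zR : ℝ} {w w1 w2 Φ Φ1 G WL WL1 WL2 W W1 W2 v v1 v2 H : ℝ → ℂ}
    (h : Core ℓ Λ κ ε w w1 w2 Φ Φ1 G) (hκ : 0 < κ) (hκ1 : κ ≤ 1) (hkl : 2 ≤ κ*ℓ) (hl1 : 1 ≤ ℓ) (hC : 0 ≤ C) (hlC : 4*C ≤ ℓ)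
    (cL : Corr C (1/48800) κ ε (-Λ) ℓ WL WL1 WL2) (cR : Corr C (1/48800) κ ε (Λ-ℓ) ℓ W W1 W2)
    (hR : Res 0 ℓ Λ (κ^2) ε v v1 v2 (fun s => G s + H s)) (cH : Continuous H)
    (hH : N2 0 ℓ H ≤ (1/48800) * (‖w 0‖ * ‖∫ s in (0:ℝ)..ℓ, WL s * (es κ ℓ s : ℂ)‖ + ‖w ℓ‖ * ‖∫ s in (0:ℝ)..ℓ, W s * (es κ ℓ s : ℂ)‖))
    (hw : ∀ s, w s = v s + w 0 * WL s + w ℓ * rf ℓ W s)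
    (hm : 0 ≤ m) (hD : Dom 0 ℓ G m)
    (hk4 : 0 < k4) (hk : k4^4 = κ) (hzL0 : 0 < zL) (hzL : zL^4 = 1+|Λ|) (hzR0 : 0 < zR) (hzR : zR^4 = 1+|Λ-ℓ|) :
    N2 0 ℓ H ≤ m ∧ Dom 0 ℓ (fun s => G s + H s) (2*m) ∧
    (‖w 0‖ * ‖∫ s in (0:ℝ)..ℓ, WL s * (es κ ℓ s : ℂ)‖ + ‖w ℓ‖ * ‖∫ s in (0:ℝ)..ℓ, W s * (es κ ℓ s : ℂ)‖) ≤ 24400*m ∧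
    zL * k4 * (‖w 0‖ * ‖∫ s in (0:ℝ)..ℓ, WL s * (es κ ℓ s : ℂ)‖) ≤ (36600 + 48800*C)*m ∧
    zR * k4 * (‖w ℓ‖ * ‖∫ s in (0:ℝ)..ℓ, W s * (es κ ℓ s : ℂ)‖) ≤ (36600 + 48800*C)*m := by
  have hl0 : 0 < ℓ := by linarith
  have cG := h.cG
  have dom' := Dom_add hD (Dom_L2 hl0.le cH) cG cH
  have hmH : 0 ≤ m + N2 0 ℓ H := add_nonneg hm (N2_nonneg _ _ _)
  have hw' : ∀ s, rf ℓ w s = rf ℓ v s + (starRingEnd ℂ) (w ℓ) * W s + (starRingEnd ℂ) (w 0) * rf ℓ WL s := by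
    intro s
    simp only [rf]
    rw [hw (ℓ - s)]
    simp [rf]; ring
  have LE := left_est hR hmH dom' hκ hκ1 hkl hl1 hC cL cR (by
    have := abs_add_le (Λ-ℓ) ℓ
    rw [sub_add_cancel, abs_of_pos hl0] at this; linarith) hw h.orth_left hk4 hk hzL0 hzL
  have RE := left_est hR.reflect hmH (Dom_rf dom') hκ hκ1 hkl hl1 hC cR cL (by
    have := abs_add_le ℓ (-Λ)
    rw [← sub_eq_add_neg, abs_of_pos hl0] at this; linarith) hw' h.orth_right hk4 hk hzR0 (by rw [abs_sub_comm]; exact hzR)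
  rw [RCLike.norm_conj, RCLike.norm_conj] at RE
  set B := ‖w 0‖ * ‖∫ s in (0:ℝ)..ℓ, WL s * (es κ ℓ s : ℂ)‖ with hB
  set A := ‖w ℓ‖ * ‖∫ s in (0:ℝ)..ℓ, W s * (es κ ℓ s : ℂ)‖ with hA
  have hA0 : 0 ≤ A := by positivity
  have hB0 : 0 ≤ B := by positivity
  have hCl : C/ℓ ≤ 1/4 := by rw [div_le_div_iff₀ hl0 (by norm_num)]; linarith
  obtain ⟨L1, L2⟩ := LE
  obtain ⟨R1, R2⟩ := RE
  have q1 : C/ℓ * A ≤ 1/4 * A := by gcongr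
  have q2 : C/ℓ * B ≤ 1/4 * B := by gcongr
  have hS : B + A ≤ 24400*m := by linarith
  have hHm : N2 0 ℓ H ≤ m := by linarith
  have hCA : C * A ≤ C * (24400*m) := by apply mul_le_mul_of_nonneg_left (by linarith) hC
  have hCB : C * B ≤ C * (24400*m) := by apply mul_le_mul_of_nonneg_left (by linarith) hC
  refine ⟨hHm, Dom_mono dom' (by linarith), hS, ?_, ?_⟩ <;> linarith

/-- sup bound for `Φ` -/
lemma sup_bound {ℓ κ : ℝ} {Φ Φ1 : ℝ → ℂ} (hκ : 0 < κ) (hΦ : ∀ x, HasDerivAt Φ (Φ1 x) x) (c1 : Continuous Φ1) (a0 : Φ 0 = 0)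
    {s : ℝ} (hs : s ∈ Icc (0:ℝ) ℓ) :
    κ * ‖Φ s‖^2 ≤ N2 0 ℓ Φ1^2 + κ^2 * N2 0 ℓ Φ^2 := by
  have cΦ : Continuous Φ := continuous_iff_continuousAt.2 fun x => (hΦ x).continuousAt
  have hl : 0 ≤ ℓ := hs.1.trans hs.2
  have h1 := intervalIntegral.integral_eq_sub_of_hasDerivAt (a := 0) (b := s) (fun x _ => hasDerivAt_cross' (hΦ x) (hΦ x))
    (Continuous.intervalIntegrable (by fun_prop) _ _)
  rw [a0, zero_mul, sub_zero] at h1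
  have h2 : ‖Φ s‖^2 ≤ ∫ x in (0:ℝ)..s, 2*(‖Φ x‖*‖Φ1 x‖) := by
    have : ‖Φ s‖^2 = ‖Φ s * (starRingEnd ℂ) (Φ s)‖ := by rw [norm_mul, RCLike.norm_conj]; ring
    rw [this, ← h1]
    refine (intervalIntegral.norm_integral_le_integral_norm hs.1).trans ?_
    apply intervalIntegral.integral_mono_on hs.1 (Continuous.intervalIntegrable (by fun_prop) _ _) (Continuous.intervalIntegrable (by fun_prop) _ _)
    intro x _
    refine (norm_add_le _ _).trans (le_of_eq ?_)
    rw [norm_mul, norm_mul, RCLike.norm_conj, RCLike.norm_conj]; ring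
  have h3 : ∫ x in (0:ℝ)..s, 2*(‖Φ x‖*‖Φ1 x‖) ≤ ∫ x in (0:ℝ)..ℓ, 2*(‖Φ x‖*‖Φ1 x‖) := by
    apply intervalIntegral.integral_mono_interval le_rfl hs.1 hs.2
    · exact Filter.Eventually.of_forall fun x => by positivity
    · exact Continuous.intervalIntegrable (by fun_prop) _ _
  rw [intervalIntegral.integral_const_mul (a := 0) (b := ℓ)] at h3
  have h4 := cs_norm hl cΦ c1
  nlinarith [sq_nonneg (κ * N2 0 ℓ Φ - N2 0 ℓ Φ1)]

lemma energy {ℓ κ : ℝ} {w Φ Φ1 : ℝ → ℂ} (hl : 0 ≤ ℓ) (cw : Continuous w) (hΦ : ∀ x, HasDerivAt Φ (Φ1 x) x)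
    (hΦ1 : ∀ x, HasDerivAt Φ1 (w x + (κ:ℂ)^2 * Φ x) x) (a0 : Φ 0 = 0) (al : Φ ℓ = 0) :
    N2 0 ℓ Φ1^2 + κ^2 * N2 0 ℓ Φ^2 ≤ ‖∫ s in (0:ℝ)..ℓ, w s * (starRingEnd ℂ) (Φ s)‖ := by
  have cΦ : Continuous Φ := continuous_iff_continuousAt.2 fun x => (hΦ x).continuousAt
  have c1 : Continuous Φ1 := continuous_iff_continuousAt.2 fun x => (hΦ1 x).continuousAt
  have h1 := ibp_cross (a := 0) (b := ℓ) hΦ1 hΦ (by fun_prop) c1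
  rw [a0, al] at h1
  simp only [map_zero, mul_zero, sub_zero, zero_sub, add_mul] at h1
  rw [intervalIntegral.integral_add] at h1
  · have key : ∀ f : ℝ → ℂ, ∫ x in (0:ℝ)..ℓ, f x * (starRingEnd ℂ) (f x) = ((N2 0 ℓ f^2 : ℝ) : ℂ) := by
      intro f
      rw [N2_sq hl, ← intervalIntegral.integral_ofReal]
      congr 1; funext x; rw [Complex.mul_conj, Complex.normSq_eq_norm_sq]
    have h2 : ∫ x in (0:ℝ)..ℓ, (κ:ℂ)^2 * Φ x * (starRingEnd ℂ) (Φ x) = (κ:ℂ)^2 * ((N2 0 ℓ Φ^2 : ℝ) : ℂ) := by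
      rw [← key, ← intervalIntegral.integral_const_mul]; congr 1; funext x; ring
    rw [h2, key] at h1
    have h3 : ∫ s in (0:ℝ)..ℓ, w s * (starRingEnd ℂ) (Φ s) = ((-(N2 0 ℓ Φ1^2 + κ^2 * N2 0 ℓ Φ^2) : ℝ) : ℂ) := by
      push_cast; push_cast at h1; linear_combination h1
    rw [h3, Complex.norm_real, norm_neg, Real.norm_eq_abs]; exact le_abs_self _
  all_goals apply Continuous.intervalIntegrable; fun_prop

/-- rescaled weight -/
noncomputable def rr (ℓ s : ℝ) : ℝ := min 1 (min s (ℓ - s))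

lemma rr_cont (ℓ : ℝ) : Continuous (rr ℓ) := by unfold rr; fun_prop
lemma rr_symm (ℓ s : ℝ) : rr ℓ (ℓ - s) = rr ℓ s := by
  unfold rr; rw [sub_sub_cancel, min_comm s]
lemma rr_nonneg {ℓ s : ℝ} (hs : s ∈ Icc (0:ℝ) ℓ) : 0 ≤ rr ℓ s :=
  le_min zero_le_one (le_min hs.1 (by linarith [hs.2]))
lemma rr_le_one (ℓ s : ℝ) : rr ℓ s ≤ 1 := min_le_left _ _
lemma rr_le_self (ℓ s : ℝ) : rr ℓ s ≤ s := (min_le_right _ _).trans (min_le_left _ _)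

lemma rr_N2 {C δ κ ε d ℓ : ℝ} {W W1 W2 : ℝ → ℂ} (h : Corr C δ κ ε d ℓ W W1 W2) (hl : 0 ≤ ℓ) (hC : 0 ≤ C) :
    N2 0 ℓ (fun s => (Real.sqrt (rr ℓ s) : ℂ) * W s) ≤ Real.sqrt C * ‖∫ s in (0:ℝ)..ℓ, W s * (es κ ℓ s : ℂ)‖ := by
  have cW := h.cw
  have cr := rr_cont ℓ
  apply N2_le_of_bound hl (by fun_prop) (g := fun s => s * ‖W s‖^2) (by fun_prop) (by positivity)
  · intro s hs
    rw [norm_mul, mul_pow, Complex.norm_real, Real.norm_eq_abs, sq_abs, Real.sq_sqrt (rr_nonneg hs)]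
    gcongr
    exact rr_le_self _ _
  · rw [mul_pow, Real.sq_sqrt hC]; exact h.hd

lemma Corr.n2 {C δ κ ε d ℓ z : ℝ} {W W1 W2 : ℝ → ℂ} (h : Corr C δ κ ε d ℓ W W1 W2) (hl : 0 ≤ ℓ) (hC : 0 ≤ C) (hz0 : 0 < z) (hz : z^4 = 1+|d|) :
    N2 0 ℓ W ≤ Real.sqrt C * z * ‖∫ s in (0:ℝ)..ℓ, W s * (es κ ℓ s : ℂ)‖ := by
  have hb := h.hb
  have : Real.sqrt (1+|d|) = z^2 := by
    rw [← hz, show z^4 = (z^2)^2 by ring, Real.sqrt_sq (by positivity)]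
  rw [this] at hb
  apply Real.sqrt_le_iff.2 ⟨by positivity, ?_⟩
  rw [mul_pow, mul_pow, Real.sq_sqrt hC]; exact hb

lemma N2_three {ℓ : ℝ} (hl : 0 ≤ ℓ) {f1 f2 f3 : ℝ → ℂ} (a b : ℂ) (h1 : Continuous f1) (h2 : Continuous f2) (h3 : Continuous f3) :
    N2 0 ℓ (fun s => f1 s + a * f2 s + b * f3 s) ≤ N2 0 ℓ f1 + ‖a‖ * N2 0 ℓ f2 + ‖b‖ * N2 0 ℓ f3 := by
  have e1 := N2_add hl (f := fun s => f1 s + a * f2 s) (g := fun s => b * f3 s) (by fun_prop) (by fun_prop)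
  have e2 := N2_add hl (f := f1) (g := fun s => a * f2 s) (by fun_prop) (by fun_prop)
  rw [N2_smul] at e1 e2
  linarith

set_option maxHeartbeats 1600000 in
lemma core_est {C κ ε ℓ Λ m k4 : ℝ} {w w1 w2 Φ Φ1 G WL WL1 WL2 W W1 W2 : ℝ → ℂ}
    (h : Core ℓ Λ κ ε w w1 w2 Φ Φ1 G) (hκ : 0 < κ) (hκ1 : κ ≤ 1) (hkl : 2 ≤ κ*ℓ) (hl1 : 1 ≤ ℓ) (hC : 0 ≤ C) (hlC : 4*C ≤ ℓ)
    (he : 0 ≤ ε) (he1 : ε ≤ 1/96)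
    (cL : Corr C (1/48800) κ ε (-Λ) ℓ WL WL1 WL2) (cR : Corr C (1/48800) κ ε (Λ-ℓ) ℓ W W1 W2)
    (hm : 0 ≤ m) (hD : Dom 0 ℓ G m) (hk4 : 0 < k4) (hk : k4^4 = κ) :
    k4 * N2 0 ℓ w ≤ (260 + 2 * Real.sqrt C * (36600 + 48800*C)) * m ∧
    N2 0 ℓ (fun s => (Real.sqrt (rr ℓ s) : ℂ) * w s) ≤ (260 + Real.sqrt C * 24400) * m ∧
    k4^2 * Real.sqrt (N2 0 ℓ Φ1^2 + κ^2 * N2 0 ℓ Φ^2) ≤ (1800 + 24400*C) * m ∧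
    ∫ s in (0:ℝ)..ℓ, ‖w s‖ ≤ 300 * (N2 0 ℓ G + m) + C * (24400 * m) := by
  have hl0 : 0 < ℓ := by linarith
  obtain ⟨v, v1, v2, H, hR, cH, hH, hw⟩ := decomp hl0.le hκ.le hκ1 he he1 h.d1 h.d2 h.c2 h.hG cL cR
  set zL := (1+|Λ|) ^ ((1:ℝ)/4) with hzLd
  set zR := (1+|Λ-ℓ|) ^ ((1:ℝ)/4) with hzRd
  have hzL0 : 0 < zL := by positivity
  have hzR0 : 0 < zR := by positivity
  have hzL : zL^4 = 1+|Λ| := by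
    rw [hzLd, ← Real.rpow_natCast, ← Real.rpow_mul (by positivity)]; norm_num
  have hzR : zR^4 = 1+|Λ-ℓ| := by
    rw [hzRd, ← Real.rpow_natCast, ← Real.rpow_mul (by positivity)]; norm_num
  obtain ⟨hHm, dom', hS, kL, kR⟩ := core_S h hκ hκ1 hkl hl1 hC hlC cL cR hR cH hH hw hm hD hk4 hk hzL0 hzL hzR0 hzR
  have hm2 : 0 ≤ 2*m := by linarith
  obtain ⟨sv, _⟩ := hR.step1 hm2 dom'
  have cv := hR.cv
  have cwL := cL.cw
  have cwR := cR.cw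
  have crf := rf_cont (ℓ := ℓ) cwR
  have cr := rr_cont ℓ
  have cG := h.cG
  have cΦ := h.cΦ
  have cΦ1 := h.cΦ1
  have hk41 : k4 ≤ 1 := by
    have := hκ1
    rw [← hk] at this
    exact (pow_le_one_iff_of_nonneg hk4.le (by norm_num)).1 this
  have hwf : w = fun s => v s + w 0 * WL s + w ℓ * rf ℓ W s := funext hw
  have nL := cL.n2 hl0.le hC hzL0 (by rw [abs_neg]; exact hzL)
  have nR := cR.n2 hl0.le hC hzR0 hzR
  have rL := rr_N2 cL hl0.le hC
  have rR := rr_N2 cR hl0.le hC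
  have aL := cL.ha
  have aR := cR.ha
  set gL := ‖∫ s in (0:ℝ)..ℓ, WL s * (es κ ℓ s : ℂ)‖
  set gR := ‖∫ s in (0:ℝ)..ℓ, W s * (es κ ℓ s : ℂ)‖
  have hw0 := norm_nonneg (w 0)
  have hwl := norm_nonneg (w ℓ)
  have sC := Real.sqrt_nonneg C
  have T1 : ∀ ψ : ℝ → ℝ, Continuous ψ → (∀ s ∈ Icc (0:ℝ) ℓ, 0 ≤ ψ s) → ∫ s in (0:ℝ)..ℓ, ‖w s‖ * ψ s ≤ (∫ s in (0:ℝ)..ℓ, ‖v s‖ * ψ s) + ‖w 0‖ * (∫ s in (0:ℝ)..ℓ, ‖WL s‖ * ψ s) + ‖w ℓ‖ * (∫ s in (0:ℝ)..ℓ, ‖rf ℓ W s‖ * ψ s) := by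
    intro ψ cψ h0
    rw [← intervalIntegral.integral_const_mul, ← intervalIntegral.integral_const_mul, ← intervalIntegral.integral_add, ← intervalIntegral.integral_add]
    · have cw := h.cw
      apply intervalIntegral.integral_mono_on hl0.le (Continuous.intervalIntegrable (by fun_prop) _ _) (Continuous.intervalIntegrable (by fun_prop) _ _)
      intro s hs
      have : ‖w s‖ ≤ ‖v s‖ + ‖w 0‖ * ‖WL s‖ + ‖w ℓ‖ * ‖rf ℓ W s‖ := by
        rw [← norm_mul, ← norm_mul]
        conv_lhs => rw [hw s]
        exact norm_add₃_le
      calc _ ≤ (‖v s‖ + ‖w 0‖ * ‖WL s‖ + ‖w ℓ‖ * ‖rf ℓ W s‖) * ψ s := mul_le_mul_of_nonneg_right this (h0 s hs)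
        _ = _ := by ring
    all_goals apply Continuous.intervalIntegrable; fun_prop
  have irf : ∫ s in (0:ℝ)..ℓ, ‖rf ℓ W s‖ = ∫ s in (0:ℝ)..ℓ, ‖W s‖ := by
    rw [← int_reflect ℓ (fun s => ‖W s‖)]
    congr 1; funext s; simp [rf]
  have hSC : ‖w 0‖ * (C * gL) + ‖w ℓ‖ * (C * gR) ≤ C * (24400 * m) := by
    calc _ = C * (‖w 0‖ * gL + ‖w ℓ‖ * gR) := by ring
      _ ≤ _ := mul_le_mul_of_nonneg_left hS hC
  refine ⟨?_, ?_, ?_, ?_⟩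
  · have t := N2_three hl0.le (w 0) (w ℓ) cv cwL crf
    rw [← hwf, N2_rf] at t
    calc k4 * N2 0 ℓ w ≤ k4 * (130*(2*m) + ‖w 0‖ * (Real.sqrt C * zL * gL) + ‖w ℓ‖ * (Real.sqrt C * zR * gR)) := by
          apply mul_le_mul_of_nonneg_left _ hk4.le
          refine t.trans ?_
          gcongr
      _ = k4 * (130*(2*m)) + Real.sqrt C * (zL * k4 * (‖w 0‖*gL)) + Real.sqrt C * (zR * k4 * (‖w ℓ‖*gR)) := by ring
      _ ≤ 1 * (130*(2*m)) + Real.sqrt C * ((36600 + 48800*C)*m) + Real.sqrt C * ((36600 + 48800*C)*m) := by gcongr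
      _ = _ := by ring
  · have t := N2_three hl0.le (w 0) (w ℓ) (f1 := fun s => (Real.sqrt (rr ℓ s) : ℂ) * v s) (f2 := fun s => (Real.sqrt (rr ℓ s) : ℂ) * WL s)
      (f3 := fun s => (Real.sqrt (rr ℓ s) : ℂ) * rf ℓ W s) (by fun_prop) (by fun_prop) (by fun_prop)
    have e1 : (fun s => (Real.sqrt (rr ℓ s) : ℂ) * v s + w 0 * ((Real.sqrt (rr ℓ s) : ℂ) * WL s) + w ℓ * ((Real.sqrt (rr ℓ s) : ℂ) * rf ℓ W s)) = fun s => (Real.sqrt (rr ℓ s) : ℂ) * w s := by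
      funext s; rw [hw s]; ring
    have e2 : (fun s => (Real.sqrt (rr ℓ s) : ℂ) * rf ℓ W s) = rf ℓ (fun s => (Real.sqrt (rr ℓ s) : ℂ) * W s) := by
      funext s; simp [rf, rr_symm]
    rw [e1, e2, N2_rf] at t
    have t2 : N2 0 ℓ (fun s => (Real.sqrt (rr ℓ s) : ℂ) * v s) ≤ N2 0 ℓ v := by
      apply N2_mono hl0.le (by fun_prop) cv
      intro s hs
      rw [norm_mul, Complex.norm_real, Real.norm_of_nonneg (Real.sqrt_nonneg _)]
      exact mul_le_of_le_one_left (norm_nonneg _) (Real.sqrt_le_one.2 (rr_le_one _ _))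
    calc _ ≤ 130*(2*m) + ‖w 0‖ * (Real.sqrt C * gL) + ‖w ℓ‖ * (Real.sqrt C * gR) := by
          refine t.trans ?_
          gcongr
          exact t2.trans sv
      _ = 130*(2*m) + Real.sqrt C * (‖w 0‖*gL + ‖w ℓ‖*gR) := by ring
      _ ≤ 130*(2*m) + Real.sqrt C * (24400*m) := by gcongr
      _ = _ := by ring
  · have en := energy hl0.le h.cw h.hΦ h.hΦ1 h.a0 h.al
    have hE0 : 0 ≤ N2 0 ℓ Φ1^2 + κ^2 * N2 0 ℓ Φ^2 := by positivity
    set E := N2 0 ℓ Φ1^2 + κ^2 * N2 0 ℓ Φ^2 with hE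
    set U := Real.sqrt E with hU
    have hUU : U^2 = E := Real.sq_sqrt hE0
    have hU0 : 0 ≤ U := Real.sqrt_nonneg _
    set P := U / k4^2 with hP
    have hP0 : 0 ≤ P := by positivity
    have hUP : U = k4^2 * P := by rw [hP]; field_simp
    have hsup : ∀ s ∈ Icc (0:ℝ) ℓ, ‖Φ s‖ ≤ P := by
      intro s hs
      have sb := sup_bound hκ h.hΦ cΦ1 h.a0 hs
      rw [← hE, ← hUU, hUP, ← hk] at sb
      have : ‖Φ s‖^2 ≤ P^2 := by
        have h4 : 0 < k4^4 := by positivity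
        have : k4^4 * ‖Φ s‖^2 ≤ k4^4 * P^2 := by linarith
        exact le_of_mul_le_mul_left this h4
      exact (abs_le_of_sq_le_sq' this hP0).2
    have hUleP : U ≤ P := by
      rw [hUP]; exact mul_le_of_le_one_left hP0 (pow_le_one₀ hk4.le hk41)
    have hΦ1U : N2 0 ℓ Φ1 ≤ U := by
      apply Real.le_sqrt_of_sq_le
      have : 0 ≤ κ^2 * N2 0 ℓ Φ^2 := by positivity
      linarith
    have com := om_cont Λ
    have o1 : N2 0 ℓ (fun x => (om Λ x:ℂ) * Φ x) ≤ 2*P := by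
      apply N2_le_of_bound hl0.le (by fun_prop) (g := fun s => P^2 * om Λ s^2) (by fun_prop) (by positivity)
      · intro s hs
        rw [norm_mul, Complex.norm_real, Real.norm_eq_abs, mul_pow, sq_abs, mul_comm]
        have := hsup s hs
        gcongr
      · rw [intervalIntegral.integral_const_mul]
        have := (om_int Λ 0 ℓ).trans Real.pi_le_four
        nlinarith [sq_nonneg P]
    have o2 : N2 0 ℓ (fun x => (om Λ x:ℂ) * Φ1 x) ≤ N2 0 ℓ Φ1 := by
      apply N2_mono hl0.le (by fun_prop) cΦ1
      intro s hs
      rw [norm_mul, Complex.norm_real, Real.norm_of_nonneg (om_nonneg _ _)]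
      exact mul_le_of_le_one_left (norm_nonneg _) (om_le_one _ _)
    have pr := hR.pairing hm2 dom' h.hΦ cΦ1 h.a0 h.al
    have pr2 : ‖∫ x in (0:ℝ)..ℓ, v x * (starRingEnd ℂ) (Φ x)‖ ≤ 300 * (2*m) * (2*P + P) := by
      refine pr.trans ?_
      gcongr
      exact o2.trans (hΦ1U.trans hUleP)
    have f1 : ∀ f : ℝ → ℂ, Continuous f → ‖∫ x in (0:ℝ)..ℓ, f x * (starRingEnd ℂ) (Φ x)‖ ≤ (∫ x in (0:ℝ)..ℓ, ‖f x‖) * P := by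
      intro f cf
      refine (intervalIntegral.norm_integral_le_integral_norm hl0.le).trans ?_
      rw [← intervalIntegral.integral_mul_const]
      apply intervalIntegral.integral_mono_on hl0.le (Continuous.intervalIntegrable (by fun_prop) _ _) (Continuous.intervalIntegrable (by fun_prop) _ _)
      intro s hs
      rw [norm_mul, RCLike.norm_conj]
      exact mul_le_mul_of_nonneg_left (hsup s hs) (norm_nonneg _)
    have spl : ∫ s in (0:ℝ)..ℓ, w s * (starRingEnd ℂ) (Φ s) = (∫ s in (0:ℝ)..ℓ, v s * (starRingEnd ℂ) (Φ s)) + w 0 * (∫ s in (0:ℝ)..ℓ, WL s * (starRingEnd ℂ) (Φ s)) + w ℓ * (∫ s in (0:ℝ)..ℓ, rf ℓ W s * (starRingEnd ℂ) (Φ s)) := by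
      rw [← intervalIntegral.integral_const_mul, ← intervalIntegral.integral_const_mul, ← intervalIntegral.integral_add, ← intervalIntegral.integral_add]
      · congr 1; funext s; rw [hw s]; ring
      all_goals apply Continuous.intervalIntegrable; fun_prop
    have fin : U^2 ≤ P * ((1800 + 24400*C) * m) := by
      rw [hUU]
      refine en.trans ?_
      rw [spl]
      refine norm_add₃_le.trans ?_
      rw [norm_mul, norm_mul]
      have g1 := f1 WL cwL
      have g2 := f1 _ crf
      rw [irf] at g2
      calc _ ≤ 300 * (2*m) * (2*P + P) + ‖w 0‖ * ((C * gL) * P) + ‖w ℓ‖ * ((C * gR) * P) := by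
            apply add_le_add (add_le_add pr2 _) _
            · apply mul_le_mul_of_nonneg_left _ hw0
              exact g1.trans (mul_le_mul_of_nonneg_right aL hP0)
            · apply mul_le_mul_of_nonneg_left _ hwl
              exact g2.trans (mul_le_mul_of_nonneg_right aR hP0)
        _ = P * (1800*m + (‖w 0‖ * (C * gL) + ‖w ℓ‖ * (C * gR))) := by ring
        _ ≤ P * (1800*m + C * (24400*m)) := by gcongr
        _ = _ := by ring
    by_cases hP1 : P = 0
    · rw [hUP, hP1]; simp; positivity
    · have hPp : 0 < P := lt_of_le_of_ne hP0 (Ne.symm hP1)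
      have : P * (k4^2 * U) ≤ P * ((1800 + 24400*C) * m) := by
        calc P * (k4^2 * U) = U^2 := by linear_combination (-U) * hUP
          _ ≤ _ := fin
      exact le_of_mul_le_mul_left this hPp
  · have t := T1 (fun _ => 1) continuous_const (fun _ _ => zero_le_one)
    simp only [mul_one] at t
    rw [irf] at t
    have l1 := hR.L1bound
    have l2 := N2_add hl0.le cG cH
    have u1 := mul_le_mul_of_nonneg_left aL hw0
    have u2 := mul_le_mul_of_nonneg_left aR hwl
    linarith

theorem core : ∃ K ε0 ℓ0 : ℝ, 0 < K ∧ 0 < ε0 ∧ ∀ (ℓ Λ κ ε k4 : ℝ) (w w1 w2 Φ Φ1 G : ℝ → ℂ),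
    Core ℓ Λ κ ε w w1 w2 Φ Φ1 G → 0 < κ → κ ≤ 1 → 2 ≤ κ*ℓ → ℓ0 ≤ ℓ → 0 ≤ ε → ε ≤ ε0 → 0 < k4 → k4^4 = κ →
    (k4 * N2 0 ℓ w ≤ K * N2 0 ℓ G ∧ ∫ s in (0:ℝ)..ℓ, ‖w s‖ ≤ K * N2 0 ℓ G) ∧
    ∀ m, 0 ≤ m → Dom 0 ℓ G m → k4 * N2 0 ℓ w ≤ K * m ∧
      N2 0 ℓ (fun s => (Real.sqrt (rr ℓ s) : ℂ) * w s) ≤ K * m ∧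
      k4^2 * Real.sqrt (N2 0 ℓ Φ1^2 + κ^2 * N2 0 ℓ Φ^2) ≤ K * m := by
  obtain ⟨C, ε0, ℓ0, hC, hε0, H⟩ := corr_exists (1/48800) (by norm_num)
  have s0 := Real.sqrt_nonneg C
  have sC : 0 ≤ Real.sqrt C * C := by positivity
  refine ⟨10000 + 100000 * Real.sqrt C + 100000 * (Real.sqrt C * C) + 100000 * C, min ε0 (1/96), max ℓ0 (max 1 (4*C)), by positivity, by positivity, ?_⟩
  intro ℓ Λ κ ε k4 w w1 w2 Φ Φ1 G h hκ hκ1 hkl hl he he1 hk4 hk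
  have hl1 : ℓ0 ≤ ℓ := (le_max_left _ _).trans hl
  have hl2 : 1 ≤ ℓ := (le_max_left _ _).trans ((le_max_right _ _).trans hl)
  have hl3 : 4*C ≤ ℓ := (le_max_right _ _).trans ((le_max_right _ _).trans hl)
  have he2 := he1.trans (min_le_left _ _)
  have he3 := he1.trans (min_le_right _ _)
  obtain ⟨WL, WL1, WL2, cL⟩ := H κ ε (-Λ) ℓ hκ hκ1 hkl he he2 hl1
  obtain ⟨W, W1, W2, cR⟩ := H κ ε (Λ-ℓ) ℓ hκ hκ1 hkl he he2 hl1
  constructor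
  · have hN := N2_nonneg 0 ℓ G
    obtain ⟨e1, e2, e3, e4⟩ := core_est h hκ hκ1 hkl hl2 hC.le hl3 he he3 cL cR hN (Dom_L2 (by linarith) h.cG) hk4 hk
    constructor
    · refine e1.trans (mul_le_mul_of_nonneg_right ?_ hN); nlinarith
    · calc _ ≤ _ := e4
        _ = (600 + 24400*C) * N2 0 ℓ G := by ring
        _ ≤ _ := mul_le_mul_of_nonneg_right (by nlinarith) hN
  · intro m hm hD
    obtain ⟨e1, e2, e3, e4⟩ := core_est h hκ hκ1 hkl hl2 hC.le hl3 he he3 cL cR hm hD hk4 hk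
    refine ⟨e1.trans (mul_le_mul_of_nonneg_right ?_ hm), e2.trans (mul_le_mul_of_nonneg_right ?_ hm), e3.trans (mul_le_mul_of_nonneg_right ?_ hm)⟩ <;> nlinarith

lemma icc_int {E : Type*} [NormedAddCommGroup E] [NormedSpace ℝ E] (f : ℝ → E) : ∫ y in Set.Icc (-1:ℝ) 1, f y = ∫ y in (-1:ℝ)..1, f y := by
  rw [intervalIntegral.integral_of_le (by norm_num), integral_Icc_eq_integral_Ioc]

lemma nL2_eq (f : ℝ → ℂ) : nL2 f = N2 (-1) 1 f := by
  unfold nL2 N2; rw [icc_int, Real.sqrt_eq_rpow]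

lemma scale_int {E : Type*} [NormedAddCommGroup E] [NormedSpace ℝ E] {L : ℝ} (hL : 0 < L) (f : ℝ → E) :
    ∫ s in (0:ℝ)..2*L, f (s/L - 1) = L • ∫ y in (-1:ℝ)..1, f y := by
  rw [intervalIntegral.integral_comp_div_sub _ hL.ne']
  congr 2 <;> field_simp <;> norm_num

lemma N2_scale {L l : ℝ} (hl : 0 < l) (hL : L = l^2) (f : ℝ → ℂ) : N2 0 (2*L) (fun s => f (s/L - 1)) = l * N2 (-1) 1 f := by
  have hL0 : 0 < L := by rw [hL]; positivity
  unfold N2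
  rw [scale_int hL0 (fun y => ‖f y‖^2), smul_eq_mul, Real.sqrt_mul hL0.le]
  nth_rewrite 1 [hL]
  rw [Real.sqrt_sq hl.le]

lemma comp_scale_deriv {L : ℝ} (hL : 0 < L) {f f1 : ℝ → ℂ} (h : ∀ x, HasDerivAt f (f1 x) x) (s : ℝ) :
    HasDerivAt (fun s : ℝ => f (s/L - 1)) ((L:ℂ)⁻¹ * f1 (s/L - 1)) s := by
  have h0 : HasDerivAt (fun s : ℝ => s/L - 1) (1/L) s := ((hasDerivAt_id s).div_const L).sub_const 1
  have := (h (s/L - 1)).scomp s h0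
  refine HasDerivAt.congr_deriv this ?_
  rw [Complex.real_smul]; push_cast; ring

lemma rho_le {L y : ℝ} (hL : 1 ≤ L) (hy : y ∈ Icc (-1:ℝ) 1) : 0 ≤ rhoW L y ∧ rhoW L y ≤ rr (2*L) (L*(y+1)) := by
  have hL0 : 0 < L := by linarith
  have h1 : 1/L ≤ 1 := by rw [div_le_one hL0]; exact hL
  have h2 : L * (1/L) = 1 := by field_simp
  obtain ⟨a, b⟩ := hy
  unfold rhoW rr
  split_ifs with c1 c2
  · refine ⟨by nlinarith, le_min ?_ (le_min le_rfl ?_)⟩ <;> nlinarith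
  · push Not at c1
    refine ⟨zero_le_one, le_min le_rfl (le_min ?_ ?_)⟩ <;> nlinarith
  · push Not at c1 c2
    refine ⟨by nlinarith, le_min ?_ (le_min ?_ ?_)⟩ <;> nlinarith

lemma rho_bound {L l : ℝ} (hl : 0 < l) (hL : L = l^2) (hL1 : 1 ≤ L) {w : ℝ → ℂ} (cw : Continuous w) :
    l * (∫ y in Set.Icc (-1:ℝ) 1, rhoW L y * ‖w y‖^2) ^ ((1:ℝ)/2) ≤ N2 0 (2*L) (fun s => (Real.sqrt (rr (2*L) s) : ℂ) * w (s/L - 1)) := by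
  have hL0 : 0 < L := by linarith
  have cr := rr_cont (2*L)
  have e : (fun s => (Real.sqrt (rr (2*L) s) : ℂ) * w (s/L - 1)) = fun s => (fun y : ℝ => (Real.sqrt (rr (2*L) (L*(y+1))) : ℂ) * w y) (s/L - 1) := by
    funext s
    have : L * (s/L - 1 + 1) = s := by field_simp; ring
    simp only [this]
  rw [e, N2_scale hl hL (fun y : ℝ => (Real.sqrt (rr (2*L) (L*(y+1))) : ℂ) * w y), ← Real.sqrt_eq_rpow]
  apply mul_le_mul_of_nonneg_left _ hl.le
  apply Real.sqrt_le_sqrt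
  rw [← icc_int]
  apply integral_mono_of_nonneg
  · filter_upwards [ae_restrict_mem measurableSet_Icc] with y hy
    have := (rho_le hL1 hy).1
    simp only [Pi.zero_apply]; positivity
  · apply Continuous.integrableOn_Icc; fun_prop
  · filter_upwards [ae_restrict_mem measurableSet_Icc] with y hy
    obtain ⟨h0, h1⟩ := rho_le hL1 hy
    simp only [norm_mul, mul_pow, Complex.norm_real, Real.norm_eq_abs, sq_abs]
    rw [Real.sq_sqrt (h0.trans h1)]
    gcongr

lemma dom_scale {L l A M : ℝ} (hl : 0 < l) (hL : L = l^2) (hL1 : 1 ≤ L) (hA : 0 < A) (hM : 0 ≤ M) {F : ℝ → ℂ} (h : Dominates F M) :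
    Dom 0 (2*L) (fun s => (A:ℂ)⁻¹ * F (s/L - 1)) (l^3 * A⁻¹ * M) := by
  have hL0 : 0 < L := by linarith
  have hLc : (L:ℂ) ≠ 0 := by exact_mod_cast hL0.ne'
  intro p p1 hp cp1 p0 pl
  set g : ℝ → ℂ := fun y => p (L*(y+1)) with hg
  set g1 : ℝ → ℂ := fun y => (L:ℂ) * p1 (L*(y+1)) with hg1
  have dg : ∀ y, HasDerivAt g (g1 y) y := by
    intro y
    have h0 : HasDerivAt (fun y : ℝ => L*(y+1)) (L*1) y := ((hasDerivAt_id y).add_const 1).const_mul L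
    have := (hp (L*(y+1))).scomp y h0
    refine HasDerivAt.congr_deriv this ?_
    rw [Complex.real_smul, mul_one]
  have cg1 : Continuous g1 := by fun_prop
  have hder : deriv g = g1 := funext fun y => (dg y).deriv
  have cd : ContDiff ℝ 1 g := by
    rw [contDiff_one_iff_deriv]
    exact ⟨fun y => (dg y).differentiableAt, by rw [hder]; exact cg1⟩
  have hh := h g cd (by simp [hg, p0]) (by simp only [hg]; rw [show L*(1+1) = 2*L by ring, pl])
  rw [hder, nL2_eq, nL2_eq, ← Real.sqrt_eq_rpow] at hh
  have inv : ∀ s : ℝ, L * (s/L - 1 + 1) = s := fun s => by field_simp; ring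
  have eg : p = fun s => g (s/L - 1) := by funext s; simp only [hg, inv]
  have eg1 : (fun s => (L:ℂ) * p1 s) = fun s => g1 (s/L - 1) := by funext s; simp only [hg1, inv]
  have np : N2 0 (2*L) p = l * N2 (-1) 1 g := by
    rw [← N2_scale hl hL g, ← eg]
  have np1 : L * N2 0 (2*L) p1 = l * N2 (-1) 1 g1 := by
    rw [← N2_scale hl hL g1, ← eg1, N2_smul, Complex.norm_real, Real.norm_of_nonneg hL0.le]
  have ei : ∫ s in (0:ℝ)..2*L, (A:ℂ)⁻¹ * F (s/L - 1) * (starRingEnd ℂ) (p s) = (L:ℂ) * (A:ℂ)⁻¹ * innI F g := by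
    unfold innI
    rw [icc_int, mul_assoc, ← Complex.real_smul, ← intervalIntegral.integral_const_mul, ← scale_int hL0 (fun y => (A:ℂ)⁻¹ * (F y * (starRingEnd ℂ) (g y)))]
    congr 1; funext s
    simp only [hg, inv]; ring
  rw [ei, norm_mul, norm_mul, norm_inv, Complex.norm_real, Complex.norm_real, Real.norm_of_nonneg hL0.le, Real.norm_of_nonneg hA.le]
  have n0 := N2_nonneg (-1) 1 g
  have n1 := N2_nonneg (-1) 1 g1
  have m0 := N2_nonneg 0 (2*L) p
  have m1 := N2_nonneg 0 (2*L) p1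
  have sq : Real.sqrt (N2 (-1) 1 g^2 + N2 (-1) 1 g1^2) ≤ N2 (-1) 1 g + N2 (-1) 1 g1 :=
    Real.sqrt_le_iff.2 ⟨by positivity, by nlinarith [mul_nonneg n0 n1]⟩
  have key : l * (N2 (-1) 1 g + N2 (-1) 1 g1) ≤ L * (N2 0 (2*L) p + N2 0 (2*L) p1) := by
    rw [mul_add, ← np, ← np1, mul_add]
    have : 1 * N2 0 (2*L) p ≤ L * N2 0 (2*L) p := by gcongr
    linarith
  calc L * A⁻¹ * ‖innI F g‖ ≤ L * A⁻¹ * (M * (N2 (-1) 1 g + N2 (-1) 1 g1)) := by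
        apply mul_le_mul_of_nonneg_left _ (by positivity)
        exact hh.trans (mul_le_mul_of_nonneg_left sq hM)
    _ = (l * A⁻¹ * M) * (l * (N2 (-1) 1 g + N2 (-1) 1 g1)) := by rw [hL]; ring
    _ ≤ (l * A⁻¹ * M) * (L * (N2 0 (2*L) p + N2 0 (2*L) p1)) := by
        apply mul_le_mul_of_nonneg_left key (by positivity)
    _ = _ := by rw [hL]; ring

set_option maxHeartbeats 1600000 in
theorem scaled : ∃ K ε0 ν0 : ℝ, 0 < K ∧ 0 < ε0 ∧ 0 < ν0 ∧ ∀ (n q ε lam L : ℝ) (φ φ1 w w1 w2 F : ℝ → ℂ),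
    0 < n → n ≤ 1 → n^12 ≤ ν0 → 1 ≤ q → n^12 * q^24 ≤ 1 → 0 ≤ ε → ε ≤ ε0 → L = q^4/n^4 →
    (∀ x, HasDerivAt φ (φ1 x) x) → (∀ x, HasDerivAt φ1 (w x + ((q^12:ℝ):ℂ)^2 * φ x) x) →
    (∀ x, HasDerivAt w (w1 x) x) → (∀ x, HasDerivAt w1 (w2 x) x) → Continuous w2 →
    φ (-1) = 0 → φ 1 = 0 → φ1 (-1) = 0 → φ1 1 = 0 →
    (∀ y : ℝ, F y = -((n^12:ℝ):ℂ) * (w2 y - ((q^12:ℝ):ℂ)^2 * w y) + Complex.I * ((q^12:ℝ):ℂ) * ((y:ℂ) - (lam:ℂ)) * w y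
      - ((ε * n^4 * q^8:ℝ):ℂ) * w y) →
    (n^2 * q^10 * nL1 w + n^5 * q^10 * nL2 w ≤ K * nL2 F) ∧
    ∀ M : ℝ, 0 ≤ M → Dominates F M →
      n^9 * q^6 * nL2 w + n^8 * q^4 * (∫ y in Set.Icc (-1:ℝ) 1, rhoW L y * ‖w y‖^2) ^ ((1:ℝ)/2)
        + n^6 * q^12 * (nL2 φ1^2 + (q^12)^2 * nL2 φ^2) ^ ((1:ℝ)/2) ≤ K * M := by
  obtain ⟨K, ε0, ℓ0, hK, hε0, H⟩ := core
  refine ⟨3*K, ε0, (1/(max 1 ℓ0))^3, by positivity, hε0, by positivity, ?_⟩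
  intro n q ε lam L φ φ1 w w1 w2 F hn hn1 hnu hq hnq he he0 hL dφ dφ1 dw dw1 cw2 φa φb φ1a φ1b hF
  have hq0 : 0 < q := by linarith
  have hL0 : 0 < L := by rw [hL]; positivity
  have hLc : (L:ℂ) ≠ 0 := by exact_mod_cast hL0.ne'
  have hn4 : n^4 ≤ 1/(max 1 ℓ0) := by
    have : (n^4)^3 ≤ (1/(max 1 ℓ0))^3 := by rw [← pow_mul]; exact hnu
    exact (pow_le_pow_iff_left₀ (by positivity) (by positivity) (by norm_num)).1 this
  have hLm : max 1 ℓ0 ≤ L := by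
    have hmx : 0 < max 1 ℓ0 := lt_of_lt_of_le one_pos (le_max_left _ _)
    rw [le_div_iff₀ hmx] at hn4
    rw [hL, le_div_iff₀ (by positivity)]
    have : 1 ≤ q^4 := one_le_pow₀ hq
    linarith
  have hL1 : 1 ≤ L := (le_max_left _ _).trans hLm
  have hLℓ : ℓ0 ≤ L := (le_max_right _ _).trans hLm
  set l := q^2/n^2 with hl
  have hl0 : 0 < l := by positivity
  have hLl : L = l^2 := by rw [hL, hl]; field_simp
  set κ := q^8*n^4 with hκ
  have hκ0 : 0 < κ := by positivity
  have hκ1 : κ ≤ 1 := by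
    have : κ^3 ≤ 1 := by rw [hκ]; calc _ = n^12*q^24 := by ring
                                _ ≤ 1 := hnq
    exact (pow_le_one_iff_of_nonneg hκ0.le (by norm_num)).1 this
  have hκL : κ * L = q^12 := by rw [hκ, hL]; field_simp
  have hkl : 2 ≤ κ*(2*L) := by
    have : 1 ≤ q^12 := one_le_pow₀ hq
    linarith
  set A := n^4*q^8 with hA
  have hA0 : 0 < A := by positivity
  have hAc : (A:ℂ) ≠ 0 := by exact_mod_cast hA0.ne'
  have hAL2 : A = n^12 * L^2 := by rw [hA, hL]; field_simp
  have hAL : A * L = q^12 := by rw [hA, hL]; field_simp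
  have hAk : A * κ^2 = n^12 * (q^12)^2 := by rw [hA, hκ]; ring
  have cw : Continuous w := continuous_iff_continuousAt.2 fun x => (dw x).continuousAt
  have inv0 : (0:ℝ)/L - 1 = -1 := by simp
  have invl : 2*L/L - 1 = 1 := by field_simp; norm_num
  have hc : Core (2*L) (L*(lam+1)) κ ε (fun s => w (s/L-1)) (fun s => (L:ℂ)⁻¹ * w1 (s/L-1)) (fun s => (L:ℂ)⁻¹ * ((L:ℂ)⁻¹ * w2 (s/L-1)))
      (fun s => (L:ℂ)^2 * φ (s/L-1)) (fun s => (L:ℂ) * φ1 (s/L-1)) (fun s => (A:ℂ)⁻¹ * F (s/L-1)) :=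
    { d1 := comp_scale_deriv hL0 dw
      d2 := fun s => (comp_scale_deriv hL0 dw1 s).const_mul _
      c2 := by fun_prop
      hG := fun s => by
        rw [hF]
        have e1 : (A:ℂ) = ((n^12:ℝ):ℂ) * (L:ℂ)^2 := by exact_mod_cast hAL2
        have e2 : (A:ℂ) * (L:ℂ) = ((q^12:ℝ):ℂ) := by exact_mod_cast hAL
        have e3 : (A:ℂ) * (κ:ℂ)^2 = ((n^12:ℝ):ℂ) * ((q^12:ℝ):ℂ)^2 := by exact_mod_cast hAk
        have e4 : ((ε * n^4 * q^8:ℝ):ℂ) = (ε:ℂ) * (A:ℂ) := by rw [hA]; push_cast; ring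
        rw [e4]
        apply mul_left_cancel₀ hAc
        rw [← mul_assoc, mul_inv_cancel₀ hAc, one_mul]
        have e5 : (A:ℂ) * ((L:ℂ)⁻¹ * ((L:ℂ)⁻¹ * w2 (s/L-1))) = ((n^12:ℝ):ℂ) * w2 (s/L-1) := by
          rw [e1]; field_simp
        have e6 : (A:ℂ) * ((s - L*(lam+1):ℝ):ℂ) = ((q^12:ℝ):ℂ) * (((s/L-1:ℝ):ℂ) - (lam:ℂ)) := by
          rw [← e2]; push_cast; field_simp; ring
        push_cast at e3 e5 e6 ⊢
        linear_combination (-(w (s/L-1))) * e3 + e5 - (Complex.I * w (s/L-1)) * e6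
      hΦ := fun s => by
        have := (comp_scale_deriv hL0 dφ s).const_mul ((L:ℂ)^2)
        refine HasDerivAt.congr_deriv this ?_
        field_simp
      hΦ1 := fun s => by
        have := (comp_scale_deriv hL0 dφ1 s).const_mul (L:ℂ)
        refine HasDerivAt.congr_deriv this ?_
        have e2 : ((q^12:ℝ):ℂ) = (κ:ℂ) * (L:ℂ) := by exact_mod_cast hκL.symm
        rw [e2]
        field_simp
      a0 := by simp only [inv0, φa, mul_zero]
      al := by simp only [invl, φb, mul_zero]
      b0 := by simp only [inv0, φ1a, mul_zero]
      bl := by simp only [invl, φ1b, mul_zero] }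
  obtain ⟨⟨p1, p2⟩, P⟩ := H (2*L) (L*(lam+1)) κ ε (q^2*n) _ _ _ _ _ _ hc hκ0 hκ1 hkl (by linarith) he he0 (by positivity) (by rw [hκ]; ring)
  have nG : N2 0 (2*L) (fun s => (A:ℂ)⁻¹ * F (s/L-1)) = A⁻¹ * (l * nL2 F) := by
    rw [N2_smul, N2_scale hl0 hLl, nL2_eq, norm_inv, Complex.norm_real, Real.norm_of_nonneg hA0.le]
  have nw : N2 0 (2*L) (fun s => w (s/L-1)) = l * nL2 w := by rw [N2_scale hl0 hLl, nL2_eq]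
  have n0w : 0 ≤ nL2 w := by rw [nL2_eq]; exact N2_nonneg _ _ _
  have n0F : 0 ≤ nL2 F := by rw [nL2_eq]; exact N2_nonneg _ _ _
  constructor
  · rw [nG, nw] at p1
    rw [nG, scale_int hL0 (fun y => ‖w y‖), ← icc_int, smul_eq_mul] at p2
    change L * nL1 w ≤ _ at p2
    have r1 : n^5 * q^10 * nL2 w ≤ K * nL2 F := by
      have := mul_le_mul_of_nonneg_left p1 (show 0 ≤ A * l⁻¹ by positivity)
      calc _ = A * l⁻¹ * (q^2*n*(l * nL2 w)) := by rw [hA]; field_simp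
        _ ≤ _ := this
        _ = _ := by field_simp
    have r2 : n^2 * q^10 * nL1 w ≤ K * nL2 F := by
      have := mul_le_mul_of_nonneg_left p2 (show 0 ≤ A * l⁻¹ by positivity)
      calc _ = A * l⁻¹ * (L * nL1 w) := by rw [hA, hLl, hl]; field_simp
        _ ≤ _ := this
        _ = _ := by field_simp
    have : 0 ≤ K * nL2 F := by positivity
    linarith
  · intro M hM hD
    obtain ⟨s1, s2, s3⟩ := P _ (by positivity) (dom_scale hl0 hLl hL1 hA0 hM hD)
    have hf : 0 ≤ A * (l^3)⁻¹ := by positivity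
    have fin : A * (l^3)⁻¹ * (K * (l^3 * A⁻¹ * M)) = K * M := by field_simp
    have r1 : n^9 * q^6 * nL2 w ≤ K * M := by
      rw [nw] at s1
      calc _ = A * (l^3)⁻¹ * (q^2*n*(l * nL2 w)) := by rw [hA, hl]; field_simp
        _ ≤ _ := mul_le_mul_of_nonneg_left s1 hf
        _ = _ := fin
    have r2 : n^8 * q^4 * (∫ y in Set.Icc (-1:ℝ) 1, rhoW L y * ‖w y‖^2) ^ ((1:ℝ)/2) ≤ K * M := by
      have rb := rho_bound hl0 hLl hL1 cw
      calc _ = A * (l^3)⁻¹ * (l * (∫ y in Set.Icc (-1:ℝ) 1, rhoW L y * ‖w y‖^2) ^ ((1:ℝ)/2)) := by rw [hA, hl]; field_simp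
        _ ≤ _ := mul_le_mul_of_nonneg_left (rb.trans s2) hf
        _ = _ := fin
    have r3 : n^6 * q^12 * (nL2 φ1^2 + (q^12)^2 * nL2 φ^2) ^ ((1:ℝ)/2) ≤ K * M := by
      have e : Real.sqrt (N2 0 (2*L) (fun s => (L:ℂ) * φ1 (s/L-1))^2 + κ^2 * N2 0 (2*L) (fun s => (L:ℂ)^2 * φ (s/L-1))^2)
          = L * l * (nL2 φ1^2 + (q^12)^2 * nL2 φ^2) ^ ((1:ℝ)/2) := by
        rw [N2_smul, N2_smul, N2_scale hl0 hLl, N2_scale hl0 hLl, norm_pow, Complex.norm_real, Real.norm_of_nonneg hL0.le, ← nL2_eq, ← nL2_eq, ← Real.sqrt_eq_rpow, ← hκL]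
        rw [show (L * (l * nL2 φ1))^2 + κ^2 * (L^2 * (l * nL2 φ))^2 = (L*l)^2 * (nL2 φ1^2 + (κ*L)^2 * nL2 φ^2) by ring,
          Real.sqrt_mul (by positivity), Real.sqrt_sq (by positivity)]
      rw [e] at s3
      calc _ = A * (l^3)⁻¹ * ((q^2*n)^2 * (L * l * (nL2 φ1^2 + (q^12)^2 * nL2 φ^2) ^ ((1:ℝ)/2))) := by rw [hA, hLl, hl]; field_simp
        _ ≤ _ := mul_le_mul_of_nonneg_left s3 hf
        _ = _ := fin
    linarith

lemma conj_deriv {f : ℝ → ℂ} {d : ℂ} {x : ℝ} (h : HasDerivAt f d x) :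
    HasDerivAt (fun y => (starRingEnd ℂ) (f y)) ((starRingEnd ℂ) d) x := by
  have := (Complex.conjCLE.toContinuousLinearMap.hasFDerivAt (x := f x)).comp_hasDerivAt x h
  exact this

lemma nL2_conj (f : ℝ → ℂ) : nL2 (fun y => (starRingEnd ℂ) (f y)) = nL2 f := by
  unfold nL2; simp only [RCLike.norm_conj]

lemma nL1_conj (f : ℝ → ℂ) : nL1 (fun y => (starRingEnd ℂ) (f y)) = nL1 f := by
  unfold nL1; simp only [RCLike.norm_conj]

lemma dom_conj {F : ℝ → ℂ} {M : ℝ} (h : Dominates F M) : Dominates (fun y => (starRingEnd ℂ) (F y)) M := by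
  intro g hg g0 g1
  have hd : deriv (fun y => (starRingEnd ℂ) (g y)) = fun y => (starRingEnd ℂ) (deriv g y) := by
    funext y
    exact (conj_deriv ((hg.differentiable (by norm_num)) y).hasDerivAt).deriv
  have hc : ContDiff ℝ 1 (fun y => (starRingEnd ℂ) (g y)) :=
    Complex.conjCLE.toContinuousLinearMap.contDiff.comp hg
  have := h _ hc (by simp [g0]) (by simp [g1])
  rw [hd, nL2_conj, nL2_conj] at this
  refine le_trans (le_of_eq ?_) this
  have : innI (fun y => (starRingEnd ℂ) (F y)) g = (starRingEnd ℂ) (innI F (fun y => (starRingEnd ℂ) (g y))) := by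
    unfold innI
    rw [← integral_conj]
    simp
  rw [this, RCLike.norm_conj]

theorem scaled2 : ∃ K ε0 ν0 : ℝ, 0 < K ∧ 0 < ε0 ∧ 0 < ν0 ∧ ∀ (n q κ ε lam L : ℝ) (φ φ1 w w1 w2 F : ℝ → ℂ),
    |κ| = q^12 →
    0 < n → n ≤ 1 → n^12 ≤ ν0 → 1 ≤ q → n^12 * q^24 ≤ 1 → 0 ≤ ε → ε ≤ ε0 → L = q^4/n^4 →
    (∀ x, HasDerivAt φ (φ1 x) x) → (∀ x, HasDerivAt φ1 (w x + (κ:ℂ)^2 * φ x) x) →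
    (∀ x, HasDerivAt w (w1 x) x) → (∀ x, HasDerivAt w1 (w2 x) x) → Continuous w2 →
    φ (-1) = 0 → φ 1 = 0 → φ1 (-1) = 0 → φ1 1 = 0 →
    (∀ y : ℝ, F y = -((n^12:ℝ):ℂ) * (w2 y - (κ:ℂ)^2 * w y) + Complex.I * (κ:ℂ) * ((y:ℂ) - (lam:ℂ)) * w y
      - ((ε * n^4 * q^8:ℝ):ℂ) * w y) →
    (n^2*q^10*nL1 w + n^5*q^10*nL2 w ≤ K*nL2 F) ∧ ∀ M, 0 ≤ M → Dominates F M →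
      n^9*q^6*nL2 w + n^8*q^4*(∫ y in Icc (-1:ℝ) 1, rhoW L y*‖w y‖^2)^((1:ℝ)/2)
        + n^6*q^12*(nL2 φ1^2+(q^12)^2*nL2 φ^2)^((1:ℝ)/2) ≤ K*M := by
  obtain ⟨K, ε0, ν0, hK, hε, hν, H⟩ := scaled
  refine ⟨K, ε0, ν0, hK, hε, hν, ?_⟩
  intro n q κ ε lam L φ φ1 w w1 w2 F hκ hn hn1 hnν hq hnq e0 e1 hL d1 d2 d3 d4 cw b1 b2 b3 b4 hF
  rcases le_total 0 κ with hk | hk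
  · rw [abs_of_nonneg hk] at hκ
    subst hκ
    exact H n q ε lam L φ φ1 w w1 w2 F hn hn1 hnν hq hnq e0 e1 hL d1 d2 d3 d4 cw b1 b2 b3 b4 hF
  · rw [abs_of_nonpos hk] at hκ
    have hκ' : (((q^12:ℝ)):ℂ) = -(κ:ℂ) := by rw [← hκ]; push_cast; ring
    have := H n q ε lam L (fun y => (starRingEnd ℂ) (φ y)) (fun y => (starRingEnd ℂ) (φ1 y))
      (fun y => (starRingEnd ℂ) (w y)) (fun y => (starRingEnd ℂ) (w1 y)) (fun y => (starRingEnd ℂ) (w2 y))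
      (fun y => (starRingEnd ℂ) (F y)) hn hn1 hnν hq hnq e0 e1 hL
      (fun x => conj_deriv (d1 x))
      (fun x => by
        refine HasDerivAt.congr_deriv (conj_deriv (d2 x)) ?_
        rw [hκ', map_add, map_mul, map_pow, Complex.conj_ofReal]; ring)
      (fun x => conj_deriv (d3 x)) (fun x => conj_deriv (d4 x))
      (Complex.continuous_conj.comp cw)
      (by simp [b1]) (by simp [b2]) (by simp [b3]) (by simp [b4])
      (fun y => by
        rw [hF y, hκ']
        simp only [map_sub, map_add, map_mul, map_neg, map_pow, Complex.conj_ofReal, Complex.conj_I]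
        ring)
    simp only [nL2_conj, nL1_conj, RCLike.norm_conj] at this
    exact ⟨this.1, fun M hM hD => this.2 M hM (dom_conj hD)⟩

lemma rpow_tw {x : ℝ} (hx : 0 ≤ x) (a : ℝ) (m : ℕ) (h : a = (1/12) * m) : x ^ a = (x ^ ((1:ℝ)/12)) ^ m := by
  rw [h, Real.rpow_mul hx, Real.rpow_natCast]

end Helpers

set_option maxHeartbeats 1600000 in
/-- Resolvent estimates with non-slip boundary condition in the regime `ν k² ≤ 1`. -/
theorem statement10 :
    ∃ ν₀ ε₀ C : ℝ, 0 < ν₀ ∧ ν₀ ≤ 1 ∧ 0 < ε₀ ∧ ε₀ < 1 ∧ 0 < C ∧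
      ∀ (ν : ℝ) (k : ℤ) (ε lam L : ℝ) (φ w F : ℝ → ℂ),
        0 < ν → ν ≤ ν₀ → 1 ≤ |k| → ν * (k:ℝ)^2 ≤ 1 → 0 < ε → ε ≤ ε₀ →
        L = (|(k:ℝ)| / ν) ^ ((1:ℝ)/3) →
        ContDiff ℝ 4 φ →
        φ (-1) = 0 → φ 1 = 0 → deriv φ (-1) = 0 → deriv φ 1 = 0 →
        (w = fun y : ℝ => deriv (deriv φ) y - (k:ℂ)^2 * φ y) →
        (F = fun y : ℝ => -(ν : ℂ) * (deriv (deriv w) y - (k:ℂ)^2 * w y)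
            + Complex.I * (k:ℂ) * ((y:ℂ) - (lam:ℂ)) * w y
            - ((ε * ν ^ ((1:ℝ)/3) * |(k:ℝ)| ^ ((2:ℝ)/3) : ℝ) : ℂ) * w y) →
        (ν ^ ((1:ℝ)/6) * |(k:ℝ)| ^ ((5:ℝ)/6) * nL1 w
            + ν ^ ((5:ℝ)/12) * |(k:ℝ)| ^ ((5:ℝ)/6) * nL2 w ≤ C * nL2 F)
        ∧ ∀ M : ℝ, 0 ≤ M → Dominates F M →
            ν ^ ((3:ℝ)/4) * |(k:ℝ)| ^ ((1:ℝ)/2) * nL2 w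
              + ν ^ ((2:ℝ)/3) * |(k:ℝ)| ^ ((1:ℝ)/3) *
                  ((∫ y in Set.Icc (-1:ℝ) 1, rhoW L y * ‖w y‖^2) ^ ((1:ℝ)/2))
              + (ν * (k:ℝ)^2) ^ ((1:ℝ)/2) *
                  ((nL2 (deriv φ) ^ 2 + (k:ℝ)^2 * nL2 φ ^ 2) ^ ((1:ℝ)/2))
              ≤ C * M := by
  obtain ⟨K, ε0, ν0, hK, hε0, hν0, H⟩ := scaled2
  refine ⟨min 1 ν0, min ε0 (1/2), K, by positivity, min_le_left _ _, by positivity,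
    lt_of_le_of_lt (min_le_right _ _) (by norm_num), hK, ?_⟩
  intro ν k ε lam L φ w F hν hν1 hk1 hνk hε hε1 hL hφ b1 b2 b3 b4 hw hF
  have hk : (1:ℝ) ≤ |(k:ℝ)| := by exact_mod_cast hk1
  have hk0 : (0:ℝ) ≤ |(k:ℝ)| := abs_nonneg _
  have hν' : ν ≤ 1 := hν1.trans (min_le_left _ _)
  obtain ⟨n, hn⟩ : ∃ n, n = ν ^ ((1:ℝ)/12) := ⟨_, rfl⟩
  obtain ⟨q, hq⟩ : ∃ q, q = |(k:ℝ)| ^ ((1:ℝ)/12) := ⟨_, rfl⟩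
  have n12 : n^12 = ν := by
    rw [hn, ← rpow_tw hν.le 1 12 (by norm_num), Real.rpow_one]
  have q12 : |(k:ℝ)| = q^12 := by
    rw [hq, ← rpow_tw hk0 1 12 (by norm_num), Real.rpow_one]
  have n0 : 0 < n := by rw [hn]; positivity
  have n1 : n ≤ 1 := by rw [hn]; exact Real.rpow_le_one hν.le hν' (by norm_num)
  have q1 : 1 ≤ q := by rw [hq]; exact Real.one_le_rpow hk (by norm_num)
  have k2 : (k:ℝ)^2 = (q^12)^2 := by rw [← q12, sq_abs]
  have N : ∀ (a : ℝ) (m : ℕ), a = (1/12) * m → ν ^ a = n^m := fun a m h => by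
    rw [hn]; exact rpow_tw hν.le a m h
  have Q : ∀ (a : ℝ) (m : ℕ), a = (1/12) * m → |(k:ℝ)| ^ a = q^m := fun a m h => by
    rw [hq]; exact rpow_tw hk0 a m h
  have hs : (ν * (k:ℝ)^2) ^ ((1:ℝ)/2) = n^6 * q^12 := by
    rw [← Real.sqrt_eq_rpow, ← n12, k2, show n^12 * (q^12)^2 = (n^6*q^12)^2 by ring]
    exact Real.sqrt_sq (by positivity)
  have hL' : L = q^4/n^4 := by
    rw [hL, Real.div_rpow hk0 hν.le, N _ 4 (by norm_num), Q _ 4 (by norm_num)]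
  rw [N ((1:ℝ)/3) 4 (by norm_num), Q ((2:ℝ)/3) 8 (by norm_num)] at hF
  rw [N ((1:ℝ)/6) 2 (by norm_num), Q ((5:ℝ)/6) 10 (by norm_num), N ((5:ℝ)/12) 5 (by norm_num),
    N ((3:ℝ)/4) 9 (by norm_num), Q ((1:ℝ)/2) 6 (by norm_num), N ((2:ℝ)/3) 8 (by norm_num),
    Q ((1:ℝ)/3) 4 (by norm_num), hs, k2]
  have c1 : ContDiff ℝ 3 (deriv φ) := (contDiff_succ_iff_deriv (n := 3)).1 (by exact_mod_cast hφ) |>.2.2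
  have c2 : ContDiff ℝ 2 (deriv (deriv φ)) := (contDiff_succ_iff_deriv (n := 2)).1 (by exact_mod_cast c1) |>.2.2
  have c3 : ContDiff ℝ 1 (deriv (deriv (deriv φ))) := (contDiff_succ_iff_deriv (n := 1)).1 (by exact_mod_cast c2) |>.2.2
  have c4 : Continuous (deriv (deriv (deriv (deriv φ)))) := c3.continuous_deriv le_rfl
  have e0 : ∀ x, HasDerivAt φ (deriv φ x) x := fun x => (hφ.differentiable (by norm_num) x).hasDerivAt
  have e1 : ∀ x, HasDerivAt (deriv φ) (deriv (deriv φ) x) x := fun x => (c1.differentiable (by norm_num) x).hasDerivAt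
  have e2 : ∀ x, HasDerivAt (deriv (deriv φ)) (deriv (deriv (deriv φ)) x) x := fun x => (c2.differentiable (by norm_num) x).hasDerivAt
  have e3 : ∀ x, HasDerivAt (deriv (deriv (deriv φ))) (deriv (deriv (deriv (deriv φ))) x) x := fun x => (c3.differentiable (by norm_num) x).hasDerivAt
  have dw : ∀ x, HasDerivAt w (deriv (deriv (deriv φ)) x - (k:ℂ)^2 * deriv φ x) x := by
    intro x; rw [hw]; exact (e2 x).sub ((e0 x).const_mul _)
  have dw1 : ∀ x, HasDerivAt (fun x => deriv (deriv (deriv φ)) x - (k:ℂ)^2 * deriv φ x)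
      (deriv (deriv (deriv (deriv φ))) x - (k:ℂ)^2 * deriv (deriv φ) x) x := fun x =>
    (e3 x).sub ((e1 x).const_mul _)
  have ew : deriv w = fun x => deriv (deriv (deriv φ)) x - (k:ℂ)^2 * deriv φ x := funext fun x => (dw x).deriv
  refine H n q k ε lam L φ (deriv φ) w (deriv w) (deriv (deriv w)) F q12 n0 n1
    (by rw [n12]; exact hν1.trans (min_le_right _ _)) q1 ?_ hε.le (hε1.trans (min_le_left _ _)) hL' e0 ?_ ?_ ?_ ?_ b1 b2 b3 b4 ?_
  · rw [k2, ← n12] at hνk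
    calc n^12*q^24 = n^12*(q^12)^2 := by ring
      _ ≤ 1 := hνk
  · intro x
    refine HasDerivAt.congr_deriv (e1 x) ?_
    rw [hw]; push_cast; ring
  · intro x; rw [ew]; exact dw x
  · intro x; rw [ew]; exact (dw1 x).differentiableAt.hasDerivAt
  · have : deriv (deriv w) = fun x => deriv (deriv (deriv (deriv φ))) x - (k:ℂ)^2 * deriv (deriv φ) x := by
      rw [ew]; exact funext fun x => (dw1 x).deriv
    rw [this]
    exact c4.sub (continuous_const.mul c2.continuous)
  · intro y
    have := congrFun hF y
    rw [this, n12]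
    push_cast
    ring
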